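/- arXiv:0902.2102 — 2 statements merged into one kernel-verified Lean document; each statement's English description precedes it below -/
import Mathlib

section
/- Let f_ε be the test function built from Lipschitz A, B with supp A ⊆ [0,1], ∫A = 0, supp B ⊆ [−1,1]. Then supp f_ε ⊆ [−1,1]×[−1,1] and ‖f_ε‖_{BMO_d} ≤ C with C independent of ε; consequently ‖f_ε‖_{L^p(ℝ²)} ≤ C_p for every 1 < p < ∞, with C_p independent of ε. -/
open MeasureTheory Filter
open scoped ENNReal Topology
noncomputable section
/-- The Haar function on `[0,1)`. -/
def haar0 (x : ℝ) : ℝ :=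
  Set.indicator (Set.Ico (0:ℝ) (1/2)) (fun _ => (1:ℝ)) x
    - Set.indicator (Set.Ico (1/2:ℝ) 1) (fun _ => (1:ℝ)) x
/-- A dyadic cube in `ℝ^n`, recorded by the exponent `k` of its side length `2^k`
and the position `pos`; the cube is `∏_t [pos t · 2^k, (pos t + 1) · 2^k)`. -/
abbrev DyadicCube (n : ℕ) := ℤ × (Fin n → ℤ)
/-- The (L∞-normalized) Haar function on the dyadic interval `[i·2^k, (i+1)·2^k)`. -/
def haarInt (k i : ℤ) (x : ℝ) : ℝ := haar0 ((x - (i : ℝ) * 2 ^ k) / 2 ^ k)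
/-- The indicator of the dyadic interval `[i·2^k, (i+1)·2^k)`. -/
def indInt (k i : ℤ) (x : ℝ) : ℝ :=
  Set.indicator (Set.Ico ((i:ℝ) * 2 ^ k) (((i:ℝ)+1) * 2 ^ k)) (fun _ => (1:ℝ)) x
/-- The Haar function `h_Q^{(ε)}` on a dyadic cube `Q` with direction `ε ∈ {0,1}^n`:
the factor in coordinate `t` is `h_{I_t}` if `ε t` and `1_{I_t}` otherwise. -/
def haarCube (n : ℕ) (ε : Fin n → Bool) (Q : DyadicCube n) (x : Fin n → ℝ) : ℝ :=
  ∏ t, (if ε t then haarInt Q.1 (Q.2 t) (x t) else indInt Q.1 (Q.2 t) (x t))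
/-- The volume `|Q| = 2^{kn}` of a dyadic cube. -/
def cubeVol (n : ℕ) (Q : DyadicCube n) : ℝ := 2 ^ (Q.1 * (n:ℤ))
/-- The pointset of a dyadic cube. -/
def cubeSet (n : ℕ) (Q : DyadicCube n) : Set (Fin n → ℝ) :=
  Set.univ.pi fun t => Set.Ico ((Q.2 t : ℝ) * 2 ^ Q.1) (((Q.2 t : ℝ) + 1) * 2 ^ Q.1)
/-- The directional Haar projection `P^{(ε)}`. -/
def haarProj (n : ℕ) (ε : Fin n → Bool) (u : (Fin n → ℝ) → ℝ) (x : Fin n → ℝ) : ℝ :=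
  ∑' Q : DyadicCube n, (∫ y, u y * haarCube n ε Q y) * haarCube n ε Q x / cubeVol n Q
/-- The Fourier transform `ℱu(ξ) = ∫ e^{-i⟨x,ξ⟩} u(x) dx`. -/
def fourierT (n : ℕ) (u : (Fin n → ℝ) → ℂ) (ξ : Fin n → ℝ) : ℂ :=
  ∫ x : Fin n → ℝ, Complex.exp (-(Complex.I) * ((∑ t, x t * ξ t : ℝ) : ℂ)) * u x
/-- The inverse Fourier transform. -/
def invFourierT (n : ℕ) (v : (Fin n → ℝ) → ℂ) (x : Fin n → ℝ) : ℂ :=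
  (((2 * Real.pi) ^ n : ℝ) : ℂ)⁻¹ *
    ∫ ξ : Fin n → ℝ, Complex.exp (Complex.I * ((∑ t, x t * ξ t : ℝ) : ℂ)) * v ξ
/-- The Riesz transform `R_i u = -√-1 ℱ⁻¹((ξ_i/|ξ|) ℱu)`. -/
def riesz (n : ℕ) (i : Fin n) (u : (Fin n → ℝ) → ℝ) (x : Fin n → ℝ) : ℂ :=
  -(Complex.I) * invFourierT n
    (fun ξ => ((ξ i / Real.sqrt (∑ t, ξ t ^ 2) : ℝ) : ℂ) * fourierT n (fun y => ((u y : ℝ) : ℂ)) ξ) x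
/-- The `j`-th standard direction `e_j`. -/
def stdDir (n : ℕ) (j : Fin n) : Fin n → Bool := fun t => decide (t = j)
end
noncomputable section
/-- The rescaled building block `g_Q = s_I ⊗ d_J` on the dyadic square
`Q = [l_I, l_I + 2^{-j}) × [l_J, l_J + 2^{-j})`:
`g_Q(x) = A((x₁ − l_I)·2^j) · B((x₂ − l_J)·2^j / ε)` with `ε = 2^{-n0}`. -/
def gBlock (A B : ℝ → ℝ) (n0 : ℕ) (j : ℕ) (lI lJ : ℝ) (x : Fin 2 → ℝ) : ℝ :=
  A ((x 0 - lI) * 2 ^ j) * B ((x 1 - lJ) * 2 ^ j * 2 ^ n0)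
/-- The test function `f_ε = Σ_{k=1}^{1/ε} Σ_{I ∈ 𝒟_{2kn₀}} Σ_{J ∈ 𝓛_{2kn₀}} g_{I×J}`,
where `ε = 2^{-n0}`, `𝒟_j` are the dyadic subintervals of `[0,1]` of length `2^{-j}`
and `𝓛_j ⊆ 𝒟_j` are the even-numbered ones. -/
def fTest (A B : ℝ → ℝ) (n0 : ℕ) (x : Fin 2 → ℝ) : ℝ :=
  ∑ k ∈ Finset.Icc 1 (2 ^ n0), ∑ i ∈ Finset.range (2 ^ (2 * k * n0)),
    ∑ i' ∈ Finset.range (2 ^ (2 * k * n0 - 1)),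
      gBlock A B n0 (2 * k * n0) ((i : ℝ) * 2 ^ (-(2 * k * n0 : ℤ)))
        ((2 * i' : ℝ) * 2 ^ (-(2 * k * n0 : ℤ))) x
end
noncomputable section
/-- The mean of `f` over a set `s` of volume `v`. -/
def meanOn (n : ℕ) (s : Set (Fin n → ℝ)) (v : ℝ) (f : (Fin n → ℝ) → ℝ) : ℝ :=
  v⁻¹ * ∫ y in s, f y
/-- The dyadic BMO norm,
`‖f‖²_{BMO_d} = |∫f|² + sup_{Q dyadic} |Q|⁻¹ ∫_Q |f − m_Q(f)|²`. -/
def bmoD (n : ℕ) (f : (Fin n → ℝ) → ℝ) : ℝ≥0∞ :=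
  (ENNReal.ofReal |∫ x, f x| ^ 2 +
    ⨆ Q : DyadicCube n,
      ENNReal.ofReal ((cubeVol n Q)⁻¹ *
        ∫ x in cubeSet n Q, (f x - meanOn n (cubeSet n Q) (cubeVol n Q) f) ^ 2)) ^ ((1:ℝ)/2)
end

/-- The points whose dilation by `2 ^ (2 * k * n0)` lies within `2 ^ (-n0)` of an integer. -/
def nearInt (n0 k : ℕ) : Set ℝ := {t | ∃ r : ℤ, |t * 2 ^ (2 * k * n0) - r| * 2 ^ n0 < 1}

/-- The number of levels `k ∈ s` at which `t` lies in `nearInt n0 k`. -/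
noncomputable def hitCount (n0 : ℕ) (s : Finset ℕ) (t : ℝ) : ℕ :=
  ∑ k ∈ s, (nearInt n0 k).indicator (fun _ => 1) t

lemma measurableSet_nearInt (n0 k : ℕ) : MeasurableSet (nearInt n0 k) := by
  have : nearInt n0 k = ⋃ r : ℤ, {t : ℝ | |t * 2 ^ (2 * k * n0) - r| * 2 ^ n0 < 1} := by
    ext; simp [nearInt]
  rw [this]
  exact MeasurableSet.iUnion fun r => measurableSet_lt (by fun_prop) (by fun_prop)

lemma measurable_hitCount (n0 : ℕ) (s : Finset ℕ) : Measurable (hitCount n0 s) :=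
  Finset.measurable_sum _ fun k _ => measurable_const.indicator (measurableSet_nearInt n0 k)

lemma setLIntegral_Ico_le_nat_mul (g : ℝ → ℝ≥0∞) {δ : ℝ} {c : ℝ≥0∞}
    (h : ∀ q : ℤ, ∫⁻ t in Set.Ico (q * δ) ((q + 1) * δ), g t ≤ c) (q : ℤ) (M : ℕ) :
    ∫⁻ t in Set.Ico (q * δ) ((q + M) * δ), g t ≤ M * c := by
  induction M with
  | zero => simp
  | succ M ih =>
    have h1 : Set.Ico (q * δ) ((q + (M + 1 : ℕ)) * δ) ⊆
        Set.Ico (q * δ) ((q + M) * δ) ∪ Set.Ico (((q + M : ℤ) : ℝ) * δ) (((q + M : ℤ) + 1) * δ) := by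
      intro t ht
      rcases lt_or_ge t ((q + M) * δ) with h | h
      · exact Or.inl ⟨ht.1, h⟩
      · refine Or.inr ⟨by push_cast; exact h, ?_⟩
        have := ht.2
        push_cast at this ⊢
        linarith
    calc _ ≤ _ := lintegral_mono_set h1
      _ ≤ _ := lintegral_union_le _ _ _
      _ ≤ M * c + c := add_le_add ih (h _)
      _ = _ := by push_cast; ring

lemma mem_Ico_union_of_mem_nearInt (n0 k : ℕ) (q : ℤ) {t : ℝ} (ht : t ∈ nearInt n0 k)
    (hq : t ∈ Set.Ico (q * (2 : ℝ) ^ (-(2 * k * n0 : ℤ))) ((q + 1) * 2 ^ (-(2 * k * n0 : ℤ)))) :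
    t ∈ Set.Ico (((q * 2 ^ n0 : ℤ) : ℝ) * (2 : ℝ) ^ (-(2 * k * n0 + n0 : ℤ)))
        (((q * 2 ^ n0 : ℤ) + 1) * 2 ^ (-(2 * k * n0 + n0 : ℤ))) ∪
      Set.Ico ((((q + 1) * 2 ^ n0 - 1 : ℤ) : ℝ) * (2 : ℝ) ^ (-(2 * k * n0 + n0 : ℤ)))
        ((((q + 1) * 2 ^ n0 - 1 : ℤ) + 1) * 2 ^ (-(2 * k * n0 + n0 : ℤ))) := by
  obtain ⟨r, hr⟩ := ht
  have e1 : (2 : ℝ) ^ (-(2 * k * n0 : ℤ)) = (2 ^ (2 * k * n0))⁻¹ := by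
    rw [zpow_neg]; norm_cast
  have e2 : (2 : ℝ) ^ (-(2 * k * n0 + n0 : ℤ)) = (2 ^ (2 * k * n0) * 2 ^ n0)⁻¹ := by
    rw [zpow_neg, ← pow_add]; norm_cast
  rw [e1] at hq
  rw [e2]
  generalize 2 * k * n0 = N at *
  have hN : (0 : ℝ) < 2 ^ N := by positivity
  have hn : (1 : ℝ) ≤ 2 ^ n0 := one_le_pow₀ (by norm_num)
  simp only [Set.mem_union, Set.mem_Ico, ← div_eq_mul_inv] at hq ⊢
  rw [div_le_iff₀ hN, lt_div_iff₀ hN] at hq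
  have hP : (0 : ℝ) < 2 ^ N * 2 ^ n0 := by positivity
  simp only [div_le_iff₀ hP, lt_div_iff₀ hP, ← mul_assoc]
  set u := t * 2 ^ N
  have hr1 : |u - r| < 1 := by nlinarith [abs_nonneg (u - r)]
  rw [abs_lt] at hr1
  have h1 : (q : ℝ) < r + 1 := by linarith
  have h2 : (r : ℝ) < q + 2 := by linarith
  have h1' : q < r + 1 := by exact_mod_cast h1
  have h2' : r < q + 2 := by exact_mod_cast h2
  have : r = q ∨ r = q + 1 := by omega
  rcases this with rfl | rfl
  · left
    have := mul_le_mul_of_nonneg_right (le_abs_self (u - r)) (by linarith : (0 : ℝ) ≤ 2 ^ n0)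
    push_cast
    constructor <;> nlinarith
  · right
    have := mul_le_mul_of_nonneg_right (neg_abs_le (u - ((q + 1 : ℤ) : ℝ)))
      (by linarith : (0 : ℝ) ≤ 2 ^ n0)
    push_cast at this hr ⊢
    constructor <;> nlinarith

lemma lintegral_two_pow_hitCount_le_pow (n0 : ℕ) (s : Finset ℕ) :
    ∀ κ : ℤ, (∀ k ∈ s, -(2 * k * n0 : ℤ) ≤ κ) → ∀ q : ℤ,
      ∫⁻ t in Set.Ico (q * (2 : ℝ) ^ κ) ((q + 1) * 2 ^ κ), 2 ^ hitCount n0 s t ≤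
        ENNReal.ofReal ((1 + 2 * (2 ^ n0)⁻¹) ^ s.card * 2 ^ κ) := by
  induction s using Finset.induction_on_min with
  | empty =>
    intro κ _ q
    simp [hitCount]
    ring_nf
    exact le_rfl
  | insert a s ha ih =>
    intro κ hκ q
    have has : a ∉ s := fun h => lt_irrefl _ (ha a h)
    have hc : ∀ t, hitCount n0 (insert a s) t =
        (nearInt n0 a).indicator (fun _ => 1) t + hitCount n0 s t := fun t => by
      simp [hitCount, Finset.sum_insert has]
    set P : ℝ → ℝ≥0∞ := fun t => 2 ^ hitCount n0 s t with hP
    have hPm : Measurable P := measurable_const.pow (measurable_hitCount n0 s)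
    set K : ℝ := (1 + 2 * (2 ^ n0)⁻¹) ^ s.card with hK
    have hK0 : 0 ≤ K := by positivity
    set N : ℤ := 2 * a * n0 with hN
    have hlevel : ∀ κ' : ℤ, -(N + n0) ≤ κ' → ∀ q : ℤ,
        ∫⁻ t in Set.Ico (q * (2 : ℝ) ^ κ') ((q + 1) * 2 ^ κ'), P t ≤
          ENNReal.ofReal (K * 2 ^ κ') := fun κ' h => ih κ' fun k hk => by
      have := ha k hk
      zify at this
      nlinarith
    have hunit : ∀ q : ℤ, ∫⁻ t in Set.Ico (q * (2 : ℝ) ^ (-N)) ((q + 1) * 2 ^ (-N)),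
        2 ^ hitCount n0 (insert a s) t ≤
          ENNReal.ofReal ((1 + 2 * (2 ^ n0)⁻¹) * K * 2 ^ (-N)) := by
      intro q
      set L := Set.Ico (((q * 2 ^ n0 : ℤ) : ℝ) * (2 : ℝ) ^ (-(N + n0)))
        (((q * 2 ^ n0 : ℤ) + 1) * 2 ^ (-(N + n0))) with hL
      set R := Set.Ico ((((q + 1) * 2 ^ n0 - 1 : ℤ) : ℝ) * (2 : ℝ) ^ (-(N + n0)))
        ((((q + 1) * 2 ^ n0 - 1 : ℤ) + 1) * 2 ^ (-(N + n0))) with hR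
      have hpt : ∀ t ∈ Set.Ico (q * (2 : ℝ) ^ (-N)) ((q + 1) * 2 ^ (-N)),
          2 ^ hitCount n0 (insert a s) t ≤ P t + (L.indicator P t + R.indicator P t) := by
        intro t ht
        rw [hc]
        by_cases h : t ∈ nearInt n0 a
        · rw [Set.indicator_of_mem h, pow_add, pow_one, two_mul]
          refine add_le_add le_rfl ?_
          rcases mem_Ico_union_of_mem_nearInt n0 a q h ht with h | h
          · rw [Set.indicator_of_mem (s := L) h]; exact le_self_add
          · rw [Set.indicator_of_mem (s := R) h]; exact le_add_self
        · rw [Set.indicator_of_notMem h, zero_add]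
          exact le_self_add
      calc _ ≤ ∫⁻ t in Set.Ico (q * (2 : ℝ) ^ (-N)) ((q + 1) * 2 ^ (-N)),
            (P t + (L.indicator P t + R.indicator P t)) :=
            setLIntegral_mono' measurableSet_Ico hpt
        _ = (∫⁻ t in Set.Ico (q * (2 : ℝ) ^ (-N)) ((q + 1) * 2 ^ (-N)), P t) +
            ((∫⁻ t in Set.Ico (q * (2 : ℝ) ^ (-N)) ((q + 1) * 2 ^ (-N)), L.indicator P t) +
            ∫⁻ t in Set.Ico (q * (2 : ℝ) ^ (-N)) ((q + 1) * 2 ^ (-N)), R.indicator P t) := by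
            rw [lintegral_add_left hPm, lintegral_add_left (hPm.indicator measurableSet_Ico)]
        _ ≤ ENNReal.ofReal (K * 2 ^ (-N)) + (ENNReal.ofReal (K * 2 ^ (-(N + n0))) +
            ENNReal.ofReal (K * 2 ^ (-(N + n0)))) := by
            refine add_le_add (hlevel _ (by omega) q) (add_le_add ?_ ?_)
            · refine (setLIntegral_le_lintegral _ _).trans ?_
              rw [lintegral_indicator measurableSet_Ico]
              exact hlevel _ le_rfl _
            · refine (setLIntegral_le_lintegral _ _).trans ?_
              rw [lintegral_indicator measurableSet_Ico]
              exact hlevel _ le_rfl _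
        _ = _ := by
            rw [← ENNReal.ofReal_add (by positivity) (by positivity),
              ← ENNReal.ofReal_add (by positivity) (by positivity)]
            congr 1
            rw [neg_add, zpow_add₀ (by norm_num), zpow_neg _ (n0 : ℤ), zpow_natCast]
            ring
    have hκN : 0 ≤ κ + N := by have := hκ a (Finset.mem_insert_self _ _); omega
    obtain ⟨M, hM⟩ := Int.eq_ofNat_of_zero_le hκN
    have hpow : (2 : ℝ) ^ κ = 2 ^ M * 2 ^ (-N) := by
      rw [← zpow_natCast, ← zpow_add₀ (by norm_num)]
      congr 1
      omega
    have := setLIntegral_Ico_le_nat_mul _ hunit (q * 2 ^ M) (2 ^ M)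
    rw [Finset.card_insert_of_notMem has, hpow]
    convert this using 1
    · congr 3
      · push_cast; ring
      · push_cast; ring
    · rw [← ENNReal.ofReal_natCast, ← ENNReal.ofReal_mul (by positivity)]
      congr 1
      push_cast
      ring

lemma lintegral_two_pow_hitCount_le (n0 : ℕ) {s : Finset ℕ} (hs : s.card ≤ 2 ^ n0) (κ : ℤ)
    (hκ : ∀ k ∈ s, -(2 * k * n0 : ℤ) ≤ κ) (q : ℤ) :
    ∫⁻ t in Set.Ico (q * (2 : ℝ) ^ κ) ((q + 1) * 2 ^ κ), 2 ^ hitCount n0 s t ≤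
      ENNReal.ofReal (Real.exp 2 * 2 ^ κ) := by
  refine (lintegral_two_pow_hitCount_le_pow n0 s κ hκ q).trans (ENNReal.ofReal_le_ofReal ?_)
  gcongr
  have h : (1 : ℝ) + 2 * (2 ^ n0)⁻¹ ≤ Real.exp (2 * (2 ^ n0)⁻¹) := by
    rw [add_comm]; exact Real.add_one_le_exp _
  calc (1 + 2 * ((2 : ℝ) ^ n0)⁻¹) ^ s.card ≤ Real.exp (2 * (2 ^ n0)⁻¹) ^ s.card := by gcongr
    _ ≤ Real.exp (2 * (2 ^ n0)⁻¹) ^ 2 ^ n0 :=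
        pow_le_pow_right₀ (Real.one_le_exp (by positivity)) hs
    _ = Real.exp 2 := by
        rw [← Real.exp_nat_mul]
        congr 1
        push_cast
        field_simp

/-- The part of `fTest` at level `k`. -/
noncomputable def fLevel (A B : ℝ → ℝ) (n0 k : ℕ) (x : Fin 2 → ℝ) : ℝ :=
  ∑ i ∈ Finset.range (2 ^ (2 * k * n0)), ∑ i' ∈ Finset.range (2 ^ (2 * k * n0 - 1)),
    gBlock A B n0 (2 * k * n0) ((i : ℝ) * 2 ^ (-(2 * k * n0 : ℤ)))
      ((2 * i' : ℝ) * 2 ^ (-(2 * k * n0 : ℤ))) x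

lemma fTest_eq_sum_fLevel (A B : ℝ → ℝ) (n0 : ℕ) (x : Fin 2 → ℝ) :
    fTest A B n0 x = ∑ k ∈ Finset.Icc 1 (2 ^ n0), fLevel A B n0 k x := rfl

lemma fLevel_eq_mul (A B : ℝ → ℝ) (n0 k : ℕ) (x : Fin 2 → ℝ) :
    fLevel A B n0 k x =
      (∑ i ∈ Finset.range (2 ^ (2 * k * n0)), A (x 0 * 2 ^ (2 * k * n0) - (i : ℤ))) *
      ∑ i ∈ Finset.range (2 ^ (2 * k * n0 - 1)),
        B ((x 1 * 2 ^ (2 * k * n0) - 2 * (i : ℤ)) * 2 ^ n0) := by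
  have e1 : (2 : ℝ) ^ (-(2 * k * n0 : ℤ)) = (2 ^ (2 * k * n0))⁻¹ := by
    rw [zpow_neg]; norm_cast
  rw [fLevel, Finset.sum_mul_sum]
  refine Finset.sum_congr rfl fun i _ => Finset.sum_congr rfl fun i' _ => ?_
  rw [gBlock, e1]
  congr 2
  · push_cast; field_simp
  · push_cast; field_simp

lemma exists_sum_range_eq_mul (ψ : ℤ → ℝ → ℝ) (e : ℤ) (s : Set ℝ)
    (h : ∀ u ∈ s, ∀ i ≠ e, ψ i u = 0) (M : ℕ) :
    ∃ c : ℝ, |c| ≤ 1 ∧ ∀ u ∈ s, ∑ i ∈ Finset.range M, ψ i u = c * ψ e u := by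
  by_cases he : 0 ≤ e ∧ e < M
  · obtain ⟨m, rfl⟩ := Int.eq_ofNat_of_zero_le he.1
    refine ⟨1, by simp, fun u hu => ?_⟩
    rw [one_mul]
    refine Finset.sum_eq_single_of_mem m (by simpa using he.2) fun i _ hi => h u hu _ ?_
    exact_mod_cast hi
  · refine ⟨0, by simp, fun u hu => ?_⟩
    rw [zero_mul]
    refine Finset.sum_eq_zero fun i hi => h u hu _ ?_
    rw [Finset.mem_range] at hi
    omega

lemma exists_fLevel_eq {A B : ℝ → ℝ} (hA : Function.support A ⊆ Set.Ioo 0 1)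
    (hB : Function.support B ⊆ Set.Ioo (-1) 1) {n0 : ℕ} (hn : 1 ≤ n0) (k : ℕ) (q0 q1 : ℤ) :
    ∃ (c : ℝ) (r : ℤ), |c| ≤ 1 ∧ ∀ x : Fin 2 → ℝ,
      x 0 * 2 ^ (2 * k * n0) ∈ Set.Ico (q0 : ℝ) (q0 + 1) →
      x 1 * 2 ^ (2 * k * n0) ∈ Set.Ico (q1 : ℝ) (q1 + 1) →
      fLevel A B n0 k x = c * (A (x 0 * 2 ^ (2 * k * n0) - q0) *
        B ((x 1 * 2 ^ (2 * k * n0) - r) * 2 ^ n0)) := by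
  obtain ⟨c, hc, hcA⟩ := exists_sum_range_eq_mul (fun i u => A (u - i)) q0 (Set.Ico (q0 : ℝ) (q0 + 1))
    (by
      intro u hu i hi
      by_contra hne
      have := hA hne
      have h1 : (i : ℝ) < q0 + 1 := by linarith [this.1, hu.2]
      have h2 : (q0 : ℝ) < i + 1 := by linarith [this.2, hu.1]
      norm_cast at h1 h2
      omega) (2 ^ (2 * k * n0))
  obtain ⟨d, hd, hdB⟩ := exists_sum_range_eq_mul (fun i u => B ((u - 2 * i) * 2 ^ n0))
    ((q1 + 1) / 2) (Set.Ico (q1 : ℝ) (q1 + 1))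
    (by
      intro u hu i hi
      by_contra hne
      have := hB hne
      have hp : (2 : ℝ) ≤ 2 ^ n0 := le_self_pow₀ (by norm_num) (by omega)
      have h1 : (u - 2 * i) < 1 / 2 := by by_contra! h; nlinarith [this.2]
      have h2 : -(1 / 2) < (u - 2 * i) := by by_contra! h; nlinarith [this.1]
      have h3 : (4 * i : ℝ) < 2 * q1 + 3 := by linarith [hu.2]
      have h4 : (2 * q1 : ℝ) < 4 * i + 1 := by linarith [hu.1]
      norm_cast at h3 h4
      omega) (2 ^ (2 * k * n0 - 1))
  refine ⟨c * d, 2 * ((q1 + 1) / 2), ?_, fun x h0 h1 => ?_⟩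
  · rw [abs_mul]
    exact mul_le_one₀ hc (abs_nonneg _) hd
  · rw [fLevel_eq_mul, hcA _ h0, hdB _ h1]
    push_cast
    ring

lemma abs_fLevel_le {A B : ℝ → ℝ} (hA : Function.support A ⊆ Set.Ioo 0 1)
    (hB : Function.support B ⊆ Set.Ioo (-1) 1) {L : ℝ} (hAL : ∀ u, |A u| ≤ L)
    (hBL : ∀ u, |B u| ≤ L) {n0 : ℕ} (hn : 1 ≤ n0) (k : ℕ) (x : Fin 2 → ℝ) :
    |fLevel A B n0 k x| ≤ L ^ 2 * ((nearInt n0 k).indicator (fun _ => 1) (x 1) : ℕ) := by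
  obtain ⟨c, r, hc, h⟩ := exists_fLevel_eq hA hB hn k ⌊x 0 * 2 ^ (2 * k * n0)⌋
    ⌊x 1 * 2 ^ (2 * k * n0)⌋
  have hL : 0 ≤ L := (abs_nonneg _).trans (hAL 0)
  rw [h x ⟨Int.floor_le _, Int.lt_floor_add_one _⟩ ⟨Int.floor_le _, Int.lt_floor_add_one _⟩]
  by_cases hx : x 1 ∈ nearInt n0 k
  · rw [Set.indicator_of_mem hx, abs_mul, abs_mul, sq]
    calc _ ≤ 1 * (L * L) := by
          gcongr
          · exact hAL _
          · exact hBL _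
      _ = _ := by simp
  · have : B ((x 1 * 2 ^ (2 * k * n0) - r) * 2 ^ n0) = 0 := by
      by_contra hne
      refine hx ⟨r, ?_⟩
      rw [← abs_of_pos (by positivity : (0 : ℝ) < 2 ^ n0), ← abs_mul, abs_lt]
      exact hB hne
    rw [this]
    simp [hx]

lemma mem_Ioo_of_fLevel_ne_zero {A B : ℝ → ℝ} (hA : Function.support A ⊆ Set.Ioo 0 1)
    (hB : Function.support B ⊆ Set.Ioo (-1) 1) {n0 k : ℕ} {x : Fin 2 → ℝ}
    (hx : fLevel A B n0 k x ≠ 0) : x 0 ∈ Set.Ioo 0 1 ∧ x 1 ∈ Set.Ioo (-1) 1 := by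
  rw [fLevel_eq_mul] at hx
  obtain ⟨i, hi, hAi⟩ := Finset.exists_ne_zero_of_sum_ne_zero (left_ne_zero_of_mul hx)
  obtain ⟨j, hj, hBj⟩ := Finset.exists_ne_zero_of_sum_ne_zero (right_ne_zero_of_mul hx)
  have h1 := hA hAi
  have h2 := hB hBj
  rw [Finset.mem_range] at hi hj
  generalize 2 * k * n0 = N at *
  have hj' : 2 * j + 1 ≤ 2 ^ N := by
    cases N with
    | zero => simp at hj; simp [hj]
    | succ N => rw [pow_succ]; simp at hj; omega
  have hi2 : (i : ℝ) + 1 ≤ 2 ^ N := by exact_mod_cast hi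
  have hj2 : 2 * (j : ℝ) + 1 ≤ 2 ^ N := by exact_mod_cast hj'
  have hN : (1 : ℝ) ≤ 2 ^ N := one_le_pow₀ (by norm_num)
  have hp : (1 : ℝ) ≤ 2 ^ n0 := one_le_pow₀ (by norm_num)
  have hi0 : (0 : ℝ) ≤ i := by positivity
  have hj0 : (0 : ℝ) ≤ j := by positivity
  push_cast at h1 h2
  obtain ⟨h1a, h1b⟩ := h1
  obtain ⟨h2a, h2b⟩ := h2
  have h3 : x 1 * 2 ^ N - 2 * j < 1 := by by_contra! h; nlinarith
  have h4 : -1 < x 1 * 2 ^ N - 2 * j := by by_contra! h; nlinarith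
  refine ⟨⟨?_, ?_⟩, ?_, ?_⟩ <;> by_contra! h <;> nlinarith

lemma exists_Ico_mul_subset (p : ℤ) {κ : ℤ} {N : ℕ} (hκ : κ ≤ -N) :
    ∃ q : ℤ, ∀ t ∈ Set.Ico (p * (2 : ℝ) ^ κ) ((p + 1) * 2 ^ κ),
      t * 2 ^ N ∈ Set.Ico (q : ℝ) (q + 1) := by
  obtain ⟨M, hM⟩ := Int.eq_ofNat_of_zero_le (show 0 ≤ -(N : ℤ) - κ by omega)
  refine ⟨p / 2 ^ M, fun t ht => ?_⟩
  have e : (2 : ℝ) ^ κ = (2 ^ N)⁻¹ * (2 ^ M)⁻¹ := by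
    rw [show κ = -(N : ℤ) + -(M : ℤ) by omega, zpow_add₀ (by norm_num), zpow_neg, zpow_neg,
      zpow_natCast, zpow_natCast]
  have hN : (0 : ℝ) < 2 ^ N := by positivity
  have hM0 : (0 : ℝ) < 2 ^ M := by positivity
  have hMz : (0 : ℤ) < 2 ^ M := by positivity
  have h1 : ((p / 2 ^ M : ℤ) : ℝ) * 2 ^ M ≤ p := by exact_mod_cast Int.ediv_mul_le p hMz.ne'
  have h2 : (p : ℝ) + 1 ≤ (((p / 2 ^ M : ℤ) : ℝ) + 1) * 2 ^ M := by
    exact_mod_cast Int.lt_ediv_add_one_mul_self p hMz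
  rw [e, ← mul_assoc, ← mul_assoc, ← div_eq_mul_inv, ← div_eq_mul_inv, ← div_eq_mul_inv,
    ← div_eq_mul_inv, div_div, div_div, Set.mem_Ico, div_le_iff₀ (by positivity),
    lt_div_iff₀ (by positivity), ← mul_assoc] at ht
  exact ⟨le_of_mul_le_mul_right (h1.trans ht.1) hM0, lt_of_mul_lt_mul_right (ht.2.trans_le h2) hM0.le⟩

lemma abs_sub_lt_of_mem_Ico {p : ℤ} {κ : ℤ} {s t : ℝ}
    (hs : s ∈ Set.Ico (p * (2 : ℝ) ^ κ) ((p + 1) * 2 ^ κ))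
    (ht : t ∈ Set.Ico (p * (2 : ℝ) ^ κ) ((p + 1) * 2 ^ κ)) : |s - t| < 2 ^ κ := by
  obtain ⟨h1, h2⟩ := hs
  obtain ⟨h3, h4⟩ := ht
  rw [abs_lt]
  constructor <;> linarith

lemma abs_fLevel_sub_le {A B : ℝ → ℝ} (hA : Function.support A ⊆ Set.Ioo 0 1)
    (hB : Function.support B ⊆ Set.Ioo (-1) 1) {L : ℝ} (hAL : ∀ u, |A u| ≤ L)
    (hBL : ∀ u, |B u| ≤ L) (hA' : ∀ u v, |A u - A v| ≤ L * |u - v|)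
    (hB' : ∀ u v, |B u - B v| ≤ L * |u - v|) {n0 : ℕ} (hn : 1 ≤ n0) (k : ℕ)
    {Q : DyadicCube 2} (hQ : Q.1 ≤ -(2 * k * n0 : ℤ)) {x y : Fin 2 → ℝ}
    (hx : x ∈ cubeSet 2 Q) (hy : y ∈ cubeSet 2 Q) :
    |fLevel A B n0 k x - fLevel A B n0 k y| ≤
      2 * L ^ 2 * min 1 (2 ^ (2 * k * n0 + n0 + Q.1 : ℤ)) := by
  have hL : 0 ≤ L := (abs_nonneg _).trans (hAL 0)
  have hx0 := hx 0 (Set.mem_univ _)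
  have hx1 := hx 1 (Set.mem_univ _)
  have hy0 := hy 0 (Set.mem_univ _)
  have hy1 := hy 1 (Set.mem_univ _)
  have hQ' : Q.1 ≤ -((2 * k * n0 : ℕ) : ℤ) := by push_cast; exact hQ
  obtain ⟨q0, h0⟩ := exists_Ico_mul_subset (Q.2 0) hQ'
  obtain ⟨q1, h1⟩ := exists_Ico_mul_subset (Q.2 1) hQ'
  obtain ⟨c, r, hc, h⟩ := exists_fLevel_eq hA hB hn k q0 q1
  rw [h x (h0 _ hx0) (h1 _ hx1), h y (h0 _ hy0) (h1 _ hy1), ← mul_sub, abs_mul]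
  have d0 := (abs_sub_lt_of_mem_Ico hx0 hy0).le
  have d1 := (abs_sub_lt_of_mem_Ico hx1 hy1).le
  have e : (2 : ℝ) ^ (2 * k * n0 + n0 + Q.1 : ℤ) = 2 ^ (2 * k * n0) * 2 ^ n0 * 2 ^ Q.1 := by
    rw [zpow_add₀ (by norm_num), ← pow_add]
    norm_cast
  rw [e]
  generalize 2 * k * n0 = N at *
  have hp : (1 : ℝ) ≤ 2 ^ n0 := one_le_pow₀ (by norm_num)
  set a := A (x 0 * 2 ^ N - q0)
  set a' := A (y 0 * 2 ^ N - q0)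
  set b := B ((x 1 * 2 ^ N - r) * 2 ^ n0)
  set b' := B ((y 1 * 2 ^ N - r) * 2 ^ n0)
  have ha : |a - a'| ≤ L * (2 ^ N * 2 ^ n0 * 2 ^ Q.1) := by
    refine (hA' _ _).trans ?_
    gcongr
    rw [show x 0 * 2 ^ N - q0 - (y 0 * 2 ^ N - q0) = (x 0 - y 0) * 2 ^ N by ring, abs_mul,
      abs_of_pos (by positivity : (0 : ℝ) < 2 ^ N)]
    calc |x 0 - y 0| * 2 ^ N ≤ 2 ^ Q.1 * 2 ^ N * 1 := by rw [mul_one]; gcongr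
      _ ≤ 2 ^ Q.1 * 2 ^ N * 2 ^ n0 := by gcongr
      _ = _ := by ring
  have hb : |b - b'| ≤ L * (2 ^ N * 2 ^ n0 * 2 ^ Q.1) := by
    refine (hB' _ _).trans ?_
    gcongr
    rw [show (x 1 * 2 ^ N - r) * 2 ^ n0 - (y 1 * 2 ^ N - r) * 2 ^ n0 =
      (x 1 - y 1) * (2 ^ N * 2 ^ n0) by ring, abs_mul,
      abs_of_pos (by positivity : (0 : ℝ) < 2 ^ N * 2 ^ n0)]
    rw [mul_comm]
    gcongr
  have key : |a * b - a' * b'| ≤ 2 * L ^ 2 * min 1 (2 ^ N * 2 ^ n0 * 2 ^ Q.1) := by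
    rw [mul_min_of_nonneg _ _ (by positivity)]
    refine le_min ?_ ?_
    · calc |a * b - a' * b'| ≤ |a * b| + |a' * b'| := abs_sub _ _
        _ = |a| * |b| + |a'| * |b'| := by rw [abs_mul, abs_mul]
        _ ≤ L * L + L * L := by
          gcongr
          exacts [hAL _, hBL _, hAL _, hBL _]
        _ = _ := by ring
    · calc |a * b - a' * b'| = |(a - a') * b + a' * (b - b')| := by congr 1; ring
        _ ≤ |a - a'| * |b| + |a'| * |b - b'| := by
          rw [← abs_mul, ← abs_mul]; exact abs_add_le _ _
        _ ≤ (L * (2 ^ N * 2 ^ n0 * 2 ^ Q.1)) * L + L * (L * (2 ^ N * 2 ^ n0 * 2 ^ Q.1)) := by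
          gcongr
          exacts [hBL _, hAL _]
        _ = _ := by ring
  calc |c| * |a * b - a' * b'| ≤ 1 * |a * b - a' * b'| := by gcongr
    _ ≤ _ := by rw [one_mul]; exact key

lemma sum_min_one_two_zpow_le {n0 : ℕ} (hn : 1 ≤ n0) (κ : ℤ) (s : Finset ℕ)
    (hs : ∀ k ∈ s, κ < -(2 * k * n0 : ℤ)) :
    ∑ k ∈ s, min (1 : ℝ) (2 ^ (2 * k * n0 + n0 + κ : ℤ)) ≤ 2 := by
  rcases s.eq_empty_or_nonempty with rfl | hne
  · simp
  set K := s.max' hne with hK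
  have hle : ∀ k ∈ s, k ≤ K := fun k hk => s.le_max' k hk
  have hterm : ∀ k ∈ s, min (1 : ℝ) (2 ^ (2 * k * n0 + n0 + κ : ℤ)) ≤ (1 / 2) ^ (K - k) := by
    intro k hk
    rcases (hle k hk).eq_or_lt with h | h
    · rw [h, Nat.sub_self, pow_zero]; exact min_le_left _ _
    · refine (min_le_right _ _).trans ?_
      rw [one_div, inv_pow, ← zpow_natCast, ← zpow_neg]
      refine zpow_le_zpow_right₀ (by norm_num) ?_
      have h1 := hs K (s.max'_mem hne)
      obtain ⟨d, hd⟩ := Nat.exists_eq_add_of_lt h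
      have hd' : (K : ℤ) = k + d + 1 := by exact_mod_cast hd
      have h2 : ((K - k : ℕ) : ℤ) = d + 1 := by omega
      have hn' : (1 : ℤ) ≤ n0 := by exact_mod_cast hn
      rw [h2]
      rw [hd'] at h1
      nlinarith [mul_nonneg (show (0 : ℤ) ≤ d by omega) (show (0 : ℤ) ≤ n0 - 1 by omega)]
  calc _ ≤ ∑ k ∈ s, (1 / 2 : ℝ) ^ (K - k) := Finset.sum_le_sum hterm
    _ ≤ ∑ k ∈ Finset.range (K + 1), (1 / 2 : ℝ) ^ (K - k) :=
        Finset.sum_le_sum_of_subset_of_nonneg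
          (fun k hk => Finset.mem_range.2 (Nat.lt_succ_of_le (hle k hk)))
          (fun _ _ _ => by positivity)
    _ = ∑ k ∈ Finset.range (K + 1), (1 / 2 : ℝ) ^ k := by
        rw [← Finset.sum_range_reflect]
        refine Finset.sum_congr rfl fun k hk => ?_
        rw [Finset.mem_range] at hk
        congr 1
        omega
    _ ≤ 2 := sum_geometric_two_le _

lemma setLIntegral_univ_pi_comp_one (S : Fin 2 → Set ℝ) (hS : ∀ i, MeasurableSet (S i))
    {g : ℝ → ℝ≥0∞} (hg : Measurable g) :
    ∫⁻ x in Set.univ.pi S, g (x 1) = volume (S 0) * ∫⁻ t in S 1, g t := by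
  have h := (volume_preserving_finTwoArrow ℝ).setLIntegral_comp_preimage
    (s := S 0 ×ˢ S 1) ((hS 0).prod (hS 1)) (f := fun z => g z.2) (by fun_prop)
  have hset : MeasurableEquiv.finTwoArrow ⁻¹' (S 0 ×ˢ S 1) = Set.univ.pi S := by
    ext x
    simp [MeasurableEquiv.finTwoArrow, Fin.forall_fin_two]
  rw [hset] at h
  refine Eq.trans h ?_
  rw [Measure.volume_eq_prod, ← Measure.prod_restrict]
  have := lintegral_prod_mul (μ := volume.restrict (S 0)) (ν := volume.restrict (S 1))
    (f := fun _ => 1) (g := g) aemeasurable_const hg.aemeasurable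
  simpa using this

lemma measurableSet_cubeSet (n : ℕ) (Q : DyadicCube n) : MeasurableSet (cubeSet n Q) :=
  MeasurableSet.univ_pi fun _ => measurableSet_Ico

lemma cubeVol_pos (n : ℕ) (Q : DyadicCube n) : 0 < cubeVol n Q := by
  unfold cubeVol; positivity

lemma volume_cubeSet (n : ℕ) (Q : DyadicCube n) :
    volume (cubeSet n Q) = ENNReal.ofReal (cubeVol n Q) := by
  rw [cubeSet, cubeVol, volume_pi_pi]
  simp only [Real.volume_Ico]
  rw [Finset.prod_congr rfl (g := fun _ => ENNReal.ofReal (2 ^ Q.1)) (fun _ _ => by congr 1; ring)]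
  rw [Finset.prod_const, Finset.card_univ, Fintype.card_fin,
    ← ENNReal.ofReal_pow (by positivity), zpow_mul, zpow_natCast]

lemma setLIntegral_cubeSet_two_pow_hitCount_le {n0 : ℕ} {s : Finset ℕ} (hs : s.card ≤ 2 ^ n0)
    (Q : DyadicCube 2) (hQ : ∀ k ∈ s, -(2 * k * n0 : ℤ) ≤ Q.1) :
    ∫⁻ x in cubeSet 2 Q, 2 ^ hitCount n0 s (x 1) ≤
      ENNReal.ofReal (Real.exp 2 * cubeVol 2 Q) := by
  rw [cubeSet, setLIntegral_univ_pi_comp_one _ (fun _ => measurableSet_Ico)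
    (g := fun t => 2 ^ hitCount n0 s t) (measurable_const.pow (measurable_hitCount n0 s))]
  rw [Real.volume_Ico]
  calc _ ≤ ENNReal.ofReal (2 ^ Q.1) * ENNReal.ofReal (Real.exp 2 * 2 ^ Q.1) := by
        gcongr
        · ring_nf; exact le_rfl
        · exact lintegral_two_pow_hitCount_le n0 hs Q.1 hQ _
    _ = _ := by
        rw [← ENNReal.ofReal_mul (by positivity), cubeVol, zpow_mul]
        congr 1
        norm_cast
        ring

lemma exists_rpow_le_mul_two_pow (p : ℝ) :
    ∃ C : ℝ, 0 < C ∧ ∀ T : ℕ, (T : ℝ) ^ p ≤ C * 2 ^ T := by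
  have h := (tendsto_rpow_mul_exp_neg_mul_atTop_nhds_zero p (Real.log 2)
    (Real.log_pos (by norm_num))).comp tendsto_natCast_atTop_atTop
  obtain ⟨C, hC⟩ := h.bddAbove_range
  refine ⟨max C 1, by positivity, fun T => ?_⟩
  have h1 := hC ⟨T, rfl⟩
  have h2 : Real.exp (Real.log 2 * T) = 2 ^ T := by
    rw [mul_comm, Real.exp_nat_mul, Real.exp_log (by norm_num)]
  simp only [Function.comp] at h1
  rw [neg_mul, Real.exp_neg, h2, ← div_eq_mul_inv, div_le_iff₀ (by positivity)] at h1
  exact h1.trans (by gcongr; exact le_max_left _ _)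

lemma setIntegral_sub_meanOn_sq_le {n : ℕ} (Q : DyadicCube n) {f : (Fin n → ℝ) → ℝ}
    (hf : IntegrableOn f (cubeSet n Q)) (hf2 : IntegrableOn (fun x => f x ^ 2) (cubeSet n Q))
    (c : ℝ) :
    ∫ x in cubeSet n Q, (f x - meanOn n (cubeSet n Q) (cubeVol n Q) f) ^ 2 ≤
      ∫ x in cubeSet n Q, (f x - c) ^ 2 := by
  have hv := cubeVol_pos n Q
  have hvol : volume.real (cubeSet n Q) = cubeVol n Q := by
    rw [Measure.real, volume_cubeSet, ENNReal.toReal_ofReal hv.le]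
  have hexp : ∀ a : ℝ, ∫ x in cubeSet n Q, (f x - a) ^ 2 =
      (∫ x in cubeSet n Q, f x ^ 2) - 2 * a * (∫ x in cubeSet n Q, f x) + a ^ 2 * cubeVol n Q := by
    intro a
    have hc : IntegrableOn (fun _ : Fin n → ℝ => a ^ 2) (cubeSet n Q) :=
      integrableOn_const (by rw [volume_cubeSet]; exact ENNReal.ofReal_ne_top)
    have e : ∀ x, (f x - a) ^ 2 = f x ^ 2 - 2 * a * f x + a ^ 2 := fun x => by ring
    simp only [e]
    have hl : IntegrableOn (fun x => 2 * a * f x) (cubeSet n Q) := hf.const_mul _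
    have hs : IntegrableOn (fun x => f x ^ 2 - 2 * a * f x) (cubeSet n Q) := hf2.sub hl
    rw [integral_add hs hc, integral_sub hf2 hl, integral_const_mul, setIntegral_const, hvol, smul_eq_mul]
    ring
  rw [hexp, hexp, meanOn]
  set v := cubeVol n Q
  set I := ∫ x in cubeSet n Q, f x
  have hI : I = v * (v⁻¹ * I) := by field_simp
  set m := v⁻¹ * I
  rw [hI]
  nlinarith [mul_nonneg hv.le (sq_nonneg (m - c))]

lemma continuous_fTest {A B : ℝ → ℝ} (hA : Continuous A) (hB : Continuous B) (n0 : ℕ) :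
    Continuous (fTest A B n0) := by
  unfold fTest gBlock
  fun_prop

lemma Continuous.integrableOn_cubeSet {n : ℕ} {f : (Fin n → ℝ) → ℝ} (hf : Continuous f)
    (Q : DyadicCube n) : IntegrableOn f (cubeSet n Q) :=
  (hf.continuousOn.integrableOn_compact
    (isCompact_univ_pi fun t => isCompact_Icc (a := (Q.2 t : ℝ) * 2 ^ Q.1)
      (b := ((Q.2 t : ℝ) + 1) * 2 ^ Q.1))).mono_set
    (Set.pi_mono fun _ _ => Set.Ico_subset_Icc_self)

section

variable {A B : ℝ → ℝ} {L : ℝ} {n0 : ℕ}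

lemma abs_sum_fLevel_le (hA : Function.support A ⊆ Set.Ioo 0 1)
    (hB : Function.support B ⊆ Set.Ioo (-1) 1) (hAL : ∀ u, |A u| ≤ L)
    (hBL : ∀ u, |B u| ≤ L) (hn : 1 ≤ n0) (s : Finset ℕ) (x : Fin 2 → ℝ) :
    |∑ k ∈ s, fLevel A B n0 k x| ≤ L ^ 2 * hitCount n0 s (x 1) := by
  refine (Finset.abs_sum_le_sum_abs _ _).trans ?_
  rw [hitCount, Nat.cast_sum, Finset.mul_sum]
  exact Finset.sum_le_sum fun k _ => abs_fLevel_le hA hB hAL hBL hn k x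

lemma mem_Ioo_of_fTest_ne_zero (hA : Function.support A ⊆ Set.Ioo 0 1)
    (hB : Function.support B ⊆ Set.Ioo (-1) 1) {x : Fin 2 → ℝ} (hx : fTest A B n0 x ≠ 0) :
    x 0 ∈ Set.Ioo 0 1 ∧ x 1 ∈ Set.Ioo (-1) 1 := by
  rw [fTest_eq_sum_fLevel] at hx
  obtain ⟨k, _, hk⟩ := Finset.exists_ne_zero_of_sum_ne_zero hx
  exact mem_Ioo_of_fLevel_ne_zero hA hB hk

lemma exists_lintegral_fTest_rpow_le (hA : Function.support A ⊆ Set.Ioo 0 1)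
    (hB : Function.support B ⊆ Set.Ioo (-1) 1) (hAL : ∀ u, |A u| ≤ L)
    (hBL : ∀ u, |B u| ≤ L) {p : ℝ} (hp : 0 < p) :
    ∃ C : ℝ, 0 ≤ C ∧ ∀ n0 : ℕ, 1 ≤ n0 →
      ∫⁻ x, ‖fTest A B n0 x‖ₑ ^ p ≤ ENNReal.ofReal C := by
  obtain ⟨C, hC0, hC⟩ := exists_rpow_le_mul_two_pow p
  set D := (L ^ 2) ^ p * C with hD
  have hD0 : 0 ≤ D := by positivity
  refine ⟨D * (Real.exp 2 + Real.exp 2), by positivity, fun n0 hn => ?_⟩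
  set s := Finset.Icc 1 (2 ^ n0) with hs
  have hcard : s.card ≤ 2 ^ n0 := by simp [hs]
  set P : (Fin 2 → ℝ) → ℝ≥0∞ := fun x => 2 ^ hitCount n0 s (x 1) with hP
  have hpt : ∀ x, ‖fTest A B n0 x‖ₑ ^ p ≤ ENNReal.ofReal D * P x := by
    intro x
    have h1 := abs_sum_fLevel_le hA hB hAL hBL hn s x
    rw [← fTest_eq_sum_fLevel] at h1
    have h2 : |fTest A B n0 x| ^ p ≤ D * 2 ^ hitCount n0 s (x 1) := by
      calc _ ≤ (L ^ 2 * hitCount n0 s (x 1)) ^ p := by gcongr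
        _ = (L ^ 2) ^ p * (hitCount n0 s (x 1) : ℝ) ^ p :=
          Real.mul_rpow (by positivity) (by positivity)
        _ ≤ (L ^ 2) ^ p * (C * 2 ^ hitCount n0 s (x 1)) := by gcongr; exact hC _
        _ = _ := by rw [hD]; ring
    rw [Real.enorm_eq_ofReal_abs, ENNReal.ofReal_rpow_of_nonneg (abs_nonneg _) hp.le]
    refine (ENNReal.ofReal_le_ofReal h2).trans ?_
    rw [ENNReal.ofReal_mul hD0, ENNReal.ofReal_pow (by norm_num)]
    simp [hP]
  have hsub : Function.support (fun x => ‖fTest A B n0 x‖ₑ ^ p) ⊆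
      cubeSet 2 (0, ![0, -1]) ∪ cubeSet 2 (0, ![0, 0]) := by
    intro x hx
    have hx' : fTest A B n0 x ≠ 0 := by
      intro h
      simp [h, hp] at hx
    obtain ⟨⟨h1, h2⟩, h3, h4⟩ := mem_Ioo_of_fTest_ne_zero hA hB hx'
    rcases lt_or_ge (x 1) 0 with h | h
    · left
      simp [cubeSet, Fin.forall_fin_two]
      exact ⟨⟨h1.le, h2⟩, h3.le, h⟩
    · right
      simp [cubeSet, Fin.forall_fin_two]
      exact ⟨⟨h1.le, h2⟩, h, h4⟩
  have hcube : ∀ v : Fin 2 → ℤ, ∫⁻ x in cubeSet 2 (0, v), ‖fTest A B n0 x‖ₑ ^ p ≤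
      ENNReal.ofReal (D * Real.exp 2) := by
    intro v
    calc _ ≤ ∫⁻ x in cubeSet 2 (0, v), ENNReal.ofReal D * P x := lintegral_mono hpt
      _ = ENNReal.ofReal D * ∫⁻ x in cubeSet 2 (0, v), P x :=
        lintegral_const_mul' _ _ ENNReal.ofReal_ne_top
      _ ≤ ENNReal.ofReal D * ENNReal.ofReal (Real.exp 2 * cubeVol 2 (0, v)) := by
        gcongr
        refine setLIntegral_cubeSet_two_pow_hitCount_le hcard _ fun k _ => ?_
        have : (0 : ℤ) ≤ 2 * k * n0 := by positivity
        dsimp only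
        omega
      _ = _ := by
        rw [← ENNReal.ofReal_mul hD0]
        simp [cubeVol]
  rw [← setLIntegral_eq_of_support_subset hsub]
  refine (lintegral_union_le _ _ _).trans ?_
  rw [mul_add, ENNReal.ofReal_add (by positivity) (by positivity)]
  exact add_le_add (hcube _) (hcube _)

lemma exists_abs_fTest_sub_le (hA : Function.support A ⊆ Set.Ioo 0 1)
    (hB : Function.support B ⊆ Set.Ioo (-1) 1) (hAL : ∀ u, |A u| ≤ L)
    (hBL : ∀ u, |B u| ≤ L) (hA' : ∀ u v, |A u - A v| ≤ L * |u - v|)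
    (hB' : ∀ u v, |B u - B v| ≤ L * |u - v|) (hn : 1 ≤ n0) (Q : DyadicCube 2) :
    ∃ s : Finset ℕ, s.card ≤ 2 ^ n0 ∧ (∀ k ∈ s, -(2 * k * n0 : ℤ) ≤ Q.1) ∧
      ∃ c : ℝ, ∀ x ∈ cubeSet 2 Q,
        |fTest A B n0 x - c| ≤ L ^ 2 * (4 + hitCount n0 s (x 1)) := by
  set S := Finset.Icc 1 (2 ^ n0) with hS
  set y : Fin 2 → ℝ := fun t => (Q.2 t : ℝ) * 2 ^ Q.1 with hy
  have hyQ : y ∈ cubeSet 2 Q := by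
    intro t _
    have : (0 : ℝ) < 2 ^ Q.1 := by positivity
    exact ⟨le_rfl, by simp only [hy]; nlinarith⟩
  refine ⟨S.filter fun k : ℕ => -(2 * k * n0 : ℤ) ≤ Q.1, ?_, ?_,
    ∑ k ∈ S.filter (fun k : ℕ => ¬ -(2 * k * n0 : ℤ) ≤ Q.1), fLevel A B n0 k y, ?_⟩
  · exact (Finset.card_filter_le _ _).trans (by simp [hS])
  · intro k hk
    exact (Finset.mem_filter.1 hk).2
  · intro x hx
    have h1 := abs_sum_fLevel_le hA hB hAL hBL hn (S.filter fun k : ℕ => -(2 * k * n0 : ℤ) ≤ Q.1) x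
    have h2 : ∑ k ∈ S.filter (fun k : ℕ => ¬ -(2 * k * n0 : ℤ) ≤ Q.1),
        |fLevel A B n0 k x - fLevel A B n0 k y| ≤ 2 * L ^ 2 * 2 := by
      refine (Finset.sum_le_sum fun k hk => abs_fLevel_sub_le hA hB hAL hBL hA' hB' hn k
        (not_le.1 (Finset.mem_filter.1 hk).2).le hx hyQ).trans ?_
      rw [← Finset.mul_sum]
      gcongr
      exact sum_min_one_two_zpow_le hn _ _ fun k hk => not_le.1 (Finset.mem_filter.1 hk).2
    rw [fTest_eq_sum_fLevel, ← hS, ← Finset.sum_filter_add_sum_filter_not S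
      (fun k : ℕ => -(2 * k * n0 : ℤ) ≤ Q.1), add_sub_assoc, ← Finset.sum_sub_distrib]
    refine (abs_add_le _ _).trans ?_
    have h3 := (Finset.abs_sum_le_sum_abs (fun k => fLevel A B n0 k x - fLevel A B n0 k y)
      (S.filter (fun k : ℕ => ¬ -(2 * k * n0 : ℤ) ≤ Q.1))).trans h2
    linarith

lemma exists_meanOscillation_fTest_le (hAc : Continuous A) (hBc : Continuous B)
    (hA : Function.support A ⊆ Set.Ioo 0 1)
    (hB : Function.support B ⊆ Set.Ioo (-1) 1) (hAL : ∀ u, |A u| ≤ L)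
    (hBL : ∀ u, |B u| ≤ L) (hA' : ∀ u v, |A u - A v| ≤ L * |u - v|)
    (hB' : ∀ u v, |B u - B v| ≤ L * |u - v|) :
    ∃ C : ℝ, 0 ≤ C ∧ ∀ n0 : ℕ, 1 ≤ n0 → ∀ Q : DyadicCube 2,
      (cubeVol 2 Q)⁻¹ * ∫ x in cubeSet 2 Q,
        (fTest A B n0 x - meanOn 2 (cubeSet 2 Q) (cubeVol 2 Q) (fTest A B n0)) ^ 2 ≤ C := by
  obtain ⟨C, hC0, hC⟩ := exists_rpow_le_mul_two_pow 2
  set D := L ^ 4 * (32 + 2 * C) with hD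
  have hD0 : 0 ≤ D := by positivity
  refine ⟨D * Real.exp 2, by positivity, fun n0 hn Q => ?_⟩
  obtain ⟨s, hcard, hs, c, hc⟩ := exists_abs_fTest_sub_le hA hB hAL hBL hA' hB' hn Q
  have hf := continuous_fTest hAc hBc n0
  have hv := cubeVol_pos 2 Q
  rw [inv_mul_le_iff₀ hv]
  refine (setIntegral_sub_meanOn_sq_le Q (hf.integrableOn_cubeSet Q)
    ((hf.pow 2).integrableOn_cubeSet Q) c).trans ?_
  have hint : IntegrableOn (fun x => (fTest A B n0 x - c) ^ 2) (cubeSet 2 Q) :=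
    ((hf.sub continuous_const).pow 2).integrableOn_cubeSet Q
  rw [← ENNReal.ofReal_le_ofReal_iff (by positivity), ofReal_integral_eq_lintegral_ofReal hint
    (Filter.Eventually.of_forall fun x => sq_nonneg _)]
  calc _ ≤ ∫⁻ x in cubeSet 2 Q, ENNReal.ofReal D * 2 ^ hitCount n0 s (x 1) := by
        refine setLIntegral_mono' (measurableSet_cubeSet 2 Q) fun x hx => ?_
        set T := hitCount n0 s (x 1)
        have h1 := hc x hx
        have h2 := hC T
        norm_cast at h2
        push_cast at h2
        have h3 : (1 : ℝ) ≤ 2 ^ T := one_le_pow₀ (by norm_num)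
        have h4 : (fTest A B n0 x - c) ^ 2 ≤ D * 2 ^ T := by
          calc _ ≤ (L ^ 2 * (4 + T)) ^ 2 := by rw [← sq_abs]; gcongr
            _ = L ^ 4 * (4 + T) ^ 2 := by ring
            _ ≤ L ^ 4 * ((32 + 2 * C) * 2 ^ T) := by
              gcongr
              nlinarith [sq_nonneg ((T : ℝ) - 4)]
            _ = _ := by rw [hD]; ring
        refine (ENNReal.ofReal_le_ofReal h4).trans ?_
        rw [ENNReal.ofReal_mul hD0, ENNReal.ofReal_pow (by norm_num)]
        simp
    _ = ENNReal.ofReal D * ∫⁻ x in cubeSet 2 Q, 2 ^ hitCount n0 s (x 1) :=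
        lintegral_const_mul' _ _ ENNReal.ofReal_ne_top
    _ ≤ ENNReal.ofReal D * ENNReal.ofReal (Real.exp 2 * cubeVol 2 Q) := by
        gcongr
        exact setLIntegral_cubeSet_two_pow_hitCount_le hcard Q hs
    _ = _ := by
        rw [← ENNReal.ofReal_mul hD0]
        congr 1
        ring

end

lemma LipschitzWith.abs_le_mul_or_eq_zero_of_support_subset {φ : ℝ → ℝ} {K : NNReal}
    (hφ : LipschitzWith K φ) {a b : ℝ} (h : Function.support φ ⊆ Set.Ioo a b) (u : ℝ) :
    |φ u| ≤ K * (b - a) ∨ φ u = 0 := by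
  by_cases hu : φ u = 0
  · exact Or.inr hu
  · left
    have ha : φ a = 0 := by
      by_contra hne
      exact lt_irrefl _ (h hne).1
    have h1 := hφ.dist_le_mul u a
    rw [Real.dist_eq, Real.dist_eq, ha, sub_zero, abs_of_pos (sub_pos.2 (h hu).1)] at h1
    exact h1.trans (by have := (h hu).2; gcongr)

theorem fTest_bmo_and_Lp_bounds
    (A B : ℝ → ℝ) (KA KB : NNReal)
    (hA_lip : LipschitzWith KA A) (hB_lip : LipschitzWith KB B)
    (hA_supp : Function.support A ⊆ Set.Icc 0 1) (hA_int : ∫ t, A t = 0)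
    (hB_supp : Function.support B ⊆ Set.Icc (-1) 1) :
    (∀ n0 : ℕ, 1 ≤ n0 →
      Function.support (fTest A B n0) ⊆ Set.Icc (-1 : Fin 2 → ℝ) 1) ∧
    (∃ C : ℝ, 0 < C ∧ ∀ n0 : ℕ, 1 ≤ n0 →
      bmoD 2 (fTest A B n0) ≤ ENNReal.ofReal C) ∧
    (∀ p : ℝ, 1 < p → ∃ Cp : ℝ, 0 < Cp ∧ ∀ n0 : ℕ, 1 ≤ n0 →
      eLpNorm (fTest A B n0) (ENNReal.ofReal p) volume ≤ ENNReal.ofReal Cp) := by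
  have hA : Function.support A ⊆ Set.Ioo 0 1 := by
    rw [← interior_Icc]
    exact interior_maximal hA_supp hA_lip.continuous.isOpen_support
  have hB : Function.support B ⊆ Set.Ioo (-1) 1 := by
    rw [← interior_Icc]
    exact interior_maximal hB_supp hB_lip.continuous.isOpen_support
  have hKA : (0 : ℝ) ≤ KA := KA.2
  have hKB : (0 : ℝ) ≤ KB := KB.2
  set L : ℝ := KA + 2 * KB with hL
  have hAL : ∀ u, |A u| ≤ L := fun u => by
    rcases hA_lip.abs_le_mul_or_eq_zero_of_support_subset hA u with h | h
    · linarith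
    · rw [h, abs_zero]; positivity
  have hBL : ∀ u, |B u| ≤ L := fun u => by
    rcases hB_lip.abs_le_mul_or_eq_zero_of_support_subset hB u with h | h
    · linarith
    · rw [h, abs_zero]; positivity
  have hA' : ∀ u v, |A u - A v| ≤ L * |u - v| := fun u v =>
    (hA_lip.dist_le_mul u v).trans
      (mul_le_mul_of_nonneg_right (by linarith) (abs_nonneg _))
  have hB' : ∀ u v, |B u - B v| ≤ L * |u - v| := fun u v =>
    (hB_lip.dist_le_mul u v).trans
      (mul_le_mul_of_nonneg_right (by linarith) (abs_nonneg _))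
  refine ⟨fun n0 _ x hx => ?_, ?_, fun p hp => ?_⟩
  · obtain ⟨h0, h1⟩ := mem_Ioo_of_fTest_ne_zero hA hB hx
    constructor
    · intro i
      fin_cases i
      · exact (by norm_num : (-1 : ℝ) ≤ 0).trans h0.1.le
      · exact h1.1.le
    · intro i
      fin_cases i
      · exact h0.2.le
      · exact h1.2.le
  · obtain ⟨C₁, hC₁, h₁⟩ := exists_lintegral_fTest_rpow_le hA hB hAL hBL one_pos
    obtain ⟨C₂, hC₂, h₂⟩ := exists_meanOscillation_fTest_le hA_lip.continuous hB_lip.continuous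
      hA hB hAL hBL hA' hB'
    refine ⟨(C₁ ^ 2 + C₂) ^ (1 / 2 : ℝ) + 1, by positivity, fun n0 hn => ?_⟩
    calc bmoD 2 (fTest A B n0)
        ≤ (ENNReal.ofReal C₁ ^ 2 + ENNReal.ofReal C₂) ^ (1 / 2 : ℝ) := by
          have hint : ENNReal.ofReal |∫ x, fTest A B n0 x| ≤ ENNReal.ofReal C₁ := by
            rw [← Real.enorm_eq_ofReal_abs]
            refine (enorm_integral_le_lintegral_enorm _).trans ?_
            simpa using h₁ n0 hn
          refine ENNReal.rpow_le_rpow (add_le_add (pow_le_pow_left₀ zero_le hint 2) ?_)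
            (by norm_num)
          exact iSup_le fun Q => ENNReal.ofReal_le_ofReal (h₂ n0 hn Q)
      _ = ENNReal.ofReal ((C₁ ^ 2 + C₂) ^ (1 / 2 : ℝ)) := by
          rw [← ENNReal.ofReal_pow hC₁, ← ENNReal.ofReal_add (by positivity) hC₂,
            ENNReal.ofReal_rpow_of_nonneg (by positivity) (by norm_num)]
      _ ≤ _ := ENNReal.ofReal_le_ofReal (by linarith)
  · have hp0 : 0 < p := by linarith
    obtain ⟨C, hC, h⟩ := exists_lintegral_fTest_rpow_le hA hB hAL hBL hp0
    refine ⟨C ^ (1 / p) + 1, by positivity, fun n0 hn => ?_⟩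
    rw [eLpNorm_eq_lintegral_rpow_enorm_toReal (by simpa using hp0) ENNReal.ofReal_ne_top,
      ENNReal.toReal_ofReal hp0.le]
    calc _ ≤ ENNReal.ofReal C ^ (1 / p) := by
          gcongr
          exact h n0 hn
      _ = ENNReal.ofReal (C ^ (1 / p)) := ENNReal.ofReal_rpow_of_nonneg hC (by positivity)
      _ ≤ _ := ENNReal.ofReal_le_ofReal (by linarith)
end

section
/- Let f_ε be the test function built from Lipschitz A, B with supp A ⊆ [0,1], ∫A = 0, supp B ⊆ [−1,1], and assume in addition that A is differentiable with Lipschitz derivative A′ and that ∫B = 0. Then for every 1 < p < ∞: ‖R_1(f_ε)‖_{L^p(ℝ²)} ≤ C_p ε, with C_p independent of ε. -/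
open MeasureTheory Filter
open scoped ENNReal Topology

section Plancherel
open FourierTransform

variable {V : Type*} [NormedAddCommGroup V] [InnerProductSpace ℝ V] [FiniteDimensional ℝ V]
  [MeasurableSpace V] [BorelSpace V]

/-- The Fourier integral of an integrable function is continuous. -/
theorem continuous_fourier_of_integrable {f : V → ℂ} (hf : Integrable f) : Continuous (𝓕 f) :=
  VectorFourier.fourierIntegral_continuous Real.continuous_fourierChar
    (by exact continuous_inner) hf

theorem continuous_fourierInv_of_integrable {f : V → ℂ} (hf : Integrable f) :
    Continuous (𝓕⁻ f) := by
  rw [Real.fourierInv_eq_fourier_comp_neg]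
  exact continuous_fourier_of_integrable hf.comp_neg

theorem norm_fourier_le_integral {f : V → ℂ} (ξ : V) : ‖𝓕 f ξ‖ ≤ ∫ x, ‖f x‖ :=
  VectorFourier.norm_fourierIntegral_le_integral_norm _ _ _ _ _

theorem integral_fourier_mul_eq {f g : V → ℂ} (hf : Integrable f) (hg : Integrable g) :
    ∫ ξ, 𝓕 f ξ * g ξ = ∫ x, f x * 𝓕 g x := by
  have := VectorFourier.integral_fourierIntegral_smul_eq_flip (L := innerₗ V)
    (μ := (volume : Measure V)) (ν := (volume : Measure V))
    Real.continuous_fourierChar (by exact continuous_inner) hf hg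
  simp only [flip_innerₗ, smul_eq_mul] at this
  exact this

/-- Plancherel's theorem for the Fourier integral of a function in `L¹ ∩ L²`. -/
theorem eLpNorm_fourier_two {f : V → ℂ} (hf : Integrable f) (hf2 : MemLp f 2) :
    eLpNorm (𝓕 f) 2 volume = eLpNorm f 2 volume := by
  set G : Lp ℂ 2 (volume : Measure V) := 𝓕 (hf2.toLp f) with hG
  have key : 𝓕 f =ᵐ[volume] G := by
    refine ae_eq_of_integral_contDiff_smul_eq
      (continuous_fourier_of_integrable hf).locallyIntegrable
      ((Lp.memLp G).locallyIntegrable (by norm_num)) ?_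
    intro g hg hgc
    have hg' : ContDiff ℝ (⊤ : ℕ∞) (fun x => ((g x : ℝ) : ℂ)) :=
      Complex.ofRealCLM.contDiff.comp hg
    have hgc' : HasCompactSupport (fun x => ((g x : ℝ) : ℂ)) :=
      hgc.comp_left (g := fun t : ℝ => (t : ℂ)) (by simp)
    set γ : SchwartzMap V ℂ := hgc'.toSchwartzMap hg' with hγ
    have e1 : (𝓕 ((hf2.toLp f : Lp ℂ 2 (volume : Measure V)) : TemperedDistribution V ℂ)) γ
        = (G : TemperedDistribution V ℂ) γ := by
      rw [Lp.fourier_toTemperedDistribution_eq]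
    rw [TemperedDistribution.fourier_apply] at e1
    rw [Lp.toTemperedDistribution_apply, Lp.toTemperedDistribution_apply] at e1
    have e2 : ∫ x, (𝓕 γ) x • (hf2.toLp f) x = ∫ x, (𝓕 γ) x • f x := by
      refine integral_congr_ae ?_
      filter_upwards [hf2.coeFn_toLp] with x hx
      rw [hx]
    rw [e2] at e1
    have e3 := integral_fourier_mul_eq hf (γ.integrable (μ := volume))
    have e4 : ∀ x, γ x = ((g x : ℝ) : ℂ) := fun x => rfl
    have e5 : (∫ x, (𝓕 γ) x • f x) = ∫ x, f x * 𝓕 (fun y => γ y) x := by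
      refine integral_congr_ae (Eventually.of_forall fun x => ?_)
      simp [SchwartzMap.fourier_coe, mul_comm]
    rw [e5] at e1
    erw [← e3] at e1
    simp only [e4, smul_eq_mul] at e1
    simp only [Complex.real_smul]
    rw [← e1]
    simp only [mul_comm]
  rw [eLpNorm_congr_ae key]
  have h1 : ‖G‖ = ‖hf2.toLp f‖ := Lp.norm_fourier_eq _
  rw [Lp.norm_def, Lp.norm_toLp] at h1
  exact (ENNReal.toReal_eq_toReal_iff' (Lp.eLpNorm_ne_top G) hf2.eLpNorm_ne_top).1 h1

theorem lintegral_sq_eq_eLpNorm {α : Type*} [MeasurableSpace α] {μ : Measure α} (f : α → ℂ) :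
    ∫⁻ x, ‖f x‖ₑ ^ 2 ∂μ = eLpNorm f 2 μ ^ 2 := by
  have := eLpNorm_nnreal_pow_eq_lintegral (f := f) (μ := μ) (p := 2) (by norm_num)
  norm_num at this
  exact this.symm

theorem memLp_two_of_lintegral_sq {α : Type*} [MeasurableSpace α] {μ : Measure α} {f : α → ℂ}
    (hf : AEStronglyMeasurable f μ) (h : ∫⁻ x, ‖f x‖ₑ ^ 2 ∂μ ≠ ∞) : MemLp f 2 μ := by
  refine ⟨hf, ?_⟩
  rw [lintegral_sq_eq_eLpNorm] at h
  exact lt_top_iff_ne_top.2 fun h' => h (by simp [h'])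

theorem lintegral_fourier_sq {f : V → ℂ} (hf : Integrable f) (hf2 : MemLp f 2) :
    ∫⁻ ξ, ‖𝓕 f ξ‖ₑ ^ 2 = ∫⁻ x, ‖f x‖ₑ ^ 2 := by
  rw [lintegral_sq_eq_eLpNorm, lintegral_sq_eq_eLpNorm, eLpNorm_fourier_two hf hf2]

theorem memLp_fourier {f : V → ℂ} (hf : Integrable f) (hf2 : MemLp f 2) : MemLp (𝓕 f) 2 :=
  ⟨(continuous_fourier_of_integrable hf).aestronglyMeasurable, by
    rw [eLpNorm_fourier_two hf hf2]; exact hf2.2⟩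

theorem lintegral_fourierInv_sq {f : V → ℂ} (hf : Integrable f) (hf2 : MemLp f 2) :
    ∫⁻ ξ, ‖𝓕⁻ f ξ‖ₑ ^ 2 = ∫⁻ x, ‖f x‖ₑ ^ 2 := by
  simp only [Real.fourierInv_eq_fourier_neg]
  rw [← lintegral_fourier_sq hf hf2]
  exact lintegral_neg_eq_self (fun ξ => ‖𝓕 f ξ‖ₑ ^ 2)

theorem memLp_fourierInv {f : V → ℂ} (hf : Integrable f) (hf2 : MemLp f 2) : MemLp (𝓕⁻ f) 2 :=
  memLp_two_of_lintegral_sq (continuous_fourierInv_of_integrable hf).aestronglyMeasurable (by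
    rw [lintegral_fourierInv_sq hf hf2, lintegral_sq_eq_eLpNorm]
    exact (ENNReal.pow_lt_top hf2.2).ne)

theorem fourier_comp_add {f : V → ℂ} (u ξ : V) :
    𝓕 (fun x => f (x + u)) ξ = (Real.fourierChar (inner ℝ u ξ) : ℂ) * 𝓕 f ξ := by
  have := VectorFourier.fourierIntegral_comp_add_right Real.fourierChar (volume : Measure V)
    (innerₗ V) f u
  have := congrFun this ξ
  exact this

theorem fourier_sub_apply {f g : V → ℂ} (hf : Integrable f) (hg : Integrable g) (ξ : V) :
    𝓕 (fun x => f x - g x) ξ = 𝓕 f ξ - 𝓕 g ξ := by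
  simp only [Real.fourier_eq, smul_sub]
  exact integral_sub ((Real.fourierIntegral_convergent_iff ξ).2 hf)
    ((Real.fourierIntegral_convergent_iff ξ).2 hg)

theorem tendsto_mul_norm_fourierChar_sub_one (s : ℝ) :
    Tendsto (fun n : ℕ => (n : ℝ) * ‖(Real.fourierChar ((n : ℝ)⁻¹ * s) : ℂ) - 1‖) atTop
      (𝓝 (2 * Real.pi * |s|)) := by
  have h := (Real.hasDerivAt_fourierChar (id 0 * s)).scomp (0:ℝ)
    ((hasDerivAt_id (0:ℝ)).mul_const s)
  have h2 := h.tendsto_slope_zero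
  have h3 : Tendsto (fun n : ℕ => ((n:ℝ))⁻¹) atTop (𝓝[≠] 0) :=
    tendsto_inv_atTop_nhdsGT_zero.comp tendsto_natCast_atTop_atTop |>.mono_right
      (nhdsWithin_mono _ (by intro x hx; exact ne_of_gt hx))
  have h4 := (h2.comp h3).norm
  simp only [Function.comp_def, zero_add, zero_mul, id, one_mul, norm_smul, inv_inv,
    Real.fourierChar.map_zero_eq_one] at h4
  convert h4 using 2 with n
  · simp
  · simp [abs_of_pos Real.pi_pos, mul_comm]

/-- If `f` is Lipschitz in `L²` along the direction `u`, then its Fourier transform has a finite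
second moment along `u`. -/
theorem lintegral_inner_fourier_sq_le {f : V → ℂ} (hf : Integrable f) (hf2 : MemLp f 2) (u : V)
    {C : ℝ≥0∞}
    (h : ∀ t : ℝ, ∫⁻ x, ‖f (x + t • u) - f x‖ₑ ^ 2 ≤ C * ‖t‖ₑ ^ 2) :
    ∫⁻ ξ, ‖inner ℝ u ξ‖ₑ ^ 2 * ‖𝓕 f ξ‖ₑ ^ 2 ≤ C := by
  have hn : ∀ n : ℕ, ∫⁻ ξ, ‖(((n : ℝ) * ‖(Real.fourierChar ((n : ℝ)⁻¹ * inner ℝ u ξ) : ℂ) - 1‖ :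
      ℝ) : ℂ) * 𝓕 f ξ‖ₑ ^ 2 ≤ C := by
    intro n
    rcases Nat.eq_zero_or_pos n with rfl | hpos
    · simp
    have i1 : Integrable (fun x => f (x + (n:ℝ)⁻¹ • u)) := hf.comp_add_right _
    have m1 : MemLp (fun x => f (x + (n:ℝ)⁻¹ • u)) 2 :=
      hf2.comp_measurePreserving (measurePreserving_add_right volume _)
    have e := lintegral_fourier_sq (i1.sub hf) (m1.sub hf2)
    have e' : ∀ ξ, 𝓕 ((fun x => f (x + (n:ℝ)⁻¹ • u)) - f) ξ =
        ((Real.fourierChar ((n : ℝ)⁻¹ * inner ℝ u ξ) : ℂ) - 1) * 𝓕 f ξ := by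
      intro ξ
      have := fourier_sub_apply i1 hf ξ
      rw [fourier_comp_add, inner_smul_left] at this
      rw [sub_mul, one_mul]
      exact this
    have hle := h (n:ℝ)⁻¹
    calc _ = ∫⁻ ξ, ‖(n:ℝ)‖ₑ ^ 2 * ‖𝓕 ((fun x => f (x + (n:ℝ)⁻¹ • u)) - f) ξ‖ₑ ^ 2 := by
            refine lintegral_congr fun ξ => ?_
            rw [e', ← mul_pow, ← enorm_norm, ← enorm_norm (_ * _ : ℂ), ← enorm_mul]
            congr 2
            simp
            ring
      _ = ‖(n:ℝ)‖ₑ ^ 2 * ∫⁻ x, ‖f (x + (n:ℝ)⁻¹ • u) - f x‖ₑ ^ 2 := by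
            rw [lintegral_const_mul' _ _ (by simp), e]; rfl
      _ ≤ ‖(n:ℝ)‖ₑ ^ 2 * (C * ‖(n:ℝ)⁻¹‖ₑ ^ 2) := by gcongr
      _ = C := by
            rw [mul_left_comm, ← mul_pow, ← enorm_mul, mul_inv_cancel₀ (by positivity)]
            simp
  have hlim : ∀ ξ, Tendsto (fun n : ℕ => ‖(((n : ℝ) *
      ‖(Real.fourierChar ((n : ℝ)⁻¹ * inner ℝ u ξ) : ℂ) - 1‖ : ℝ) : ℂ) * 𝓕 f ξ‖ₑ ^ 2) atTop
      (𝓝 (‖((2 * Real.pi * |inner ℝ u ξ| : ℝ) : ℂ) * 𝓕 f ξ‖ₑ ^ 2)) := by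
    intro ξ
    have h1 := tendsto_mul_norm_fourierChar_sub_one (inner ℝ u ξ)
    have h2 := ((Complex.continuous_ofReal.tendsto _).comp h1).mul_const (𝓕 f ξ)
    exact ((ENNReal.continuous_pow 2).tendsto _).comp h2.enorm
  calc ∫⁻ ξ, ‖inner ℝ u ξ‖ₑ ^ 2 * ‖𝓕 f ξ‖ₑ ^ 2
      ≤ ∫⁻ ξ, ‖((2 * Real.pi * |inner ℝ u ξ| : ℝ) : ℂ) * 𝓕 f ξ‖ₑ ^ 2 := by
        refine lintegral_mono fun ξ => ?_
        rw [← mul_pow]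
        gcongr
        rw [enorm_mul]
        gcongr
        rw [enorm_le_iff_norm_le, Complex.norm_real, norm_mul, Real.norm_eq_abs, Real.norm_eq_abs,
          Real.norm_eq_abs, abs_abs]
        have : 1 ≤ |2 * Real.pi| := by
          rw [abs_of_pos (by positivity)]; linarith [Real.pi_gt_three]
        exact le_mul_of_one_le_left (abs_nonneg _) this
    _ = ∫⁻ ξ, liminf (fun n : ℕ => ‖(((n : ℝ) *
      ‖(Real.fourierChar ((n : ℝ)⁻¹ * inner ℝ u ξ) : ℂ) - 1‖ : ℝ) : ℂ) * 𝓕 f ξ‖ₑ ^ 2) atTop :=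
        lintegral_congr fun ξ => (hlim ξ).liminf_eq.symm
    _ ≤ liminf (fun n : ℕ => ∫⁻ ξ, ‖(((n : ℝ) *
      ‖(Real.fourierChar ((n : ℝ)⁻¹ * inner ℝ u ξ) : ℂ) - 1‖ : ℝ) : ℂ) * 𝓕 f ξ‖ₑ ^ 2) atTop := by
        refine lintegral_liminf_le fun n => ?_
        have := (continuous_fourier_of_integrable hf).measurable
        have hc : Continuous fun ξ : V => (Real.fourierChar ((n : ℝ)⁻¹ * inner ℝ u ξ) : ℂ) := by
          fun_prop
        fun_prop
    _ ≤ C := by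
        refine liminf_le_of_le (by isBoundedDefault) fun b hb => ?_
        obtain ⟨n, hn'⟩ := hb.exists
        exact hn'.trans (hn n)

end Plancherel

section HalfSpace
open FourierTransform

variable {V : Type*} [NormedAddCommGroup V] [InnerProductSpace ℝ V] [FiniteDimensional ℝ V]
  [MeasurableSpace V] [BorelSpace V]

theorem coe_fourierChar_sum {ι : Type*} (s : Finset ι) (a : ι → ℝ) :
    ((Real.fourierChar (∑ i ∈ s, a i) : Circle) : ℂ)
      = ∏ i ∈ s, ((Real.fourierChar (a i) : Circle) : ℂ) := by
  classical
  induction s using Finset.induction_on with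
  | empty => simp
  | insert i s hi ih => rw [Finset.sum_insert hi, Finset.prod_insert hi, AddChar.map_add_eq_mul,
      Circle.coe_mul, ih]

theorem integral_fourier_pow_mul {φ g : V → ℂ} (hφ : Integrable φ) (hg : Integrable g) (n : ℕ) :
    ∫ x, 𝓕 φ x ^ n * g x = ∫ ζ : Fin n → V, (∏ i, φ (ζ i)) * 𝓕 g (∑ i, ζ i) := by
  let L : (Fin n → V) →ₗ[ℝ] V →ₗ[ℝ] ℝ := (innerₗ V).comp (∑ i, LinearMap.proj i)
  have hL : ∀ ζ x, L ζ x = inner ℝ (∑ i, ζ i) x := by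
    intro ζ x
    simp [L, LinearMap.sum_apply, sum_inner]
  have hLc : Continuous fun p : (Fin n → V) × V => L p.1 p.2 := by
    simp only [hL]
    fun_prop
  have hΦ : Integrable (fun ζ : Fin n → V => ∏ i, φ (ζ i)) := Integrable.fintype_prod fun _ => hφ
  have key := VectorFourier.integral_fourierIntegral_smul_eq_flip (L := L)
    (μ := (volume : Measure (Fin n → V))) (ν := (volume : Measure V))
    Real.continuous_fourierChar hLc hΦ hg
  simp only [smul_eq_mul] at key
  have e1 : ∀ x, VectorFourier.fourierIntegral Real.fourierChar volume L
      (fun ζ : Fin n → V => ∏ i, φ (ζ i)) x = 𝓕 φ x ^ n := by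
    intro x
    have := integral_fintype_prod_volume_eq_pow (𝕜 := ℂ) (ι := Fin n)
      (fun ξ : V => Real.fourierChar (-(inner ℝ ξ x)) • φ ξ)
    rw [Fintype.card_fin] at this
    rw [Real.fourier_eq, ← this, VectorFourier.fourierIntegral]
    refine integral_congr_ae (Eventually.of_forall fun ζ => ?_)
    simp only [hL, sum_inner, Circle.smul_def, smul_eq_mul, Finset.prod_mul_distrib]
    congr 1
    rw [← Finset.sum_neg_distrib, coe_fourierChar_sum]
  have e2 : ∀ ζ, VectorFourier.fourierIntegral Real.fourierChar volume L.flip g ζ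
      = 𝓕 g (∑ i, ζ i) := by
    intro ζ
    rw [Real.fourier_eq, VectorFourier.fourierIntegral]
    simp only [LinearMap.flip_apply, hL, real_inner_comm]
  simp only [e1, e2] at key
  exact key

/-- If `φ` lives in an open half space, then all powers of its Fourier transform have integral
zero. -/
theorem integral_fourier_pow_eq_zero {φ : V → ℂ} (hφ : Integrable φ) {θ : V} (hθ : ‖θ‖ = 1)
    (hsupp : ∀ ξ, φ ξ ≠ 0 → 0 < inner ℝ θ ξ) {n : ℕ}
    (hint : Integrable fun x => 𝓕 φ x ^ n) :
    ∫ x, 𝓕 φ x ^ n = 0 := by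
  let g : ℝ → V → ℂ := fun τ v => Complex.exp (-(((τ⁻¹) ^ 3 : ℝ) : ℂ) * ‖v‖ ^ 2 +
    2 * Real.pi * Complex.I * inner ℝ (-(τ⁻¹ • θ)) v)
  have hcont : Continuous (𝓕 φ) := continuous_fourier_of_integrable hφ
  have hgc : ∀ τ, Continuous (g τ) := fun τ => by fun_prop
  have lim1 : Tendsto (fun τ : ℝ => ∫ x, 𝓕 φ x ^ n * g τ x) atTop (𝓝 (∫ x, 𝓕 φ x ^ n)) := by
    refine tendsto_integral_filter_of_dominated_convergence (fun x => ‖𝓕 φ x ^ n‖) ?_ ?_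
      hint.norm ?_
    · exact Eventually.of_forall fun τ => ((hcont.pow n).mul (hgc τ)).aestronglyMeasurable
    · filter_upwards [eventually_gt_atTop 0] with τ hτ
      refine Eventually.of_forall fun x => ?_
      rw [norm_mul]
      refine mul_le_of_le_one_right (norm_nonneg _) ?_
      rw [Complex.norm_exp, Real.exp_le_one_iff]
      have : 0 ≤ (τ⁻¹) ^ 3 * ‖x‖ ^ 2 := by positivity
      have e : (-(((τ⁻¹) ^ 3 : ℝ) : ℂ) * ‖x‖ ^ 2 +
        2 * Real.pi * Complex.I * inner ℝ (-(τ⁻¹ • θ)) x) =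
        ((-((τ⁻¹) ^ 3 * ‖x‖ ^ 2) : ℝ) : ℂ) + ((2 * Real.pi * inner ℝ (-(τ⁻¹ • θ)) x : ℝ) : ℂ)
          * Complex.I := by push_cast; ring
      rw [e, Complex.add_re, Complex.ofReal_re, Complex.re_ofReal_mul]
      simpa using this
    · refine Eventually.of_forall fun x => ?_
      have h0 : Tendsto (fun τ : ℝ => τ⁻¹) atTop (𝓝 0) := tendsto_inv_atTop_zero
      have hc : Continuous fun s : ℝ => 𝓕 φ x ^ n * Complex.exp (-(((s) ^ 3 : ℝ) : ℂ) * ‖x‖ ^ 2 +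
        2 * Real.pi * Complex.I * inner ℝ (-(s • θ)) x) := by fun_prop
      have := (hc.tendsto 0).comp h0
      simpa [Function.comp_def, g] using this
  have lim2 : Tendsto (fun τ : ℝ => ∫ x, 𝓕 φ x ^ n * g τ x) atTop (𝓝 0) := by
    set d : ℝ := (Module.finrank ℝ V / 2 : ℝ) with hd
    set M : ℝ := ∫ ζ : Fin n → V, ‖∏ i, φ (ζ i)‖ with hM
    have hb : Tendsto (fun τ : ℝ => M * (Real.pi ^ d * (τ ^ (3 * d) *
        Real.exp (-(Real.pi ^ 2) * τ)))) atTop (𝓝 0) := by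
      have := tendsto_rpow_mul_exp_neg_mul_atTop_nhds_zero (3 * d) (Real.pi ^ 2) (by positivity)
      simpa using (this.const_mul (Real.pi ^ d)).const_mul M
    refine squeeze_zero_norm' ?_ hb
    filter_upwards [eventually_gt_atTop 0] with τ hτ
    have hbpos : 0 < ((((τ⁻¹) ^ 3 : ℝ) : ℂ)).re := by
      rw [Complex.ofReal_re]; positivity
    have hgint : Integrable (g τ) :=
      GaussianFourier.integrable_cexp_neg_mul_sq_norm_add hbpos (2 * Real.pi * Complex.I)
        (-(τ⁻¹ • θ))
    rw [integral_fourier_pow_mul hφ hgint, hM, ← integral_mul_const]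
    have hΦ : Integrable (fun ζ : Fin n → V => ∏ i, φ (ζ i)) :=
      Integrable.fintype_prod fun _ => hφ
    refine norm_integral_le_of_norm_le (hΦ.norm.mul_const _) (Eventually.of_forall fun ζ => ?_)
    rw [norm_mul]
    by_cases hz : ∀ i, φ (ζ i) ≠ 0
    swap
    · push Not at hz
      obtain ⟨i, hi⟩ := hz
      rw [Finset.prod_eq_zero (Finset.mem_univ i) hi]
      simp
    refine mul_le_mul_of_nonneg_left ?_ (norm_nonneg _)
    rw [fourier_gaussian_innerProductSpace' hbpos, norm_mul, ← mul_assoc]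
    have n1 : ‖((Real.pi : ℂ) / (((τ⁻¹) ^ 3 : ℝ) : ℂ)) ^ (Module.finrank ℝ V / 2 : ℂ)‖ =
        Real.pi ^ d * τ ^ (3 * d) := by
      rw [← Complex.ofReal_div, Complex.norm_cpow_eq_rpow_re_of_pos (by positivity)]
      have : ((Module.finrank ℝ V / 2 : ℂ)).re = d := by
        rw [hd]
        have : (Module.finrank ℝ V / 2 : ℂ) = ((Module.finrank ℝ V / 2 : ℝ) : ℂ) := by
          push_cast; rfl
        rw [this, Complex.ofReal_re]
      rw [this, inv_pow, div_inv_eq_mul, Real.mul_rpow Real.pi_pos.le (by positivity),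
        Real.rpow_mul hτ.le]
      norm_cast
    rw [n1]
    refine mul_le_mul_of_nonneg_left ?_ (by positivity)
    have e : (-(Real.pi : ℂ) ^ 2 * ‖-(τ⁻¹ • θ) - ∑ i, ζ i‖ ^ 2 / (((τ⁻¹) ^ 3 : ℝ) : ℂ)) =
        ((-(Real.pi ^ 2) * (‖-(τ⁻¹ • θ) - ∑ i, ζ i‖ ^ 2 * τ ^ 3) : ℝ) : ℂ) := by
      push_cast
      rw [inv_pow, div_inv_eq_mul]; ring
    rw [e, Complex.norm_exp, Complex.ofReal_re, Real.exp_le_exp]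
    have h1 : τ⁻¹ ≤ ‖-(τ⁻¹ • θ) - ∑ i, ζ i‖ := by
      have h2 := abs_real_inner_le_norm θ (-(τ⁻¹ • θ) - ∑ i, ζ i)
      rw [hθ, one_mul, inner_sub_right, inner_neg_right, inner_smul_right,
        real_inner_self_eq_norm_sq, hθ, inner_sum] at h2
      have h3 : 0 ≤ ∑ i, inner ℝ θ (ζ i) := Finset.sum_nonneg fun i _ => (hsupp _ (hz i)).le
      refine le_trans ?_ h2
      rw [← abs_neg]
      refine le_trans ?_ (le_abs_self _)
      linarith
    have h4 : τ ≤ ‖-(τ⁻¹ • θ) - ∑ i, ζ i‖ ^ 2 * τ ^ 3 := by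
      calc τ = (τ⁻¹) ^ 2 * τ ^ 3 := by field_simp
        _ ≤ _ := by gcongr
    have := mul_le_mul_of_nonneg_left h4 (sq_nonneg Real.pi)
    linarith
  exact tendsto_nhds_unique lim1 lim2

theorem exists_im_pow_le (m : ℕ) :
    ∃ C : ℝ, 0 ≤ C ∧ ∀ z : ℂ, z.im ^ (4 * m) ≤ 2 * (z ^ (4 * m)).re + C * z.re ^ (4 * m) := by
  have hc : Continuous fun t : ℝ => ((1 - t * Complex.I : ℂ) ^ (4 * m)).re := by fun_prop
  have h0 : ∀ᶠ t : ℝ in 𝓝 0, 1 / 2 < ((1 - t * Complex.I : ℂ) ^ (4 * m)).re := by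
    refine (hc.tendsto 0).eventually_const_lt ?_
    simp
    norm_num
  obtain ⟨δ, hδ, hδ'⟩ := Metric.eventually_nhds_iff.1 h0
  have hev : Even (4 * m) := ⟨2 * m, by ring⟩
  refine ⟨3 * (1 + 1 / δ) ^ (4 * m), by positivity, fun z => ?_⟩
  have hp : 0 ≤ z.re ^ (4 * m) := hev.pow_nonneg _
  by_cases hz : |z.re| < δ * |z.im|
  · have him : z.im ≠ 0 := by
      rintro h; rw [h, abs_zero, mul_zero] at hz; exact absurd hz (not_lt.2 (abs_nonneg _))
    have e : z = (z.im : ℂ) * Complex.I * (1 - ((z.re / z.im : ℝ) : ℂ) * Complex.I) := by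
      apply Complex.ext
      · simp
        field_simp
      · simp
    have e2 : (z ^ (4 * m)).re = z.im ^ (4 * m) *
        ((1 - ((z.re / z.im : ℝ) : ℂ) * Complex.I) ^ (4 * m)).re := by
      conv_lhs => rw [e, mul_pow, mul_pow, pow_mul Complex.I, Complex.I_pow_four, one_pow, mul_one]
      rw [← Complex.ofReal_pow, Complex.re_ofReal_mul]
    have h3 := @hδ' (z.re / z.im) (by
      rw [dist_zero_right, Real.norm_eq_abs, abs_div, div_lt_iff₀ (abs_pos.2 him)]; exact hz)
    have h4 : 0 ≤ z.im ^ (4 * m) := hev.pow_nonneg _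
    rw [e2]
    have : 0 ≤ 3 * (1 + 1 / δ) ^ (4 * m) * z.re ^ (4 * m) := by positivity
    nlinarith
  · push Not at hz
    have h1 : |z.im| ≤ |z.re| / δ := by rw [le_div_iff₀ hδ, mul_comm]; exact hz
    have h2 : z.im ^ (4 * m) ≤ (1 + 1 / δ) ^ (4 * m) * z.re ^ (4 * m) := by
      rw [← hev.pow_abs z.im, ← hev.pow_abs z.re, ← mul_pow]
      refine pow_le_pow_left₀ (abs_nonneg _) (h1.trans ?_) _
      rw [add_mul, one_mul, div_mul_eq_mul_div, one_mul]
      linarith [abs_nonneg z.re]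
    have h3 : |(z ^ (4 * m)).re| ≤ (1 + 1 / δ) ^ (4 * m) * z.re ^ (4 * m) := by
      refine (Complex.abs_re_le_norm _).trans ?_
      rw [norm_pow, ← hev.pow_abs z.re, ← mul_pow]
      refine pow_le_pow_left₀ (norm_nonneg _) ((Complex.norm_le_abs_re_add_abs_im z).trans ?_) _
      rw [add_mul, one_mul, div_mul_eq_mul_div, one_mul]
      linarith
    have h4 := (abs_le.1 h3).1
    nlinarith

/-- The directional Hilbert transform, with multiplier `sign ⟪θ, ξ⟫`. -/
noncomputable def dirHilbert (θ : V) (h : V → ℝ) : V → ℂ :=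
  𝓕⁻ fun ξ => ((Real.sign (inner ℝ θ ξ) : ℝ) : ℂ) * 𝓕 (fun y => ((h y : ℝ) : ℂ)) ξ

theorem ae_inner_ne_zero {θ : V} (hθ : ‖θ‖ = 1) : ∀ᵐ ξ : V, inner ℝ θ ξ ≠ 0 := by
  have h : (LinearMap.ker (innerₗ V θ)) ≠ ⊤ := by
    intro h
    have : θ ∈ LinearMap.ker (innerₗ V θ) := h ▸ Submodule.mem_top
    simp [hθ] at this
  have := Measure.addHaar_submodule volume _ h
  rw [ae_iff]
  convert this using 2
  ext ξ
  simp

theorem conj_fourier_ofReal (h : V → ℝ) (ξ : V) :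
    (starRingEnd ℂ) (𝓕 (fun y => ((h y : ℝ) : ℂ)) ξ) = 𝓕 (fun y => ((h y : ℝ) : ℂ)) (-ξ) := by
  rw [Real.fourier_eq, Real.fourier_eq, ← integral_conj]
  refine integral_congr_ae (Eventually.of_forall fun x => ?_)
  simp [Circle.smul_def, ← Circle.coe_inv_eq_conj, ← AddChar.map_neg_eq_inv]

/-- M. Riesz' theorem for directional Hilbert transforms and exponents divisible by four. -/
theorem exists_lintegral_dirHilbert_le {m : ℕ} (hm : 1 ≤ m) :
    ∃ C : ℝ≥0∞, C ≠ ∞ ∧ ∀ (θ : V) (_ : ‖θ‖ = 1) (h : V → ℝ) (_ : Continuous h)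
      (_ : Integrable h) (_ : MemLp (fun y => ((h y : ℝ) : ℂ)) 2)
      (_ : Integrable (𝓕 fun y => ((h y : ℝ) : ℂ))),
      ∫⁻ x, ‖dirHilbert θ h x‖ₑ ^ (4 * m) ≤ C * ∫⁻ x, ‖h x‖ₑ ^ (4 * m) := by
  obtain ⟨C, hC, hCz⟩ := exists_im_pow_le m
  refine ⟨ENNReal.ofReal C, ENNReal.ofReal_ne_top, fun θ hθ h hcont hint hL2 hF => ?_⟩
  set H : V → ℂ := fun y => ((h y : ℝ) : ℂ) with hH
  have hev : Even (4 * m) := ⟨2 * m, by ring⟩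
  have hHint : Integrable H := hint.ofReal
  have hFL2 : MemLp (𝓕 H) 2 := memLp_fourier hHint hL2
  set S : Set V := {ξ | 0 < inner ℝ θ ξ} with hS
  set S' : Set V := {ξ | inner ℝ θ ξ < 0} with hS'
  have hSm : MeasurableSet S := (isOpen_lt continuous_const (by fun_prop)).measurableSet
  have hSm' : MeasurableSet S' := (isOpen_lt (by fun_prop) continuous_const).measurableSet
  set φ : V → ℂ := S.indicator (𝓕 H) with hφ
  set ψ : V → ℂ := S'.indicator (𝓕 H) with hψ
  have iφ : Integrable φ := hF.indicator hSm
  have iψ : Integrable ψ := hF.indicator hSm'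
  have lφ : MemLp φ 2 := hFL2.indicator hSm
  set F : V → ℂ := 𝓕⁻ φ with hFdef
  have hFc : Continuous F := continuous_fourierInv_of_integrable iφ
  have hFL : MemLp F 2 := memLp_fourierInv iφ lφ
  have hconj : ∀ x, (starRingEnd ℂ) (F x) = 𝓕⁻ ψ x := by
    intro x
    rw [hFdef, Real.fourierInv_eq, Real.fourierInv_eq, ← integral_conj,
      ← integral_neg_eq_self]
    refine integral_congr_ae (Eventually.of_forall fun ξ => ?_)
    have e1 : (starRingEnd ℂ) (φ (-ξ)) = ψ ξ := by
      simp only [hφ, hψ, Set.indicator, hS, hS', Set.mem_ofPred_eq, inner_neg_right,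
        Left.neg_pos_iff]
      split_ifs
      · rw [hH, conj_fourier_ofReal, neg_neg]
      · simp
    simp only [Circle.smul_def, smul_eq_mul, map_mul, e1]
    rw [← Circle.coe_inv_eq_conj, ← AddChar.map_neg_eq_inv, inner_neg_left, neg_neg]
  have hadd : ∀ x, F x + 𝓕⁻ ψ x = H x := by
    intro x
    have := congrFun (Continuous.fourierInv_fourier_eq (by fun_prop : Continuous H) hHint hF) x
    rw [← this, hFdef, Real.fourierInv_eq, Real.fourierInv_eq, Real.fourierInv_eq,
      ← integral_add]
    · refine integral_congr_ae ?_
      filter_upwards [ae_inner_ne_zero hθ] with ξ hξ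
      rw [← smul_add]
      congr 1
      simp only [hφ, hψ, Set.indicator, hS, hS', Set.mem_ofPred_eq]
      rcases lt_or_gt_of_ne hξ with h1 | h1
      · simp [h1, h1.le.not_gt]
      · simp [h1, h1.le.not_gt]
    · simpa using (Real.fourierIntegral_convergent_iff (-x)).2 iφ
    · simpa using (Real.fourierIntegral_convergent_iff (-x)).2 iψ
  have hsub : ∀ x, F x - 𝓕⁻ ψ x = dirHilbert θ h x := by
    intro x
    rw [hFdef, dirHilbert, Real.fourierInv_eq, Real.fourierInv_eq, Real.fourierInv_eq,
      ← integral_sub]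
    · refine integral_congr_ae (Eventually.of_forall fun ξ => ?_)
      simp only
      rw [← smul_sub]
      congr 1
      simp only [hφ, hψ, Set.indicator, hS, hS', Set.mem_ofPred_eq]
      rcases lt_trichotomy (inner ℝ θ ξ) 0 with h1 | h1 | h1
      · simp [h1, h1.le.not_gt, Real.sign_of_neg h1, hH]
      · simp [h1]
      · simp [h1, h1.le.not_gt, Real.sign_of_pos h1, hH]
    · simpa using (Real.fourierIntegral_convergent_iff (-x)).2 iφ
    · simpa using (Real.fourierIntegral_convergent_iff (-x)).2 iψ
  have hre : ∀ x, 2 * (F x).re = h x := by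
    intro x
    have := congrArg Complex.re (hadd x)
    rw [← hconj] at this
    simp [hH] at this
    linarith
  have him : ∀ x, ‖dirHilbert θ h x‖ = |2 * (F x).im| := by
    intro x
    rw [← hsub, ← hconj, Complex.sub_conj]
    simp
  have hbd : ∀ x, ‖F x‖ ≤ ∫ ξ, ‖φ ξ‖ := by
    intro x
    rw [hFdef, Real.fourierInv_eq_fourier_neg]
    exact norm_fourier_le_integral _
  have hsq : Integrable fun x => ‖F x‖ ^ 2 := hFL.integrable_norm_pow (by norm_num)
  have hpow : Integrable fun x => ‖F x‖ ^ (4 * m) := by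
    refine (hsq.const_mul ((∫ ξ, ‖φ ξ‖) ^ (4 * m - 2))).mono'
      (hFc.norm.pow _).aestronglyMeasurable (Eventually.of_forall fun x => ?_)
    rw [norm_pow, norm_norm]
    calc ‖F x‖ ^ (4 * m) = ‖F x‖ ^ (4 * m - 2) * ‖F x‖ ^ 2 := by
          rw [← pow_add]; congr 1; omega
      _ ≤ _ := by gcongr; exact hbd x
  have hpowF : Integrable fun x => F x ^ (4 * m) := by
    refine hpow.mono' (hFc.pow _).aestronglyMeasurable (Eventually.of_forall fun x => ?_)
    rw [norm_pow]
  have hzero : ∫ x, F x ^ (4 * m) = 0 := by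
    have e : F = 𝓕 fun x => φ (-x) := by
      rw [hFdef, Real.fourierInv_eq_fourier_comp_neg]
    rw [e] at hpowF ⊢
    refine integral_fourier_pow_eq_zero iφ.comp_neg (θ := -θ) (by rwa [norm_neg]) ?_ hpowF
    intro ξ hξ
    have : -ξ ∈ S := Set.mem_of_indicator_ne_zero hξ
    simpa [hS] using this
  have hreint : Integrable fun x => (2 * (F x).re) ^ (4 * m) := by
    refine (hpow.const_mul (2 ^ (4 * m))).mono' (by fun_prop) (Eventually.of_forall fun x => ?_)
    rw [norm_pow, ← mul_pow, norm_mul, Real.norm_two]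
    gcongr
    exact Complex.abs_re_le_norm _
  have himint : Integrable fun x => (2 * (F x).im) ^ (4 * m) := by
    refine (hpow.const_mul (2 ^ (4 * m))).mono' (by fun_prop) (Eventually.of_forall fun x => ?_)
    rw [norm_pow, ← mul_pow, norm_mul, Real.norm_two]
    gcongr
    exact Complex.abs_im_le_norm _
  have hreF : Integrable fun x => (F x ^ (4 * m)).re := hpowF.re
  have main : ∫ x, (2 * (F x).im) ^ (4 * m) ≤ C * ∫ x, (2 * (F x).re) ^ (4 * m) := by
    have h0 : ∫ x, (F x ^ (4 * m)).re = 0 := by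
      have := integral_re hpowF
      rw [hzero] at this
      simpa using this
    calc ∫ x, (2 * (F x).im) ^ (4 * m)
        ≤ ∫ x, (2 ^ (4 * m) * 2 * (F x ^ (4 * m)).re + C * (2 * (F x).re) ^ (4 * m)) := by
          refine integral_mono himint ((hreF.const_mul _).add (hreint.const_mul _)) fun x => ?_
          have := mul_le_mul_of_nonneg_left (hCz (F x)) (by positivity : (0:ℝ) ≤ 2 ^ (4 * m))
          simp only [mul_pow]
          linarith
      _ = C * ∫ x, (2 * (F x).re) ^ (4 * m) := by
          rw [integral_add (hreF.const_mul _) (hreint.const_mul _), integral_const_mul,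
            integral_const_mul, h0, mul_zero, zero_add]
  have c1 : ∫⁻ x, ‖dirHilbert θ h x‖ₑ ^ (4 * m)
      = ENNReal.ofReal (∫ x, (2 * (F x).im) ^ (4 * m)) := by
    rw [ofReal_integral_eq_lintegral_ofReal himint
      (Eventually.of_forall fun x => hev.pow_nonneg _)]
    refine lintegral_congr fun x => ?_
    rw [← hev.pow_abs, ENNReal.ofReal_pow (abs_nonneg _), ← him, ofReal_norm]
  have c2 : ∫⁻ x, ‖h x‖ₑ ^ (4 * m) = ENNReal.ofReal (∫ x, (2 * (F x).re) ^ (4 * m)) := by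
    rw [ofReal_integral_eq_lintegral_ofReal hreint
      (Eventually.of_forall fun x => hev.pow_nonneg _)]
    refine lintegral_congr fun x => ?_
    rw [← hev.pow_abs, ENNReal.ofReal_pow (abs_nonneg _), hre, ← Real.norm_eq_abs,
      ofReal_norm]
  rw [c1, c2, ← ENNReal.ofReal_mul hC]
  exact ENNReal.ofReal_le_ofReal main

end HalfSpace

section Rotation
open FourierTransform Real

theorem measurable_real_sign : Measurable Real.sign := by
  unfold Real.sign
  exact Measurable.ite measurableSet_Iio measurable_const
    (Measurable.ite measurableSet_Ioi measurable_const measurable_const)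

theorem norm_real_sign_le (r : ℝ) : ‖Real.sign r‖ ≤ 1 := by
  rcases Real.sign_apply_eq r with h | h | h <;> simp [h]

theorem real_sign_mul_self (r : ℝ) : r * Real.sign r = |r| := by
  rcases lt_trichotomy r 0 with h | rfl | h
  · rw [Real.sign_of_neg h, abs_of_neg h]; ring
  · simp
  · rw [Real.sign_of_pos h, abs_of_pos h]; ring

theorem lintegral_pow_le_const_mul {α : Type*} [MeasurableSpace α] {μ : Measure α}
    {f : α → ℂ} (hf : AEStronglyMeasurable f μ) {n : ℕ} (hn : 1 ≤ n) :
    (∫⁻ x, ‖f x‖ₑ ∂μ) ^ n ≤ μ Set.univ ^ (n - 1 : ℝ) * ∫⁻ x, ‖f x‖ₑ ^ n ∂μ := by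
  have hn' : (1 : ℝ) ≤ n := by exact_mod_cast hn
  have h := eLpNorm'_le_eLpNorm'_mul_rpow_measure_univ (μ := μ) one_pos hn' hf
  rw [eLpNorm'_eq_lintegral_enorm, eLpNorm'_eq_lintegral_enorm] at h
  simp only [ENNReal.rpow_one, div_one, ENNReal.rpow_natCast] at h
  calc (∫⁻ x, ‖f x‖ₑ ∂μ) ^ n
      ≤ ((∫⁻ x, ‖f x‖ₑ ^ n ∂μ) ^ (1 / (n:ℝ)) * μ Set.univ ^ (1 - 1 / (n:ℝ))) ^ n := by gcongr
    _ = _ := by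
      rw [mul_pow, ← ENNReal.rpow_natCast, ← ENNReal.rpow_natCast, ← ENNReal.rpow_mul,
        ← ENNReal.rpow_mul, mul_comm]
      congr 2
      · field_simp
      · rw [one_div_mul_cancel (by positivity), ENNReal.rpow_one]

/-- The unit vector in direction `t`. -/
noncomputable def unitVec (t : ℝ) : EuclideanSpace ℝ (Fin 2) := !₂[cos t, sin t]

theorem inner_unitVec (t : ℝ) (ξ : EuclideanSpace ℝ (Fin 2)) :
    inner ℝ (unitVec t) ξ = ξ 0 * cos t + ξ 1 * sin t := by
  simp [unitVec, PiLp.inner_apply, Fin.sum_univ_two]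

theorem norm_unitVec (t : ℝ) : ‖unitVec t‖ = 1 := by
  rw [EuclideanSpace.norm_eq, Fin.sum_univ_two]
  simp [unitVec]

theorem exists_polar (ξ : EuclideanSpace ℝ (Fin 2)) :
    ∃ φ : ℝ, ξ 0 = ‖ξ‖ * cos φ ∧ ξ 1 = ‖ξ‖ * sin φ := by
  set z : ℂ := ⟨ξ 0, ξ 1⟩ with hz
  have hn : ‖z‖ = ‖ξ‖ := by
    rw [EuclideanSpace.norm_eq, Fin.sum_univ_two, Complex.norm_def, Complex.normSq_apply]
    simp [hz, sq]
  refine ⟨Complex.arg z, ?_, ?_⟩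
  · rw [← hn, Complex.norm_mul_cos_arg]
  · rw [← hn, Complex.norm_mul_sin_arg]

theorem integral_sin_mul_sign (ξ : EuclideanSpace ℝ (Fin 2)) :
    ∫ t in -π..π, sin t * Real.sign (inner ℝ (unitVec t) ξ)
      = (∫ t in -π..π, |cos t|) * (ξ 1 / ‖ξ‖) := by
  obtain ⟨φ, h0, h1⟩ := exists_polar ξ
  rcases eq_or_ne ξ 0 with rfl | hξ
  · simp
  have hr : 0 < ‖ξ‖ := norm_pos_iff.2 hξ
  set g : ℝ → ℝ := fun s => sin (s + φ) * Real.sign (cos s) with hg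
  have hgp : Function.Periodic g (2 * π) := by
    intro s
    simp only [hg]
    rw [add_right_comm, sin_add_two_pi, cos_add_two_pi]
  have e1 : ∀ t, sin t * Real.sign (inner ℝ (unitVec t) ξ) = g (t - φ) := by
    intro t
    have : inner ℝ (unitVec t) ξ = ‖ξ‖ * cos (t - φ) := by
      rw [inner_unitVec, h0, h1, cos_sub]; ring
    rw [this]
    simp only [hg, sub_add_cancel]
    congr 1
    rcases lt_trichotomy (cos (t - φ)) 0 with h | h | h
    · rw [Real.sign_of_neg h, Real.sign_of_neg (mul_neg_of_pos_of_neg hr h)]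
    · rw [h, mul_zero]
    · rw [Real.sign_of_pos h, Real.sign_of_pos (mul_pos hr h)]
  simp only [e1]
  rw [intervalIntegral.integral_comp_sub_right g φ]
  have e2 : ∫ s in (-π - φ)..(π - φ), g s = ∫ s in -π..π, g s := by
    have := hgp.intervalIntegral_add_eq (-π - φ) (-π)
    rw [show -π - φ + 2 * π = π - φ by ring, show -π + 2 * π = π by ring] at this
    exact this
  rw [e2]
  have e3 : ∀ s, g s = (cos φ * (sin s * Real.sign (cos s))) + (sin φ * |cos s|) := by
    intro s
    simp only [hg]
    rw [sin_add, ← real_sign_mul_self (cos s)]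
    ring
  simp only [e3]
  have i1 : IntervalIntegrable (fun s => sin s * Real.sign (cos s)) volume (-π) π := by
    refine IntervalIntegrable.mono_fun (g := fun s => sin s * Real.sign (cos s))
      (f := fun _ => (1:ℝ)) (by simp) ?_ ?_
    · exact (measurable_sin.mul (measurable_real_sign.comp measurable_cos)).aestronglyMeasurable
    · refine Eventually.of_forall fun s => ?_
      simp only [norm_mul, norm_one]
      exact mul_le_one₀ (by simpa using abs_sin_le_one s) (norm_nonneg _) (norm_real_sign_le _)
  have i2 : IntervalIntegrable (fun s => |cos s|) volume (-π) π :=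
    (continuous_cos.abs).intervalIntegrable _ _
  rw [intervalIntegral.integral_add (i1.const_mul _) (i2.const_mul _),
    intervalIntegral.integral_const_mul, intervalIntegral.integral_const_mul]
  have e4 : ∫ s in -π..π, sin s * Real.sign (cos s) = 0 := by
    have := intervalIntegral.integral_comp_neg (a := -π) (b := π)
      (fun s => sin s * Real.sign (cos s))
    simp only [sin_neg, cos_neg, neg_neg, neg_mul, intervalIntegral.integral_neg] at this
    linarith
  rw [e4, h1]
  field_simp
  ring

theorem integral_abs_cos_pos : 0 < ∫ t in -π..π, |cos t| := by
  refine intervalIntegral.integral_pos (by linarith [pi_pos]) continuous_cos.abs.continuousOn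
    (fun x _ => abs_nonneg _) ⟨0, ⟨by linarith [pi_pos], pi_pos.le⟩, by simp⟩

/-- The second Riesz transform on the Euclidean plane, up to the factor `-i`. -/
noncomputable def rieszPlane (h : EuclideanSpace ℝ (Fin 2) → ℝ) :
    EuclideanSpace ℝ (Fin 2) → ℂ :=
  𝓕⁻ fun ξ => ((ξ 1 / ‖ξ‖ : ℝ) : ℂ) * 𝓕 (fun y => ((h y : ℝ) : ℂ)) ξ

theorem measurable_sign_inner_unitVec :
    Measurable fun p : ℝ × EuclideanSpace ℝ (Fin 2) =>
      Real.sign (inner ℝ (unitVec p.1) p.2) := by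
  simp only [inner_unitVec]
  exact measurable_real_sign.comp (by fun_prop)

theorem rieszPlane_eq_integral {h : EuclideanSpace ℝ (Fin 2) → ℝ}
    (hint : Integrable h)
    (hF : Integrable (𝓕 fun y => ((h y : ℝ) : ℂ))) (x : EuclideanSpace ℝ (Fin 2)) :
    ((∫ t in -π..π, |cos t| : ℝ) : ℂ) * rieszPlane h x
      = ∫ t in Set.Ioc (-π) π, (sin t : ℂ) * dirHilbert (unitVec t) h x := by
  have hm := measurable_sign_inner_unitVec
  have hFc := continuous_fourier_of_integrable hint.ofReal
  have hI : Integrable (Function.uncurry fun (t : ℝ) (ξ : EuclideanSpace ℝ (Fin 2)) =>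
      (Real.fourierChar (inner ℝ ξ x) : ℂ) * (((sin t * Real.sign (inner ℝ (unitVec t) ξ) : ℝ) : ℂ)
        * 𝓕 (fun y => ((h y : ℝ) : ℂ)) ξ)) ((volume.restrict (Set.Ioc (-π) π)).prod volume) := by
    have := (integrable_const (μ := volume.restrict (Set.Ioc (-π) π)) (1:ℝ)).mul_prod hF.norm
    refine this.mono' ?_ (Eventually.of_forall ?_)
    · have h1 : Measurable fun p : ℝ × EuclideanSpace ℝ (Fin 2) =>
          (Real.fourierChar (inner ℝ p.2 x) : ℂ) :=
        (by fun_prop : Continuous fun p : ℝ × EuclideanSpace ℝ (Fin 2) =>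
          (Real.fourierChar (inner ℝ p.2 x) : ℂ)).measurable
      have h2 : Measurable fun p : ℝ × EuclideanSpace ℝ (Fin 2) =>
          ((sin p.1 * Real.sign (inner ℝ (unitVec p.1) p.2) : ℝ) : ℂ) :=
        Complex.measurable_ofReal.comp ((measurable_sin.comp measurable_fst).mul hm)
      exact (h1.mul (h2.mul (hFc.measurable.comp measurable_snd))).aestronglyMeasurable
    · rintro ⟨t, ξ⟩
      simp only [Function.uncurry, norm_mul, one_mul, Circle.norm_coe, Complex.norm_real]
      refine mul_le_of_le_one_left (norm_nonneg _) ?_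
      exact mul_le_one₀ (by simpa using abs_sin_le_one t) (norm_nonneg _) (norm_real_sign_le _)
  have hsw := integral_integral_swap hI
  have e1 : ∀ t, (∫ ξ : EuclideanSpace ℝ (Fin 2), (Real.fourierChar (inner ℝ ξ x) : ℂ) *
      (((sin t * Real.sign (inner ℝ (unitVec t) ξ) : ℝ) : ℂ)
        * 𝓕 (fun y => ((h y : ℝ) : ℂ)) ξ)) = (sin t : ℂ) * dirHilbert (unitVec t) h x := by
    intro t
    rw [dirHilbert, Real.fourierInv_eq, ← integral_const_mul]
    refine integral_congr_ae (Eventually.of_forall fun ξ => ?_)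
    simp only [Circle.smul_def, smul_eq_mul]
    push_cast
    ring
  simp only [e1] at hsw
  rw [hsw, rieszPlane, Real.fourierInv_eq, ← integral_const_mul]
  refine integral_congr_ae (Eventually.of_forall fun ξ => ?_)
  simp only [Circle.smul_def, smul_eq_mul]
  rw [integral_const_mul, integral_mul_const, integral_complex_ofReal,
    ← intervalIntegral.integral_of_le (by linarith [pi_pos]), integral_sin_mul_sign]
  push_cast
  ring

theorem stronglyMeasurable_dirHilbert_unitVec {h : EuclideanSpace ℝ (Fin 2) → ℝ}
    (hint : Integrable h) :
    StronglyMeasurable fun p : ℝ × EuclideanSpace ℝ (Fin 2) => dirHilbert (unitVec p.1) h p.2 := by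
  have hFc := continuous_fourier_of_integrable hint.ofReal
  simp only [dirHilbert, Real.fourierInv_eq, Circle.smul_def, smul_eq_mul]
  refine StronglyMeasurable.integral_prod_right (f := fun (p : ℝ × EuclideanSpace ℝ (Fin 2)) ξ =>
    (Real.fourierChar (inner ℝ ξ p.2) : ℂ) * (((Real.sign (inner ℝ (unitVec p.1) ξ) : ℝ) : ℂ)
        * 𝓕 (fun y => ((h y : ℝ) : ℂ)) ξ)) ?_
  refine Measurable.stronglyMeasurable ?_
  simp only [Function.uncurry_def]
  have h1 : Measurable fun q : (ℝ × EuclideanSpace ℝ (Fin 2)) × EuclideanSpace ℝ (Fin 2) =>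
      (Real.fourierChar (inner ℝ q.2 q.1.2) : ℂ) :=
    (by fun_prop : Continuous fun q : (ℝ × EuclideanSpace ℝ (Fin 2)) × EuclideanSpace ℝ (Fin 2) =>
          (Real.fourierChar (inner ℝ q.2 q.1.2) : ℂ)).measurable
  have h2 : Measurable fun q : (ℝ × EuclideanSpace ℝ (Fin 2)) × EuclideanSpace ℝ (Fin 2) =>
      ((Real.sign (inner ℝ (unitVec q.1.1) q.2) : ℝ) : ℂ) :=
    Complex.measurable_ofReal.comp (measurable_sign_inner_unitVec.comp
      ((measurable_fst.comp measurable_fst).prodMk measurable_snd))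
  exact h1.mul (h2.mul (hFc.measurable.comp measurable_snd))

/-- The method of rotations: the Riesz transform is bounded for exponents divisible by four. -/
theorem exists_lintegral_rieszPlane_le {m : ℕ} (hm : 1 ≤ m) :
    ∃ C : ℝ≥0∞, C ≠ ∞ ∧ ∀ (h : EuclideanSpace ℝ (Fin 2) → ℝ) (_ : Continuous h)
      (_ : Integrable h) (_ : MemLp (fun y => ((h y : ℝ) : ℂ)) 2)
      (_ : Integrable (𝓕 fun y => ((h y : ℝ) : ℂ))),
      ∫⁻ x, ‖rieszPlane h x‖ₑ ^ (4 * m) ≤ C * ∫⁻ x, ‖h x‖ₑ ^ (4 * m) := by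
  obtain ⟨C, hC, hCb⟩ := exists_lintegral_dirHilbert_le (V := EuclideanSpace ℝ (Fin 2)) hm
  set c : ℝ := ∫ t in -π..π, |cos t| with hc
  have hcpos : 0 < c := integral_abs_cos_pos
  set μ : Measure ℝ := volume.restrict (Set.Ioc (-π) π) with hμ
  set K : ℝ≥0∞ := μ Set.univ ^ (((4 * m : ℕ) : ℝ) - 1) with hK
  have hμfin : μ Set.univ ≠ ∞ := measure_ne_top _ _
  have hKfin : K ≠ ∞ := by
    refine ENNReal.rpow_ne_top_of_nonneg ?_ hμfin
    have : (1:ℝ) ≤ ((4 * m : ℕ) : ℝ) := by exact_mod_cast (by omega : 1 ≤ 4 * m)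
    linarith
  refine ⟨(‖(c:ℂ)‖ₑ ^ (4 * m))⁻¹ * (K * (C * μ Set.univ)), ?_, fun h hcont hint hL2 hF => ?_⟩
  · refine ENNReal.mul_ne_top (ENNReal.inv_ne_top.2 (pow_ne_zero _ ?_))
      (ENNReal.mul_ne_top hKfin (ENNReal.mul_ne_top hC hμfin))
    simpa using hcpos.ne'
  have hsm := stronglyMeasurable_dirHilbert_unitVec hint
  have hpt : ∀ x, ‖(c:ℂ)‖ₑ ^ (4 * m) * ‖rieszPlane h x‖ₑ ^ (4 * m)
      ≤ K * ∫⁻ t, ‖dirHilbert (unitVec t) h x‖ₑ ^ (4 * m) ∂μ := by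
    intro x
    have hsx : StronglyMeasurable fun t => dirHilbert (unitVec t) h x :=
      hsm.comp_measurable (g := fun t : ℝ => (t, x)) (by fun_prop)
    rw [← mul_pow, ← enorm_mul, hc, rieszPlane_eq_integral hint hF]
    refine le_trans ?_ (lintegral_pow_le_const_mul hsx.aestronglyMeasurable (by omega))
    gcongr
    refine (enorm_integral_le_lintegral_enorm _).trans (lintegral_mono fun t => ?_)
    rw [enorm_mul]
    refine mul_le_of_le_one_left' ?_
    exact (enorm_le_iff_norm_le.2 (by
      rw [Complex.norm_real, norm_one]; exact abs_sin_le_one t :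
          ‖((sin t : ℝ) : ℂ)‖ ≤ ‖(1:ℂ)‖) |>.trans_eq (by simp))
  calc ∫⁻ x, ‖rieszPlane h x‖ₑ ^ (4 * m)
      = (‖(c:ℂ)‖ₑ ^ (4 * m))⁻¹ * ∫⁻ x, ‖(c:ℂ)‖ₑ ^ (4 * m) * ‖rieszPlane h x‖ₑ ^ (4 * m) := by
        rw [lintegral_const_mul' _ _ (by simp), ← mul_assoc, ENNReal.inv_mul_cancel, one_mul]
        · exact pow_ne_zero _ (by simpa using hcpos.ne')
        · simp
    _ ≤ (‖(c:ℂ)‖ₑ ^ (4 * m))⁻¹ *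
        ∫⁻ x, K * ∫⁻ t, ‖dirHilbert (unitVec t) h x‖ₑ ^ (4 * m) ∂μ := by
        exact mul_le_mul_right (lintegral_mono hpt) _
    _ = (‖(c:ℂ)‖ₑ ^ (4 * m))⁻¹ *
        (K * ∫⁻ t, ∫⁻ x, ‖dirHilbert (unitVec t) h x‖ₑ ^ (4 * m) ∂volume ∂μ) := by
        rw [lintegral_const_mul' _ _ hKfin, lintegral_lintegral_swap]
        exact ((hsm.measurable.comp measurable_swap).enorm.pow_const _).aemeasurable
    _ ≤ (‖(c:ℂ)‖ₑ ^ (4 * m))⁻¹ * (K * ∫⁻ _t, (C * ∫⁻ x, ‖h x‖ₑ ^ (4 * m)) ∂μ) := by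
        refine mul_le_mul_right (mul_le_mul_right (lintegral_mono fun t => ?_) _) _
        exact hCb _ (norm_unitVec t) h hcont hint hL2 hF
    _ = _ := by
        rw [lintegral_const]
        ring

end Rotation

section Weighted
open FourierTransform

theorem two_mul_ofReal (r : ℝ) : 2 * ENNReal.ofReal r = ENNReal.ofReal (2 * r) := by
  rw [ENNReal.ofReal_mul (by norm_num), ENNReal.ofReal_ofNat]

theorem enorm_sq_le_of_norm_le {a b w : ℂ} (h : ‖w‖ ≤ ‖a‖ + ‖b‖) :
    ‖w‖ₑ ^ 2 ≤ 2 * ‖a‖ₑ ^ 2 + 2 * ‖b‖ₑ ^ 2 := by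
  simp only [← ofReal_norm]
  rw [← ENNReal.ofReal_pow (norm_nonneg _), ← ENNReal.ofReal_pow (norm_nonneg _),
    ← ENNReal.ofReal_pow (norm_nonneg _), ← ENNReal.ofReal_ofNat 2,
    ← ENNReal.ofReal_mul (by norm_num), ← ENNReal.ofReal_mul (by norm_num),
    ← ENNReal.ofReal_add (by positivity) (by positivity)]
  refine ENNReal.ofReal_le_ofReal ?_
  nlinarith [norm_nonneg w, sq_nonneg (‖a‖ - ‖b‖), norm_nonneg a, norm_nonneg b]

theorem norm_fourierChar_sub_one_le (s : ℝ) :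
    ‖(Real.fourierChar s : ℂ) - 1‖ ≤ 2 * Real.pi * |s| := by
  rw [Real.fourierChar_apply, mul_comm]
  refine (Real.norm_exp_I_mul_ofReal_sub_one_le).trans ?_
  rw [Real.norm_eq_abs, abs_mul, abs_of_pos (by positivity)]

theorem norm_normalize_sub_le {V : Type*} [NormedAddCommGroup V] [NormedSpace ℝ V] (a b : V) :
    ‖(‖a‖⁻¹ • a) - (‖b‖⁻¹ • b)‖ * ‖b‖ ≤ 2 * ‖a - b‖ := by
  rcases eq_or_ne b 0 with rfl | hb
  · simp
  rcases eq_or_ne a 0 with rfl | ha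
  · simp [norm_smul, hb]
  have h1 : ‖b‖ • ((‖a‖⁻¹ • a) - (‖b‖⁻¹ • b)) = (a - b) + ((‖b‖ - ‖a‖) * ‖a‖⁻¹) • a := by
    rw [smul_sub, smul_smul, smul_smul, mul_inv_cancel₀ (norm_ne_zero_iff.2 hb), sub_mul,
      mul_inv_cancel₀ (norm_ne_zero_iff.2 ha)]
    module
  have h2 : ‖b‖ * ‖(‖a‖⁻¹ • a) - (‖b‖⁻¹ • b)‖ = ‖‖b‖ • ((‖a‖⁻¹ • a) - (‖b‖⁻¹ • b))‖ := by
    rw [norm_smul, norm_norm]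
  rw [mul_comm, h2, h1]
  refine (norm_add_le _ _).trans ?_
  have : ‖((‖b‖ - ‖a‖) * ‖a‖⁻¹) • a‖ ≤ ‖a - b‖ := by
    rw [norm_smul, norm_mul, norm_inv, norm_norm, mul_assoc,
      inv_mul_cancel₀ (norm_ne_zero_iff.2 ha), mul_one, norm_sub_rev]
    exact abs_norm_sub_norm_le _ _
  linarith

theorem abs_coord_div_norm_le (ξ : EuclideanSpace ℝ (Fin 2)) : |ξ 1 / ‖ξ‖| ≤ 1 := by
  rw [abs_div, abs_norm]
  exact div_le_one_of_le₀ (PiLp.norm_apply_le ξ 1) (norm_nonneg _)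

theorem abs_coord_div_norm_sub_le (a b : EuclideanSpace ℝ (Fin 2)) :
    |a 1 / ‖a‖ - b 1 / ‖b‖| * ‖b‖ ≤ 2 * ‖a - b‖ := by
  refine le_trans ?_ (norm_normalize_sub_le a b)
  gcongr
  have := PiLp.norm_apply_le ((‖a‖⁻¹ • a) - (‖b‖⁻¹ • b)) 1
  simpa [div_eq_inv_mul] using this

variable {V : Type*} [NormedAddCommGroup V] [InnerProductSpace ℝ V] [FiniteDimensional ℝ V]
  [MeasurableSpace V] [BorelSpace V]

theorem fourier_add_sub {f : V → ℂ} (hf : Integrable f) (u ξ : V) :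
    𝓕 f (ξ + u) - 𝓕 f ξ = 𝓕 (fun x => ((Real.fourierChar (-inner ℝ x u) : ℂ) - 1) * f x) ξ := by
  have i1 : Integrable fun x => (Real.fourierChar (-inner ℝ x u) : ℂ) * f x := by
    simpa [Circle.smul_def] using (Real.fourierIntegral_convergent_iff u).2 hf
  have : 𝓕 f (ξ + u) = 𝓕 (fun x => (Real.fourierChar (-inner ℝ x u) : ℂ) * f x) ξ := by
    simp only [Real.fourier_eq, Circle.smul_def, smul_eq_mul]
    refine integral_congr_ae (Eventually.of_forall fun x => ?_)
    simp only
    rw [inner_add_right, neg_add, AddChar.map_add_eq_mul, Circle.coe_mul, mul_assoc]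
  rw [this, ← fourier_sub_apply i1 hf]
  simp only [sub_mul, one_mul]

theorem lintegral_fourier_add_sub_sq_le {f : V → ℂ} (hf : Integrable f) (hf2 : MemLp f 2)
    {R : ℝ} (hR : ∀ x, f x ≠ 0 → ‖x‖ ≤ R) (u : V) :
    ∫⁻ ξ, ‖𝓕 f (ξ + u) - 𝓕 f ξ‖ₑ ^ 2
      ≤ ENNReal.ofReal (2 * Real.pi * R * ‖u‖) ^ 2 * ∫⁻ x, ‖f x‖ₑ ^ 2 := by
  have hb : ∀ x, ‖((Real.fourierChar (-inner ℝ x u) : ℂ) - 1) * f x‖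
      ≤ 2 * Real.pi * R * ‖u‖ * ‖f x‖ := by
    intro x
    rcases eq_or_ne (f x) 0 with h0 | h0
    · simp [h0]
    rw [norm_mul]
    refine mul_le_mul_of_nonneg_right ((norm_fourierChar_sub_one_le _).trans ?_) (norm_nonneg _)
    rw [abs_neg, mul_assoc (2 * Real.pi)]
    refine mul_le_mul_of_nonneg_left ((abs_real_inner_le_norm _ _).trans ?_) (by positivity)
    exact mul_le_mul_of_nonneg_right (hR x h0) (norm_nonneg _)
  have hc : Continuous fun x : V => (Real.fourierChar (-inner ℝ x u) : ℂ) - 1 := by fun_prop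
  have i1 : Integrable fun x => ((Real.fourierChar (-inner ℝ x u) : ℂ) - 1) * f x :=
    (hf.norm.const_mul (2 * Real.pi * R * ‖u‖)).mono'
      (hc.aestronglyMeasurable.mul hf.aestronglyMeasurable) (Eventually.of_forall hb)
  have m1 : MemLp (fun x => ((Real.fourierChar (-inner ℝ x u) : ℂ) - 1) * f x) 2 :=
    (hf2.norm.const_mul (2 * Real.pi * R * ‖u‖)).mono'
      (hc.aestronglyMeasurable.mul hf.aestronglyMeasurable) (Eventually.of_forall hb)
  simp only [fourier_add_sub hf]
  rw [lintegral_fourier_sq i1 m1, ← lintegral_const_mul' _ _ (by simp)]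
  refine lintegral_mono fun x => ?_
  rw [← mul_pow, ← ofReal_norm, ← ofReal_norm (f x), ← ENNReal.ofReal_mul' (norm_nonneg _)]
  gcongr
  exact hb x

theorem norm_fourier_le_of_integral_eq_zero {f : V → ℂ} (hf : Integrable f)
    {R : ℝ} (hR : ∀ x, f x ≠ 0 → ‖x‖ ≤ R) (h0 : ∫ x, f x = 0) (ξ : V) :
    ‖𝓕 f ξ‖ ≤ 2 * Real.pi * R * ‖ξ‖ * ∫ x, ‖f x‖ := by
  have e := fourier_add_sub hf ξ 0
  have e0 : 𝓕 f 0 = 0 := by simpa [Real.fourier_eq] using h0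
  rw [zero_add, e0, sub_zero] at e
  rw [e]
  refine (norm_fourier_le_integral _).trans ?_
  rw [← integral_const_mul]
  refine integral_mono_of_nonneg (Eventually.of_forall fun x => norm_nonneg _)
    (hf.norm.const_mul _) (Eventually.of_forall fun x => ?_)
  simp only
  rcases eq_or_ne (f x) 0 with h0 | h0
  · simp [h0]
  rw [norm_mul]
  refine mul_le_mul_of_nonneg_right ((norm_fourierChar_sub_one_le _).trans ?_) (norm_nonneg _)
  rw [abs_neg, mul_assoc (2 * Real.pi)]
  refine mul_le_mul_of_nonneg_left ((abs_real_inner_le_norm _ _).trans ?_) (by positivity)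
  exact mul_le_mul_of_nonneg_right (hR x h0) (norm_nonneg _)

/-- A function with mean zero and compact support has a Riesz transform with finite second
moment. -/
theorem exists_lintegral_norm_sq_rieszPlane_le {R K : ℝ} (hR0 : 0 ≤ R) (hK0 : 0 ≤ K) :
    ∃ C : ℝ≥0∞, C ≠ ∞ ∧ ∀ (h : EuclideanSpace ℝ (Fin 2) → ℝ)
      (_ : Integrable h) (_ : MemLp (fun y => ((h y : ℝ) : ℂ)) 2)
      (_ : Integrable (𝓕 fun y => ((h y : ℝ) : ℂ))) (_ : ∀ x, h x ≠ 0 → ‖x‖ ≤ R)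
      (_ : ∫ x, h x = 0) (_ : ∫ x, ‖h x‖ ≤ K) (_ : ∫⁻ x, ‖h x‖ₑ ^ 2 ≤ ENNReal.ofReal K),
      ∫⁻ x, ‖x‖ₑ ^ 2 * ‖rieszPlane h x‖ₑ ^ 2 ≤ C := by
  set B : Set (EuclideanSpace ℝ (Fin 2)) := Metric.closedBall 0 1 with hB
  set C : ℝ≥0∞ := 2 * (ENNReal.ofReal (2 * Real.pi * R) ^ 2 * ENNReal.ofReal K) +
    2 * (4 * (ENNReal.ofReal (2 * Real.pi * R * K) ^ 2 * volume B + ENNReal.ofReal K)) with hC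
  have hCfin : C ≠ ∞ := by
    have : volume B ≠ ∞ := measure_closedBall_lt_top.ne
    finiteness
  refine ⟨C + C, by finiteness, fun h hint hL2 hF hR h0 hK1 hK2 => ?_⟩
  set H : EuclideanSpace ℝ (Fin 2) → ℂ := fun y => ((h y : ℝ) : ℂ) with hH
  have hHi : Integrable H := hint.ofReal
  have hHR : ∀ x, H x ≠ 0 → ‖x‖ ≤ R := fun x hx => hR x (by simpa [hH] using hx)
  have hH0 : ∫ x, H x = 0 := by simp only [hH]; rw [integral_complex_ofReal, h0]; simp
  have hH1 : ∫ x, ‖H x‖ ≤ K := by simpa [hH] using hK1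
  have hH2 : ∫⁻ x, ‖H x‖ₑ ^ 2 ≤ ENNReal.ofReal K := by
    refine le_of_eq_of_le (lintegral_congr fun x => ?_) hK2
    rw [← enorm_norm, ← enorm_norm (h x)]; simp [hH]
  have hFc : Continuous (𝓕 H) := continuous_fourier_of_integrable hHi
  have hFL2 : MemLp (𝓕 H) 2 := memLp_fourier hHi hL2
  set φ : EuclideanSpace ℝ (Fin 2) → ℂ := fun ξ => ((ξ 1 / ‖ξ‖ : ℝ) : ℂ) * 𝓕 H ξ with hφ
  have hmm : Measurable fun ξ : EuclideanSpace ℝ (Fin 2) => ((ξ 1 / ‖ξ‖ : ℝ) : ℂ) := by fun_prop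
  have hφle : ∀ ξ, ‖φ ξ‖ ≤ ‖𝓕 H ξ‖ := by
    intro ξ
    rw [hφ, norm_mul, Complex.norm_real]
    exact mul_le_of_le_one_left (norm_nonneg _) (abs_coord_div_norm_le ξ)
  have hφi : Integrable φ := hF.norm.mono' (hmm.mul hFc.measurable).aestronglyMeasurable
    (Eventually.of_forall hφle)
  have hφ2 : MemLp φ 2 := hFL2.norm.mono' (hmm.mul hFc.measurable).aestronglyMeasurable
    (Eventually.of_forall hφle)
  have hstep : ∀ u : EuclideanSpace ℝ (Fin 2), ‖u‖ = 1 → ∀ t : ℝ,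
      ∫⁻ ξ, ‖φ (ξ + t • u) - φ ξ‖ₑ ^ 2 ≤ C * ‖t‖ₑ ^ 2 := by
    intro u hu t
    have hu' : ‖t • u‖ = |t| := by rw [norm_smul, hu, mul_one, Real.norm_eq_abs]
    have ht : ‖t‖ₑ = ENNReal.ofReal |t| := by rw [← ofReal_norm, Real.norm_eq_abs]
    have hpt : ∀ ξ, ‖φ (ξ + t • u) - φ ξ‖ₑ ^ 2 ≤ 2 * ‖𝓕 H (ξ + t • u) - 𝓕 H ξ‖ₑ ^ 2 +
        2 * (4 * ‖t‖ₑ ^ 2 * (B.indicator (fun _ => ENNReal.ofReal (2 * Real.pi * R * K) ^ 2) ξ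
          + ‖𝓕 H ξ‖ₑ ^ 2)) := by
      intro ξ
      have h1 : φ (ξ + t • u) - φ ξ = (((ξ + t • u) 1 / ‖ξ + t • u‖ : ℝ) : ℂ) *
          (𝓕 H (ξ + t • u) - 𝓕 H ξ) +
          (((ξ + t • u) 1 / ‖ξ + t • u‖ - ξ 1 / ‖ξ‖ : ℝ) : ℂ) * 𝓕 H ξ := by
        simp only [hφ]; push_cast; ring
      have h2 := abs_coord_div_norm_sub_le (ξ + t • u) ξ
      rw [add_sub_cancel_left, hu'] at h2
      set d : ℝ := (ξ + t • u) 1 / ‖ξ + t • u‖ - ξ 1 / ‖ξ‖ with hd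
      have hdec := enorm_sq_le_of_norm_le (w := φ (ξ + t • u) - φ ξ)
        (a := 𝓕 H (ξ + t • u) - 𝓕 H ξ) (b := (d : ℂ) * 𝓕 H ξ) (by
          rw [h1]
          refine (norm_add_le _ _).trans ?_
          gcongr
          rw [norm_mul, Complex.norm_real]
          exact mul_le_of_le_one_left (norm_nonneg _) (abs_coord_div_norm_le _))
      refine hdec.trans ?_
      refine add_le_add le_rfl (mul_le_mul_right ?_ _)
      have h4 : (4:ℝ≥0∞) = 2 ^ 2 := by norm_num
      by_cases hξ : ξ ∈ B
      · rw [Set.indicator_of_mem hξ]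
        have hb : ‖(d : ℂ) * 𝓕 H ξ‖ ≤ 2 * |t| * (2 * Real.pi * R * K) := by
          rw [norm_mul, Complex.norm_real, Real.norm_eq_abs]
          calc |d| * ‖𝓕 H ξ‖ ≤ |d| * (2 * Real.pi * R * ‖ξ‖ * K) := by
                refine mul_le_mul_of_nonneg_left
                  ((norm_fourier_le_of_integral_eq_zero hHi hHR hH0 ξ).trans ?_) (abs_nonneg _)
                exact mul_le_mul_of_nonneg_left hH1 (by positivity)
            _ = (|d| * ‖ξ‖) * (2 * Real.pi * R * K) := by ring
            _ ≤ _ := mul_le_mul_of_nonneg_right h2 (by positivity)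
        rw [mul_add]
        refine le_add_right ?_
        rw [h4, ← mul_pow, ← mul_pow]
        gcongr
        rw [ht, ← ofReal_norm, two_mul_ofReal,
          ← ENNReal.ofReal_mul (by positivity)]
        exact ENNReal.ofReal_le_ofReal hb
      · rw [Set.indicator_of_notMem hξ, zero_add, h4, ← mul_pow, ← mul_pow]
        gcongr
        rw [enorm_mul]
        gcongr
        have hξ1 : 1 ≤ ‖ξ‖ := by
          rw [hB, mem_closedBall_zero_iff, not_le] at hξ
          exact hξ.le
        rw [ht, ← ofReal_norm, two_mul_ofReal,
          Complex.norm_real, Real.norm_eq_abs]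
        refine ENNReal.ofReal_le_ofReal ?_
        nlinarith [abs_nonneg d]
    have hI := lintegral_fourier_add_sub_sq_le hHi hL2 hHR (t • u)
    have hmt : Measurable fun ξ => ‖𝓕 H (ξ + t • u) - 𝓕 H ξ‖ₑ ^ 2 := by
      have := hFc.measurable
      fun_prop
    have hmF : Measurable fun ξ => ‖𝓕 H ξ‖ₑ ^ 2 := by
      have := hFc.measurable
      fun_prop
    have hBm : MeasurableSet B := Metric.isClosed_closedBall.measurableSet
    calc ∫⁻ ξ, ‖φ (ξ + t • u) - φ ξ‖ₑ ^ 2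
        ≤ ∫⁻ ξ, (2 * ‖𝓕 H (ξ + t • u) - 𝓕 H ξ‖ₑ ^ 2 +
        2 * (4 * ‖t‖ₑ ^ 2 * (B.indicator (fun _ => ENNReal.ofReal (2 * Real.pi * R * K) ^ 2) ξ
          + ‖𝓕 H ξ‖ₑ ^ 2))) := lintegral_mono hpt
      _ = 2 * (∫⁻ ξ, ‖𝓕 H (ξ + t • u) - 𝓕 H ξ‖ₑ ^ 2) + 2 * (4 * ‖t‖ₑ ^ 2 *
          (ENNReal.ofReal (2 * Real.pi * R * K) ^ 2 * volume B + ∫⁻ ξ, ‖𝓕 H ξ‖ₑ ^ 2)) := by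
        rw [lintegral_add_left (hmt.const_mul _), lintegral_const_mul _ hmt,
          lintegral_const_mul' _ _ (by simp), lintegral_const_mul' _ _ (by finiteness),
          lintegral_add_right _ hmF, lintegral_indicator_const hBm]
      _ ≤ 2 * (ENNReal.ofReal (2 * Real.pi * R * |t|) ^ 2 * ENNReal.ofReal K) +
          2 * (4 * ‖t‖ₑ ^ 2 *
          (ENNReal.ofReal (2 * Real.pi * R * K) ^ 2 * volume B + ENNReal.ofReal K)) := by
        rw [lintegral_fourier_sq hHi hL2]
        rw [hu'] at hI
        gcongr
        exact hI.trans (by gcongr)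
      _ = C * ‖t‖ₑ ^ 2 := by
        rw [hC, ENNReal.ofReal_mul (by positivity), ht]
        ring
  have hmom : ∀ i : Fin 2, ∫⁻ x : EuclideanSpace ℝ (Fin 2), ‖x i‖ₑ ^ 2 * ‖rieszPlane h x‖ₑ ^ 2
      ≤ C := by
    intro i
    have hu : ‖EuclideanSpace.single i (1:ℝ)‖ = 1 := by simp
    have := lintegral_inner_fourier_sq_le hφi hφ2 _ (hstep _ hu)
    rw [← lintegral_neg_eq_self] at this
    refine le_of_eq_of_le (lintegral_congr fun x => ?_) this
    rw [rieszPlane, Real.fourierInv_eq_fourier_neg, inner_neg_right, enorm_neg]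
    congr 3
    simp [EuclideanSpace.inner_single_left]
  have hm0 : Measurable fun x : EuclideanSpace ℝ (Fin 2) =>
      ‖x 0‖ₑ ^ 2 * ‖rieszPlane h x‖ₑ ^ 2 := by
    have : Measurable (rieszPlane h) := (continuous_fourierInv_of_integrable hφi).measurable
    fun_prop
  calc ∫⁻ x, ‖x‖ₑ ^ 2 * ‖rieszPlane h x‖ₑ ^ 2
      = ∫⁻ x : EuclideanSpace ℝ (Fin 2), (‖x 0‖ₑ ^ 2 * ‖rieszPlane h x‖ₑ ^ 2 +
          ‖x 1‖ₑ ^ 2 * ‖rieszPlane h x‖ₑ ^ 2) := by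
        refine lintegral_congr fun x => ?_
        rw [← add_mul]
        congr 1
        simp only [← ofReal_norm]
        rw [← ENNReal.ofReal_pow (norm_nonneg _), ← ENNReal.ofReal_pow (norm_nonneg _),
          ← ENNReal.ofReal_pow (norm_nonneg _), ← ENNReal.ofReal_add (by positivity)
            (by positivity), EuclideanSpace.norm_sq_eq, Fin.sum_univ_two]
    _ ≤ C + C := by
        rw [lintegral_add_left hm0]
        exact add_le_add (hmom 0) (hmom 1)

theorem rpow_le_weighted {p : ℝ} (hp : 1 < p) (hp2 : p < 2) {a w : ℝ} (ha : 0 ≤ a) (hw : 1 ≤ w) :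
    a ^ p ≤ a ^ 2 * w ^ 2 + w ^ (-(2 * p / (2 - p))) := by
  have hw0 : 0 < w := by linarith
  have h2p : 0 < 2 - p := by linarith
  rcases le_total a (w ^ (-(2 / (2 - p)))) with h | h
  · have : a ^ p ≤ w ^ (-(2 * p / (2 - p))) := by
      refine (Real.rpow_le_rpow ha h (by linarith)).trans_eq ?_
      rw [← Real.rpow_mul hw0.le]
      congr 1
      ring
    have := mul_nonneg (sq_nonneg a) (sq_nonneg w)
    linarith
  · have ha0 : 0 < a := (Real.rpow_pos_of_pos hw0 _).trans_le h
    have h1 : a ^ (p - 2) ≤ w ^ 2 := by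
      refine (Real.rpow_le_rpow_of_nonpos (Real.rpow_pos_of_pos hw0 _) h (by linarith)).trans_eq ?_
      rw [← Real.rpow_mul hw0.le, ← Real.rpow_natCast]
      congr 1
      field_simp
      push_cast
      ring
    have h2 : a ^ p = a ^ 2 * a ^ (p - 2) := by
      rw [← Real.rpow_natCast, ← Real.rpow_add ha0]
      congr 1
      push_cast
      ring
    rw [h2]
    have := Real.rpow_nonneg hw0.le (-(2 * p / (2 - p)))
    have := mul_le_mul_of_nonneg_left h1 (sq_nonneg a)
    linarith

theorem rpow_le_sq_add_pow {p : ℝ} (hp2 : 2 ≤ p) {n : ℕ} (hn : p ≤ n) {a : ℝ} (ha : 0 ≤ a) :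
    a ^ p ≤ a ^ 2 + a ^ n := by
  rcases le_total a 1 with h | h
  · rcases ha.eq_or_lt with rfl | ha0
    · rw [Real.zero_rpow (by linarith)]; positivity
    have := Real.rpow_le_rpow_of_exponent_ge ha0 h hp2
    rw [Real.rpow_ofNat] at this
    have := pow_nonneg ha n
    linarith
  · have := Real.rpow_le_rpow_of_exponent_le h hn
    rw [Real.rpow_natCast] at this
    nlinarith [sq_nonneg a]

theorem exists_lintegral_rieszPlane_rpow_le {p : ℝ} (hp : 1 < p) {m : ℕ} (hm : p ≤ 4 * m)
    {R K : ℝ} (hR0 : 0 ≤ R) (hK0 : 0 ≤ K) :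
    ∃ C : ℝ≥0∞, C ≠ ∞ ∧ ∀ (h : EuclideanSpace ℝ (Fin 2) → ℝ) (_ : Continuous h)
      (_ : Integrable h) (_ : MemLp (fun y => ((h y : ℝ) : ℂ)) 2)
      (_ : Integrable (𝓕 fun y => ((h y : ℝ) : ℂ))) (_ : ∀ x, h x ≠ 0 → ‖x‖ ≤ R)
      (_ : ∫ x, h x = 0) (_ : ∫ x, ‖h x‖ ≤ K) (_ : ∫⁻ x, ‖h x‖ₑ ^ 2 ≤ ENNReal.ofReal K)
      (_ : ∫⁻ x, ‖h x‖ₑ ^ (4 * m) ≤ ENNReal.ofReal K),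
      ∫⁻ x, ‖rieszPlane h x‖ₑ ^ p ≤ C := by
  have hm1 : 1 ≤ m := by
    by_contra hlt
    have : m = 0 := by omega
    subst this
    norm_num at hm
    linarith
  obtain ⟨C1, hC1, h1⟩ := exists_lintegral_rieszPlane_le hm1
  obtain ⟨C2, hC2, h2⟩ := exists_lintegral_norm_sq_rieszPlane_le hR0 hK0
  have hsq : ∀ (h : EuclideanSpace ℝ (Fin 2) → ℝ) (_ : Integrable h)
      (_ : MemLp (fun y => ((h y : ℝ) : ℂ)) 2) (_ : Integrable (𝓕 fun y => ((h y : ℝ) : ℂ)))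
      (_ : ∫⁻ x, ‖h x‖ₑ ^ 2 ≤ ENNReal.ofReal K),
      ∫⁻ x, ‖rieszPlane h x‖ₑ ^ 2 ≤ ENNReal.ofReal K ∧ Measurable (rieszPlane h) := by
    intro h hint hL2 hF hK2
    have hFc : Continuous (𝓕 fun y => ((h y : ℝ) : ℂ)) :=
      continuous_fourier_of_integrable hint.ofReal
    have hmm : Measurable fun ξ : EuclideanSpace ℝ (Fin 2) => ((ξ 1 / ‖ξ‖ : ℝ) : ℂ) *
      𝓕 (fun y => ((h y : ℝ) : ℂ)) ξ := by
      have := hFc.measurable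
      fun_prop
    have hle : ∀ ξ : EuclideanSpace ℝ (Fin 2), ‖((ξ 1 / ‖ξ‖ : ℝ) : ℂ) *
        𝓕 (fun y => ((h y : ℝ) : ℂ)) ξ‖ ≤ ‖𝓕 (fun y => ((h y : ℝ) : ℂ)) ξ‖ := by
      intro ξ
      rw [norm_mul, Complex.norm_real]
      exact mul_le_of_le_one_left (norm_nonneg _) (abs_coord_div_norm_le ξ)
    have i1 := hF.norm.mono' hmm.aestronglyMeasurable (Eventually.of_forall hle)
    have m1 := (memLp_fourier hint.ofReal hL2).norm.mono' hmm.aestronglyMeasurable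
      (Eventually.of_forall hle)
    refine ⟨?_, (continuous_fourierInv_of_integrable i1).measurable⟩
    rw [rieszPlane, lintegral_fourierInv_sq i1 m1]
    calc _ ≤ ∫⁻ ξ, ‖𝓕 (fun y => ((h y : ℝ) : ℂ)) ξ‖ₑ ^ 2 := by
          refine lintegral_mono fun ξ => ?_
          have := hle ξ
          gcongr
          exact enorm_le_iff_norm_le.2 this
      _ ≤ ENNReal.ofReal K := by
          refine (lintegral_fourier_sq hint.ofReal hL2).trans_le ?_
          refine le_of_eq_of_le (lintegral_congr fun x => ?_) hK2
          rw [← enorm_norm, ← enorm_norm (h x)]; simp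
  have hconv : ∀ z : ℂ, ‖z‖ₑ ^ p = ENNReal.ofReal (‖z‖ ^ p) := fun z => by
    rw [← ofReal_norm, ENNReal.ofReal_rpow_of_nonneg (norm_nonneg _) (by linarith)]
  have hconv2 : ∀ (z : ℂ) (n : ℕ), ENNReal.ofReal (‖z‖ ^ n) = ‖z‖ₑ ^ n := fun z n => by
    rw [ENNReal.ofReal_pow (norm_nonneg _), ofReal_norm]
  rcases lt_or_ge p 2 with hp2 | hp2
  · set s : ℝ := 2 * p / (2 - p) with hs
    have hs2 : (Module.finrank ℝ (EuclideanSpace ℝ (Fin 2)) : ℝ) < s := by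
      rw [finrank_euclideanSpace_fin, hs, lt_div_iff₀ (by linarith)]
      push_cast
      linarith
    have hfin := finite_integral_one_add_norm (μ := (volume : Measure (EuclideanSpace ℝ (Fin 2))))
      hs2
    set W : ℝ≥0∞ := ∫⁻ x : EuclideanSpace ℝ (Fin 2), ENNReal.ofReal ((1 + ‖x‖) ^ (-s)) with hW
    refine ⟨2 * ENNReal.ofReal K + 2 * C2 + W, by finiteness,
      fun h hcont hint hL2 hF hR h0 hK1 hK2 hK3 => ?_⟩
    obtain ⟨hb, hmeas⟩ := hsq h hint hL2 hF hK2
    calc ∫⁻ x, ‖rieszPlane h x‖ₑ ^ p ≤ ∫⁻ x, (2 * ‖rieszPlane h x‖ₑ ^ 2 +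
          2 * (‖x‖ₑ ^ 2 * ‖rieszPlane h x‖ₑ ^ 2) + ENNReal.ofReal ((1 + ‖x‖) ^ (-s))) := by
          refine lintegral_mono fun x => ?_
          have := rpow_le_weighted hp hp2 (norm_nonneg (rieszPlane h x))
            (by linarith [norm_nonneg x] : 1 ≤ 1 + ‖x‖)
          simp only [← hconv2 _ 2]
          rw [hconv, ← ofReal_norm x, ← ENNReal.ofReal_pow (norm_nonneg _),
            ← ENNReal.ofReal_mul (by positivity), two_mul_ofReal, two_mul_ofReal,
            ← ENNReal.ofReal_add (by positivity) (by positivity),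
            ← ENNReal.ofReal_add (by positivity) (by positivity)]
          refine ENNReal.ofReal_le_ofReal (this.trans ?_)
          refine add_le_add ?_ le_rfl
          nlinarith [mul_nonneg (sq_nonneg ‖rieszPlane h x‖) (sq_nonneg (1 - ‖x‖))]
      _ = 2 * (∫⁻ x, ‖rieszPlane h x‖ₑ ^ 2) +
          2 * (∫⁻ x, ‖x‖ₑ ^ 2 * ‖rieszPlane h x‖ₑ ^ 2) + W := by
          rw [lintegral_add_left (by fun_prop), lintegral_add_left (by fun_prop),
            lintegral_const_mul' _ _ (by simp), lintegral_const_mul' _ _ (by simp)]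
      _ ≤ _ := by
          gcongr
          exact h2 h hint hL2 hF hR h0 hK1 hK2
  · refine ⟨ENNReal.ofReal K + C1 * ENNReal.ofReal K, by finiteness,
      fun h hcont hint hL2 hF hR h0 hK1 hK2 hK3 => ?_⟩
    obtain ⟨hb, hmeas⟩ := hsq h hint hL2 hF hK2
    calc ∫⁻ x, ‖rieszPlane h x‖ₑ ^ p
        ≤ ∫⁻ x, (‖rieszPlane h x‖ₑ ^ 2 + ‖rieszPlane h x‖ₑ ^ (4 * m)) := by
          refine lintegral_mono fun x => ?_
          simp only [← hconv2]
          rw [hconv, ← ENNReal.ofReal_add (by positivity) (by positivity)]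
          exact ENNReal.ofReal_le_ofReal (rpow_le_sq_add_pow hp2 (by exact_mod_cast hm)
            (norm_nonneg _))
      _ ≤ _ := by
          rw [lintegral_add_left (by fun_prop)]
          refine add_le_add hb ((h1 h hcont hint hL2 hF).trans ?_)
          gcongr

end Weighted

section Moments

theorem gBlock_dyadic (A B : ℝ → ℝ) (n0 k i i' : ℕ) (x : Fin 2 → ℝ) :
    gBlock A B n0 (2 * k * n0) ((i : ℝ) * 2 ^ (-(2 * k * n0 : ℤ)))
        ((2 * i' : ℝ) * 2 ^ (-(2 * k * n0 : ℤ))) x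
      = A (x 0 * 2 ^ (2 * k * n0) - i) * B ((x 1 * 2 ^ (2 * k * n0) - 2 * i') * 2 ^ n0) := by
  have h : (2:ℝ) ^ (-(2 * k * n0 : ℤ)) * 2 ^ (2 * k * n0) = 1 := by
    rw [zpow_neg, show (2 * k * n0 : ℤ) = ((2 * k * n0 : ℕ) : ℤ) by push_cast; ring, zpow_natCast]
    exact inv_mul_cancel₀ (by positivity)
  rw [gBlock, sub_mul, mul_assoc (i : ℝ), h, mul_one, sub_mul (x 1), mul_assoc (2 * (i':ℝ)), h,
    mul_one]

theorem abs_sum_le_of_subsingleton {ι : Type*} (s : Finset ι) (f : ι → ℝ) {a : ℝ} (ha : 0 ≤ a)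
    (hf : ∀ i ∈ s, |f i| ≤ a) (hs : ∀ i ∈ s, ∀ j ∈ s, f i ≠ 0 → f j ≠ 0 → i = j) :
    |∑ i ∈ s, f i| ≤ a := by
  by_cases h : ∃ i ∈ s, f i ≠ 0
  · obtain ⟨i, hi, hfi⟩ := h
    rw [Finset.sum_eq_single_of_mem i hi fun j hj hji => by
      by_contra hne; exact hji (hs j hj i hi hne hfi)]
    exact hf i hi
  · push Not at h
    rw [Finset.sum_eq_zero h, abs_zero]
    exact ha

/-- Indicator of the `ε`-neighbourhood of the even integers. -/
noncomputable def evenNbhd (ε : ℝ) : ℝ → ℝ :=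
  Set.indicator {y | ∃ i : ℤ, |y - 2 * i| < ε} fun _ => 1

theorem measurable_evenNbhd (ε : ℝ) : Measurable (evenNbhd ε) := by
  refine measurable_const.indicator (IsOpen.measurableSet ?_)
  simp only [Set.ofPred_exists]
  exact isOpen_iUnion fun i => isOpen_lt (by fun_prop) continuous_const

theorem evenNbhd_periodic (ε : ℝ) : Function.Periodic (evenNbhd ε) 2 := by
  intro y
  have : (∃ i : ℤ, |y + 2 - 2 * i| < ε) ↔ ∃ i : ℤ, |y - 2 * i| < ε := by
    constructor
    · rintro ⟨i, hi⟩
      refine ⟨i - 1, ?_⟩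
      push_cast
      convert hi using 2
      ring
    · rintro ⟨i, hi⟩
      refine ⟨i + 1, ?_⟩
      push_cast
      convert hi using 2
      ring
  classical
  rw [evenNbhd, Set.indicator_apply, Set.indicator_apply]
  exact if_congr this rfl rfl

theorem evenNbhd_nonneg (ε y : ℝ) : 0 ≤ evenNbhd ε y :=
  Set.indicator_nonneg (fun _ _ => zero_le_one) _

theorem evenNbhd_le_one (ε y : ℝ) : evenNbhd ε y ≤ 1 :=
  Set.indicator_le_self' (fun _ _ => zero_le_one) _

theorem evenNbhd_eq_or (ε y : ℝ) : evenNbhd ε y = 0 ∨ evenNbhd ε y = 1 := by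
  by_cases h : y ∈ {y : ℝ | ∃ i : ℤ, |y - 2 * i| < ε}
  · exact Or.inr (Set.indicator_of_mem h _)
  · exact Or.inl (Set.indicator_of_notMem h _)

theorem evenNbhd_of_abs_lt {ε y : ℝ} (hε : ε ≤ 1) (hy : |y| < 1) :
    evenNbhd ε y = Set.indicator (Set.Ioo (-ε) ε) (fun _ => 1) y := by
  have : (∃ i : ℤ, |y - 2 * i| < ε) ↔ y ∈ Set.Ioo (-ε) ε := by
    rw [Set.mem_Ioo, ← abs_lt]
    constructor
    · rintro ⟨i, hi⟩
      rw [abs_lt] at hi hy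
      have h1 : (i:ℝ) < 1 := by linarith
      have h2 : (-1:ℝ) < i := by linarith
      have h3 : i < 1 := by exact_mod_cast h1
      have h4 : -1 < i := by exact_mod_cast h2
      obtain rfl : i = 0 := by omega
      rw [abs_lt]
      simpa using hi
    · intro h
      exact ⟨0, by simpa using h⟩
  classical
  rw [evenNbhd, Set.indicator_apply, Set.indicator_apply]
  exact if_congr this rfl rfl

/-- The product over `K` consecutive scales of `1 + evenNbhd`. -/
noncomputable def scaleProd (ε M : ℝ) (K : ℕ) (y : ℝ) : ℝ :=
  ∏ k ∈ Finset.range K, (1 + evenNbhd ε (M ^ k * y))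

theorem scaleProd_succ (ε M : ℝ) (K : ℕ) (y : ℝ) :
    scaleProd ε M (K + 1) y = (1 + evenNbhd ε y) * scaleProd ε M K (M * y) := by
  rw [scaleProd, Finset.prod_range_succ', mul_comm]
  simp only [pow_zero, one_mul, scaleProd, pow_succ, mul_assoc]

theorem measurable_scaleProd (ε M : ℝ) (K : ℕ) : Measurable (scaleProd ε M K) := by
  unfold scaleProd
  have := measurable_evenNbhd ε
  fun_prop

theorem scaleProd_nonneg (ε M : ℝ) (K : ℕ) (y : ℝ) : 0 ≤ scaleProd ε M K y :=
  Finset.prod_nonneg fun k _ => by linarith [evenNbhd_nonneg ε (M ^ k * y)]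

theorem scaleProd_le (ε M : ℝ) (K : ℕ) (y : ℝ) : scaleProd ε M K y ≤ 2 ^ K := by
  calc scaleProd ε M K y ≤ ∏ _k ∈ Finset.range K, (2 : ℝ) :=
        Finset.prod_le_prod (fun k _ => by linarith [evenNbhd_nonneg ε (M ^ k * y)])
          fun k _ => by linarith [evenNbhd_le_one ε (M ^ k * y)]
    _ = 2 ^ K := by simp

theorem scaleProd_periodic (ε : ℝ) (M : ℕ) (K : ℕ) :
    Function.Periodic (scaleProd ε M K) 2 := by
  intro y
  refine Finset.prod_congr rfl fun k _ => ?_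
  have := (evenNbhd_periodic ε).nat_mul (M ^ k) ((M:ℝ) ^ k * y)
  rw [← this]
  push_cast
  rw [mul_add]

theorem intervalIntegrable_scaleProd (ε M : ℝ) (K : ℕ) (a b : ℝ) :
    IntervalIntegrable (scaleProd ε M K) volume a b := by
  refine IntervalIntegrable.mono_fun (f := fun _ => (2:ℝ) ^ K) (by simp)
    (measurable_scaleProd ε M K).aestronglyMeasurable (Eventually.of_forall fun y => ?_)
  simp only [Real.norm_eq_abs, abs_of_nonneg (scaleProd_nonneg ε M K y)]
  exact (scaleProd_le ε M K y).trans (le_abs_self _)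

theorem Function.Periodic.integral_comp_nat_mul {g : ℝ → ℝ} (hg : Function.Periodic g 2)
    (hgi : ∀ a b, IntervalIntegrable g volume a b) {M : ℕ} (hM : 0 < M) {r : ℝ} {n : ℕ}
    (hr : M * r = n) :
    ∫ y in -r..r, g (M * y) = r * ∫ y in (-1:ℝ)..1, g y := by
  have hM' : (0:ℝ) < M := by exact_mod_cast hM
  rw [intervalIntegral.integral_comp_mul_left g hM'.ne']
  have h := hg.intervalIntegral_add_zsmul_eq n (-(M * r)) (fun a b => hgi a b)
  have h2 := hg.intervalIntegral_add_eq (-(M * r)) (-1)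
  have e : -((M:ℝ) * r) + (n:ℤ) • (2:ℝ) = M * r := by
    rw [hr]; simp; ring
  rw [e] at h
  rw [mul_neg, h, h2, smul_eq_mul, zsmul_eq_mul]
  rw [show (-1:ℝ) + 2 = 1 by norm_num]
  push_cast
  rw [← hr]
  field_simp

theorem integral_scaleProd {n0 : ℕ} (K : ℕ) :
    ∫ y in (-1:ℝ)..1, scaleProd ((2:ℝ) ^ n0)⁻¹ ((4 ^ n0 : ℕ) : ℝ) K y
      = 2 * (1 + ((2:ℝ) ^ n0)⁻¹) ^ K := by
  induction K with
  | zero => simp [scaleProd]; norm_num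
  | succ K ih =>
    set ε : ℝ := ((2:ℝ) ^ n0)⁻¹ with hε
    set M : ℕ := 4 ^ n0 with hM
    have hMpos : 0 < M := by positivity
    have hε0 : 0 < ε := by positivity
    have hε1 : ε ≤ 1 := inv_le_one_of_one_le₀ (one_le_pow₀ (by norm_num))
    have hMε : (M:ℝ) * ε = (2 ^ n0 : ℕ) := by
      rw [hM, hε, show (4:ℕ) = 2 * 2 by norm_num, mul_pow]
      push_cast
      field_simp
    have hp := scaleProd_periodic ε M K
    have hi := intervalIntegrable_scaleProd ε M K
    have e1 := hp.integral_comp_nat_mul hi hMpos (r := 1) (n := M) (by simp)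
    have e2 := hp.integral_comp_nat_mul hi hMpos hMε
    have hiM : Measurable fun y => scaleProd ε M K (M * y) :=
      (measurable_scaleProd ε M K).comp (by fun_prop)
    have hi1 : IntervalIntegrable (fun y => scaleProd ε M K (M * y)) volume (-1) 1 := by
      refine IntervalIntegrable.mono_fun (f := fun _ => (2:ℝ) ^ K) (by simp)
        hiM.aestronglyMeasurable (Eventually.of_forall fun y => ?_)
      simp only [Real.norm_eq_abs, abs_of_nonneg (scaleProd_nonneg ε M K _)]
      exact (scaleProd_le ε M K _).trans (le_abs_self _)
    have hi2 : IntervalIntegrable (fun y => evenNbhd ε y * scaleProd ε M K (M * y))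
        volume (-1) 1 := by
      refine hi1.mono_fun ((measurable_evenNbhd ε).mul hiM).aestronglyMeasurable
        (Eventually.of_forall fun y => ?_)
      simp only [norm_mul]
      refine mul_le_of_le_one_left (norm_nonneg _) ?_
      rw [Real.norm_eq_abs, abs_of_nonneg (evenNbhd_nonneg _ _)]
      exact evenNbhd_le_one _ _
    have e3 : ∫ y in (-1:ℝ)..1, evenNbhd ε y * scaleProd ε M K (M * y)
        = ∫ y in -ε..ε, scaleProd ε M K (M * y) := by
      rw [intervalIntegral.integral_of_le (by norm_num), intervalIntegral.integral_of_le
        (by linarith), integral_Ioc_eq_integral_Ioo, integral_Ioc_eq_integral_Ioo]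
      have hsub : Set.Ioo (-ε) ε ⊆ Set.Ioo (-1) 1 := Set.Ioo_subset_Ioo (by linarith) hε1
      rw [← Set.inter_eq_right.2 hsub, ← setIntegral_indicator measurableSet_Ioo]
      refine setIntegral_congr_fun measurableSet_Ioo fun y hy => ?_
      rw [evenNbhd_of_abs_lt hε1 (abs_lt.2 hy)]
      by_cases h : y ∈ Set.Ioo (-ε) ε
      · simp [h]
      · simp [h]
    simp only [scaleProd_succ, add_mul, one_mul]
    rw [intervalIntegral.integral_add hi1 hi2, e3, e1, e2, ih]
    ring

theorem exists_pow_le_const_mul_two_pow (q : ℕ) :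
    ∃ C : ℝ, 0 ≤ C ∧ ∀ N : ℝ, 0 ≤ N → N ^ q ≤ C * 2 ^ N := by
  have h2 : 0 < Real.log 2 := Real.log_pos (by norm_num)
  refine ⟨q.factorial / Real.log 2 ^ q, by positivity, fun N hN => ?_⟩
  have := Real.pow_div_factorial_le_exp (Real.log 2 * N) (by positivity) q
  rw [← Real.rpow_def_of_pos (by norm_num)] at this
  rw [div_mul_eq_mul_div, le_div_iff₀ (by positivity)]
  rw [div_le_iff₀ (by positivity), mul_pow] at this
  linarith

end Moments

section TestFunction

/-- The part of `fTest` at the scale `T⁻¹`, as a product of two functions of one variable. -/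
theorem fTest_eq_sum_mul (P Q : ℝ → ℝ) (n0 : ℕ) (x : Fin 2 → ℝ) :
    fTest P Q n0 x = ∑ k ∈ Finset.Icc 1 (2 ^ n0),
      (∑ i ∈ Finset.range (2 ^ (2 * k * n0)), P (x 0 * 2 ^ (2 * k * n0) - i)) *
        ∑ i' ∈ Finset.range (2 ^ (2 * k * n0 - 1)),
          Q ((x 1 * 2 ^ (2 * k * n0) - 2 * i') * 2 ^ n0) := by
  simp only [fTest, gBlock_dyadic, Finset.sum_mul_sum]

theorem abs_sum_translate_le {P : ℝ → ℝ} {a : ℝ} (ha : ∀ t, |P t| ≤ a)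
    (hP : Function.support P ⊆ Set.Ioo 0 1) (N : ℕ) (u : ℝ) :
    |∑ i ∈ Finset.range N, P (u - i)| ≤ a := by
  refine abs_sum_le_of_subsingleton _ _ ((abs_nonneg _).trans (ha 0)) (fun i _ => ha _) ?_
  intro i _ j _ hi hj
  obtain ⟨h1, h2⟩ := hP hi
  obtain ⟨h3, h4⟩ := hP hj
  have h5 : (i : ℝ) < j + 1 := by linarith
  have h6 : (j : ℝ) < i + 1 := by linarith
  have h7 : i < j + 1 := by exact_mod_cast h5
  have h8 : j < i + 1 := by exact_mod_cast h6
  omega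

theorem abs_sub_two_mul_lt {Q : ℝ → ℝ} (hQ : Function.support Q ⊆ Set.Ioo (-1) 1) {n0 : ℕ}
    {v : ℝ} {i : ℕ} (h : Q ((v - 2 * i) * 2 ^ n0) ≠ 0) : |v - 2 * i| < ((2 : ℝ) ^ n0)⁻¹ := by
  have h1 := abs_lt.2 (hQ h)
  rw [abs_mul, abs_of_pos (show (0 : ℝ) < 2 ^ n0 by positivity)] at h1
  rwa [← one_div, lt_div_iff₀ (by positivity)]

theorem inv_two_pow_le_one (n0 : ℕ) : ((2 : ℝ) ^ n0)⁻¹ ≤ 1 :=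
  inv_le_one_of_one_le₀ (one_le_pow₀ (by norm_num))

theorem abs_sum_even_translate_le {Q : ℝ → ℝ} {b : ℝ} (hb : ∀ t, |Q t| ≤ b)
    (hQ : Function.support Q ⊆ Set.Ioo (-1) 1) (n0 N : ℕ) (v : ℝ) :
    |∑ i ∈ Finset.range N, Q ((v - 2 * i) * 2 ^ n0)| ≤ b * evenNbhd ((2 : ℝ) ^ n0)⁻¹ v := by
  have hb0 : 0 ≤ b := (abs_nonneg _).trans (hb 0)
  refine abs_sum_le_of_subsingleton _ _ (mul_nonneg hb0 (evenNbhd_nonneg _ _)) (fun i _ => ?_) ?_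
  · by_cases h : Q ((v - 2 * i) * 2 ^ n0) = 0
    · rw [h, abs_zero]
      exact mul_nonneg hb0 (evenNbhd_nonneg _ _)
    · have : evenNbhd ((2 : ℝ) ^ n0)⁻¹ v = 1 :=
        Set.indicator_of_mem (s := {y : ℝ | ∃ i : ℤ, |y - 2 * i| < ((2 : ℝ) ^ n0)⁻¹})
          ⟨i, by exact_mod_cast abs_sub_two_mul_lt hQ h⟩ _
      rw [this, mul_one]
      exact hb _
  · intro i _ j _ hi hj
    have h0 := inv_two_pow_le_one n0
    obtain ⟨h1, h2⟩ := abs_lt.1 (abs_sub_two_mul_lt hQ hi)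
    obtain ⟨h3, h4⟩ := abs_lt.1 (abs_sub_two_mul_lt hQ hj)
    have h5 : (i : ℝ) < j + 1 := by linarith
    have h6 : (j : ℝ) < i + 1 := by linarith
    have h7 : i < j + 1 := by exact_mod_cast h5
    have h8 : j < i + 1 := by exact_mod_cast h6
    omega

theorem fTest_support {P Q : ℝ → ℝ} (hP : Function.support P ⊆ Set.Ioo 0 1)
    (hQ : Function.support Q ⊆ Set.Ioo (-1) 1) {n0 : ℕ} (hn : 1 ≤ n0) {x : Fin 2 → ℝ}
    (hx : fTest P Q n0 x ≠ 0) : x 0 ∈ Set.Icc (0 : ℝ) 1 ∧ x 1 ∈ Set.Ioc (-1 : ℝ) 1 := by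
  rw [fTest_eq_sum_mul] at hx
  obtain ⟨k, hk, hne⟩ := Finset.exists_ne_zero_of_sum_ne_zero hx
  obtain ⟨i, hi, h1⟩ := Finset.exists_ne_zero_of_sum_ne_zero (left_ne_zero_of_mul hne)
  obtain ⟨j, hj, h2⟩ := Finset.exists_ne_zero_of_sum_ne_zero (right_ne_zero_of_mul hne)
  have hk1 : 1 ≤ k := (Finset.mem_Icc.1 hk).1
  obtain ⟨h3, h4⟩ := hP h1
  obtain ⟨h5, h6⟩ := abs_lt.1 (abs_sub_two_mul_lt hQ h2)
  have h0 := inv_two_pow_le_one n0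
  have he : 2 * k * n0 = (2 * k * n0 - 1) + 1 := by
    have : 0 < 2 * k * n0 := by positivity
    omega
  have hi' : i + 1 ≤ 2 ^ (2 * k * n0) := Finset.mem_range.1 hi
  have hj' : j + 1 ≤ 2 ^ (2 * k * n0 - 1) := Finset.mem_range.1 hj
  have hj2 : 2 * j + 2 ≤ 2 ^ (2 * k * n0) := by
    rw [he, pow_succ]
    omega
  have hiR : (i : ℝ) + 1 ≤ 2 ^ (2 * k * n0) := by exact_mod_cast hi'
  have hjR : 2 * (j : ℝ) + 2 ≤ 2 ^ (2 * k * n0) := by exact_mod_cast hj2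
  have hT : (1 : ℝ) ≤ 2 ^ (2 * k * n0) := one_le_pow₀ (by norm_num)
  generalize (2 : ℝ) ^ (2 * k * n0) = T at *
  have hi0 : (0 : ℝ) ≤ i := i.cast_nonneg
  have hj0 : (0 : ℝ) ≤ j := j.cast_nonneg
  refine ⟨⟨?_, ?_⟩, ?_, ?_⟩ <;> by_contra! hc <;> nlinarith

theorem abs_fTest_le {P Q : ℝ → ℝ} {a b : ℝ} (ha : ∀ t, |P t| ≤ a) (hb : ∀ t, |Q t| ≤ b)
    (hP : Function.support P ⊆ Set.Ioo 0 1) (hQ : Function.support Q ⊆ Set.Ioo (-1) 1)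
    (n0 : ℕ) (x : Fin 2 → ℝ) :
    |fTest P Q n0 x| ≤ a * b * ∑ k ∈ Finset.range (2 ^ n0),
      evenNbhd ((2 : ℝ) ^ n0)⁻¹ (((4 ^ n0 : ℕ) : ℝ) ^ k * (((4 ^ n0 : ℕ) : ℝ) * x 1)) := by
  rw [fTest_eq_sum_mul, Finset.mul_sum, ← Finset.Ico_add_one_right_eq_Icc,
    Finset.sum_Ico_eq_sum_range, Nat.add_sub_cancel]
  refine (Finset.abs_sum_le_sum_abs _ _).trans (Finset.sum_le_sum fun k _ => ?_)
  have e : ((4 ^ n0 : ℕ) : ℝ) ^ k * (((4 ^ n0 : ℕ) : ℝ) * x 1)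
      = x 1 * 2 ^ (2 * (1 + k) * n0) := by
    have h4 : ((4 ^ n0 : ℕ) : ℝ) = 2 ^ (2 * n0) := by
      rw [pow_mul]
      norm_num
    rw [h4, ← mul_assoc, ← pow_succ, ← pow_mul, mul_comm]
    congr 2
    ring
  rw [abs_mul, e, mul_assoc a b]
  exact mul_le_mul (abs_sum_translate_le ha hP _ _) (abs_sum_even_translate_le hb hQ _ _ _)
    (abs_nonneg _) ((abs_nonneg _).trans (ha 0))

theorem two_rpow_sum_evenNbhd (ε M : ℝ) (K : ℕ) (y : ℝ) :
    (2 : ℝ) ^ (∑ k ∈ Finset.range K, evenNbhd ε (M ^ k * y)) = scaleProd ε M K y := by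
  rw [Real.rpow_sum_of_pos (by norm_num), scaleProd]
  refine Finset.prod_congr rfl fun k _ => ?_
  rcases evenNbhd_eq_or ε (M ^ k * y) with h | h <;> rw [h] <;> norm_num

theorem integral_scaleProd_mul_le (n0 : ℕ) :
    ∫ y in (-1 : ℝ)..1, scaleProd ((2 : ℝ) ^ n0)⁻¹ ((4 ^ n0 : ℕ) : ℝ) (2 ^ n0)
      (((4 ^ n0 : ℕ) : ℝ) * y) ≤ 2 * Real.exp 1 := by
  rw [(scaleProd_periodic _ _ _).integral_comp_nat_mul (intervalIntegrable_scaleProd _ _ _)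
    (by positivity) (r := 1) (n := 4 ^ n0) (by simp), integral_scaleProd, one_mul]
  have h : (0 : ℝ) < 2 ^ n0 := by positivity
  gcongr
  calc (1 + ((2 : ℝ) ^ n0)⁻¹) ^ (2 ^ n0) ≤ Real.exp ((2 : ℝ) ^ n0)⁻¹ ^ (2 ^ n0) := by
        gcongr
        linarith [Real.add_one_le_exp ((2 : ℝ) ^ n0)⁻¹]
    _ = Real.exp 1 := by
        rw [← Real.exp_nat_mul]
        push_cast
        rw [mul_inv_cancel₀ h.ne']

theorem lintegral_fin_two_mul {u v : ℝ → ℝ≥0∞} (hu : Measurable u) (hv : Measurable v) :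
    ∫⁻ x : Fin 2 → ℝ, u (x 0) * v (x 1) = (∫⁻ t, u t) * ∫⁻ t, v t := by
  rw [← lintegral_prod_mul hu.aemeasurable hv.aemeasurable]
  exact (volume_preserving_finTwoArrow ℝ).lintegral_comp
    (f := fun z : ℝ × ℝ => u z.1 * v z.2) (by fun_prop)

theorem exists_lintegral_fTest_pow_le {P Q : ℝ → ℝ} {a b : ℝ} (ha : ∀ t, |P t| ≤ a)
    (hb : ∀ t, |Q t| ≤ b) (hP : Function.support P ⊆ Set.Ioo 0 1)
    (hQ : Function.support Q ⊆ Set.Ioo (-1) 1) {q : ℕ} (hq : q ≠ 0) :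
    ∃ C : ℝ, 0 ≤ C ∧ ∀ n0 : ℕ, 1 ≤ n0 →
      ∫⁻ x, ‖fTest P Q n0 x‖ₑ ^ q ≤ ENNReal.ofReal C := by
  have ha0 : 0 ≤ a := (abs_nonneg _).trans (ha 0)
  have hb0 : 0 ≤ b := (abs_nonneg _).trans (hb 0)
  obtain ⟨C, hC0, hC⟩ := exists_pow_le_const_mul_two_pow q
  refine ⟨(a * b) ^ q * C * (2 * Real.exp 1), by positivity, fun n0 hn => ?_⟩
  set ε : ℝ := ((2 : ℝ) ^ n0)⁻¹
  set M : ℝ := ((4 ^ n0 : ℕ) : ℝ)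
  set S : ℝ → ℝ := fun y => scaleProd ε M (2 ^ n0) (M * y)
  have hSm : Measurable S := (measurable_scaleProd ε M _).comp (by fun_prop)
  have hS0 : ∀ y, 0 ≤ S y := fun y => scaleProd_nonneg _ _ _ _
  have hpt : ∀ x : Fin 2 → ℝ, ‖fTest P Q n0 x‖ₑ ^ q ≤ ENNReal.ofReal ((a * b) ^ q * C) *
      ((Set.Icc (0 : ℝ) 1).indicator 1 (x 0) *
        (Set.Ioc (-1 : ℝ) 1).indicator (fun y => ENNReal.ofReal (S y)) (x 1)) := by
    intro x
    by_cases hx : fTest P Q n0 x = 0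
    · simp [hx, hq]
    obtain ⟨h0, h1⟩ := fTest_support hP hQ hn hx
    rw [Set.indicator_of_mem h0, Set.indicator_of_mem h1, Pi.one_apply, one_mul,
      ← ENNReal.ofReal_mul (by positivity), ← ofReal_norm, ← ENNReal.ofReal_pow (norm_nonneg _)]
    refine ENNReal.ofReal_le_ofReal ?_
    have hN := Finset.sum_nonneg fun k (_ : k ∈ Finset.range (2 ^ n0)) =>
      evenNbhd_nonneg ε (M ^ k * (M * x 1))
    calc ‖fTest P Q n0 x‖ ^ q
        ≤ (a * b * ∑ k ∈ Finset.range (2 ^ n0), evenNbhd ε (M ^ k * (M * x 1))) ^ q :=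
          pow_le_pow_left₀ (norm_nonneg _) (abs_fTest_le ha hb hP hQ n0 x) q
      _ ≤ (a * b) ^ q *
          (C * 2 ^ (∑ k ∈ Finset.range (2 ^ n0), evenNbhd ε (M ^ k * (M * x 1)))) := by
          rw [mul_pow]
          exact mul_le_mul_of_nonneg_left (hC _ hN) (by positivity)
      _ = (a * b) ^ q * C * S (x 1) := by rw [two_rpow_sum_evenNbhd, mul_assoc]
  refine (lintegral_mono hpt).trans ?_
  rw [lintegral_const_mul' _ _ ENNReal.ofReal_ne_top, lintegral_fin_two_mul
    (measurable_one.indicator measurableSet_Icc)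
    (hSm.ennreal_ofReal.indicator measurableSet_Ioc), lintegral_indicator_one measurableSet_Icc,
    lintegral_indicator measurableSet_Ioc, Real.volume_Icc, sub_zero, ENNReal.ofReal_one, one_mul,
    ENNReal.ofReal_mul (p := (a * b) ^ q * C) (by positivity)]
  refine mul_le_mul_right ?_ _
  have hSi : IntegrableOn S (Set.Ioc (-1) 1) := by
    refine Measure.integrableOn_of_bounded (M := 2 ^ (2 ^ n0)) (by simp)
      hSm.aestronglyMeasurable (Eventually.of_forall fun y => ?_)
    rw [Real.norm_eq_abs, abs_of_nonneg (hS0 y)]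
    exact scaleProd_le _ _ _ _
  rw [← ofReal_integral_eq_lintegral_ofReal hSi (Eventually.of_forall hS0),
    ← intervalIntegral.integral_of_le (by norm_num)]
  exact ENNReal.ofReal_le_ofReal (integral_scaleProd_mul_le n0)

end TestFunction

section TensorProduct
open FourierTransform

theorem lintegral_comp_add_sub_sq_le {G : ℝ → ℝ} {K : NNReal} (hG : LipschitzWith K G)
    (t : ℝ) :
    ∫⁻ x, ‖((G (x + t) : ℝ) : ℂ) - ((G x : ℝ) : ℂ)‖ₑ ^ 2
      ≤ 2 * (K : ℝ≥0∞) ^ 2 * volume (tsupport G) * ‖t‖ₑ ^ 2 := by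
  have hm : MeasurableSet (tsupport G) := (isClosed_tsupport G).measurableSet
  have hle : ∀ x, ‖((G (x + t) : ℝ) : ℂ) - ((G x : ℝ) : ℂ)‖ₑ ≤ K * ‖t‖ₑ := by
    intro x
    rw [← Complex.ofReal_sub, ← ofReal_norm, Complex.norm_real, ofReal_norm]
    have := hG.edist_le_mul (x + t) x
    rwa [edist_eq_enorm_sub, edist_eq_enorm_sub, add_sub_cancel_left] at this
  have hpt : ∀ x, ‖((G (x + t) : ℝ) : ℂ) - ((G x : ℝ) : ℂ)‖ₑ ^ 2
      ≤ (K * ‖t‖ₑ) ^ 2 * ((tsupport G).indicator 1 (x + t) + (tsupport G).indicator 1 x) := by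
    intro x
    by_cases h1 : x + t ∈ tsupport G
    · refine (pow_le_pow_left₀ zero_le (hle x) 2).trans (le_mul_of_one_le_right zero_le ?_)
      simp [h1]
    by_cases h2 : x ∈ tsupport G
    · refine (pow_le_pow_left₀ zero_le (hle x) 2).trans (le_mul_of_one_le_right zero_le ?_)
      simp [h2]
    · simp [image_eq_zero_of_notMem_tsupport h1, image_eq_zero_of_notMem_tsupport h2]
  have hi : Measurable ((tsupport G).indicator (1 : ℝ → ℝ≥0∞)) := measurable_one.indicator hm
  refine (lintegral_mono hpt).trans (le_of_eq ?_)
  rw [lintegral_const_mul _ (by fun_prop), lintegral_add_right _ hi,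
    lintegral_add_right_eq_self (fun x => (tsupport G).indicator (1 : ℝ → ℝ≥0∞) x),
    lintegral_indicator_one hm]
  ring

/-- The Fourier transform of a compactly supported Lipschitz function on the line is integrable. -/
theorem integrable_fourier_of_lipschitz {G : ℝ → ℝ} {K : NNReal} (hG : LipschitzWith K G)
    (hs : HasCompactSupport G) : Integrable (𝓕 fun t => ((G t : ℝ) : ℂ)) := by
  have hc : Continuous fun t => ((G t : ℝ) : ℂ) := Complex.continuous_ofReal.comp hG.continuous
  have hcs : HasCompactSupport fun t => ((G t : ℝ) : ℂ) :=
    hs.comp_left (g := fun r : ℝ => (r : ℂ)) Complex.ofReal_zero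
  have hf : Integrable fun t => ((G t : ℝ) : ℂ) := hc.integrable_of_hasCompactSupport hcs
  have hf2 : MemLp (fun t => ((G t : ℝ) : ℂ)) 2 := hc.memLp_of_hasCompactSupport hcs
  have hFc := continuous_fourier_of_integrable hf
  set g := 𝓕 fun t => ((G t : ℝ) : ℂ) with hg
  have h1 : Integrable fun ξ => ‖g ξ‖ ^ 2 :=
    (memLp_fourier hf hf2).integrable_norm_pow (by norm_num)
  have hC := lintegral_inner_fourier_sq_le hf hf2 (1 : ℝ) (fun t => by
    simpa using lintegral_comp_add_sub_sq_le hG t)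
  have h2 : Integrable fun ξ : ℝ => ξ ^ 2 * ‖g ξ‖ ^ 2 := by
    refine ⟨by fun_prop, ?_⟩
    rw [hasFiniteIntegral_iff_enorm]
    refine lt_of_le_of_lt (le_of_eq ?_) (hC.trans_lt ?_)
    · refine lintegral_congr fun ξ => ?_
      simp [hg]
    · exact ENNReal.mul_lt_top (by finiteness) hs.measure_lt_top
  refine ((h1.add h2).add integrable_inv_one_add_sq).mono' hFc.aestronglyMeasurable
    (Eventually.of_forall fun ξ => ?_)
  simp only [Pi.add_apply]
  have hpos : (0 : ℝ) < 1 + ξ ^ 2 := by positivity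
  have e : ‖g ξ‖ ^ 2 + ξ ^ 2 * ‖g ξ‖ ^ 2 + (1 + ξ ^ 2)⁻¹
      = ((1 + ξ ^ 2) * ‖g ξ‖ - 1) ^ 2 / (1 + ξ ^ 2) + 2 * ‖g ξ‖ := by
    field_simp
    ring
  rw [e]
  have : 0 ≤ ((1 + ξ ^ 2) * ‖g ξ‖ - 1) ^ 2 / (1 + ξ ^ 2) := by positivity
  linarith [norm_nonneg (g ξ)]

theorem integral_euclidean_mul (u v : ℝ → ℂ) :
    ∫ x : EuclideanSpace ℝ (Fin 2), u (x 0) * v (x 1) = (∫ t, u t) * ∫ t, v t := by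
  rw [← integral_prod_mul]
  have h1 := (PiLp.volume_preserving_ofLp (Fin 2)).integral_comp
    (MeasurableEquiv.toLp 2 (Fin 2 → ℝ)).symm.measurableEmbedding
    (fun x : Fin 2 → ℝ => u (x 0) * v (x 1))
  have h2 := (volume_preserving_finTwoArrow ℝ).integral_comp
    MeasurableEquiv.finTwoArrow.measurableEmbedding (fun z : ℝ × ℝ => u z.1 * v z.2)
  exact h1.trans h2

theorem integrable_euclidean_mul {u v : ℝ → ℂ} (hu : Integrable u) (hv : Integrable v) :
    Integrable fun x : EuclideanSpace ℝ (Fin 2) => u (x 0) * v (x 1) := by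
  have h2 := ((volume_preserving_finTwoArrow ℝ).integrable_comp_emb
    MeasurableEquiv.finTwoArrow.measurableEmbedding).2 (hu.mul_prod hv)
  exact ((PiLp.volume_preserving_ofLp (Fin 2)).integrable_comp_emb
    (MeasurableEquiv.toLp 2 (Fin 2 → ℝ)).symm.measurableEmbedding).2 h2

theorem fourier_tensor (u v : ℝ → ℂ) (ξ : EuclideanSpace ℝ (Fin 2)) :
    𝓕 (fun x : EuclideanSpace ℝ (Fin 2) => u (x 0) * v (x 1)) ξ = 𝓕 u (ξ 0) * 𝓕 v (ξ 1) := by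
  rw [Real.fourier_real_eq_integral_exp_smul, Real.fourier_real_eq_integral_exp_smul,
    ← integral_euclidean_mul, Real.fourier_eq']
  refine integral_congr_ae (Eventually.of_forall fun x => ?_)
  simp only [smul_eq_mul, PiLp.inner_apply, Fin.sum_univ_two, RCLike.inner_apply, conj_trivial]
  have : (((-2 * Real.pi * (ξ 0 * x 0 + ξ 1 * x 1) : ℝ)) : ℂ) * Complex.I
      = ((-2 * Real.pi * x 0 * ξ 0 : ℝ) : ℂ) * Complex.I
        + ((-2 * Real.pi * x 1 * ξ 1 : ℝ) : ℂ) * Complex.I := by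
    push_cast
    ring
  rw [this, Complex.exp_add]
  ring

/-- The rescaled profiles at scale `T⁻¹` making up `fTest`. -/
noncomputable def dilate (P : ℝ → ℝ) (c d : ℝ) (t : ℝ) : ℂ := ((P (t * c - d) : ℝ) : ℂ)

/-- Index set of the blocks in `fTest`: scale and positions. -/
def blockIndex (n0 : ℕ) : Finset (Σ _ : ℕ, ℕ × ℕ) :=
  (Finset.Icc 1 (2 ^ n0)).sigma fun k =>
    Finset.range (2 ^ (2 * k * n0)) ×ˢ Finset.range (2 ^ (2 * k * n0 - 1))

theorem fTest_eq_sum_dilate (P Q : ℝ → ℝ) (n0 : ℕ) (x : Fin 2 → ℝ) :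
    ((fTest P Q n0 x : ℝ) : ℂ) = ∑ s ∈ blockIndex n0,
      dilate P (2 ^ (2 * s.1 * n0)) s.2.1 (x 0) *
        dilate Q (2 ^ (2 * s.1 * n0) * 2 ^ n0) (2 * s.2.2 * 2 ^ n0) (x 1) := by
  simp only [fTest, gBlock_dyadic, blockIndex, Finset.sum_sigma, Finset.sum_product, dilate]
  push_cast
  refine Finset.sum_congr rfl fun k _ => Finset.sum_congr rfl fun i _ =>
    Finset.sum_congr rfl fun j _ => ?_
  congr 4
  ring

theorem integrable_dilate {P : ℝ → ℝ} (hP : Integrable P) {c : ℝ} (hc : c ≠ 0) (d : ℝ) :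
    Integrable (dilate P c d) :=
  ((hP.comp_sub_right d).comp_mul_right' hc).ofReal

theorem integral_dilate {P : ℝ → ℝ} (hP : ∫ t, P t = 0) (c d : ℝ) :
    ∫ t, dilate P c d t = 0 := by
  unfold dilate
  rw [integral_complex_ofReal, Measure.integral_comp_mul_right (fun t => P (t - d)),
    integral_sub_right_eq_self P, hP]
  simp

theorem integrable_fourier_dilate {G : ℝ → ℝ} {K : NNReal} (hG : LipschitzWith K G)
    (hs : HasCompactSupport G) {c : ℝ} (hc : c ≠ 0) (d : ℝ) : Integrable (𝓕 (dilate G c d)) := by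
  refine integrable_fourier_of_lipschitz (G := fun t => G (t * c - d)) (K := K * ‖c‖₊)
    (hG.comp (LipschitzWith.of_dist_le_mul fun x y => le_of_eq ?_))
    (hs.comp_homeomorph ((Homeomorph.mulRight₀ c hc).trans (Homeomorph.subRight d)))
  rw [Real.dist_eq, sub_sub_sub_cancel_right, ← sub_mul, abs_mul, mul_comm]
  rfl

theorem fourier_dilate_deriv {A A' : ℝ → ℝ} (hA : ∀ t, HasDerivAt A (A' t) t)
    (hAi : Integrable A) (hA'i : Integrable A') {c : ℝ} (hc : c ≠ 0) (d ξ : ℝ) :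
    (c : ℂ) * 𝓕 (dilate A' c d) ξ = (2 * Real.pi * Complex.I * ξ) * 𝓕 (dilate A c d) ξ := by
  have hd : ∀ t, HasDerivAt (dilate A c d) ((c : ℂ) * dilate A' c d t) t := by
    intro t
    have h1 : HasDerivAt (fun t : ℝ => t * c - d) c t := by
      simpa using ((hasDerivAt_id t).mul_const c).sub_const d
    have h2 := ((hA (t * c - d)).comp t h1).ofReal_comp
    rw [Complex.ofReal_mul, mul_comm] at h2
    exact h2
  have hde : deriv (dilate A c d) = (c : ℂ) • dilate A' c d := funext fun t => (hd t).deriv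
  have h := Real.fourier_deriv (integrable_dilate hAi hc d) (fun t => (hd t).differentiableAt)
    (by rw [hde]; exact (integrable_dilate hA'i hc d).smul _)
  have h2 := congrFun h ξ
  rw [hde] at h2
  rw [← smul_eq_mul, ← smul_eq_mul, ← h2]
  exact (congrFun (VectorFourier.fourierIntegral_const_smul _ _ _ _ _) ξ).symm

theorem fourier_fTest {P Q : ℝ → ℝ} (hP : Integrable P) (hQ : Integrable Q) (n0 : ℕ)
    (ξ : EuclideanSpace ℝ (Fin 2)) :
    𝓕 (fun y : EuclideanSpace ℝ (Fin 2) => ((fTest P Q n0 y.ofLp : ℝ) : ℂ)) ξ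
      = ∑ s ∈ blockIndex n0, 𝓕 (dilate P (2 ^ (2 * s.1 * n0)) s.2.1) (ξ 0) *
        𝓕 (dilate Q (2 ^ (2 * s.1 * n0) * 2 ^ n0) (2 * s.2.2 * 2 ^ n0)) (ξ 1) := by
  simp only [fTest_eq_sum_dilate, ← fourier_tensor]
  simp only [Real.fourier_eq, Finset.smul_sum]
  refine integral_finsetSum _ fun s _ => (Real.fourierIntegral_convergent_iff ξ).2 ?_
  exact integrable_euclidean_mul (integrable_dilate hP (by positivity) _)
    (integrable_dilate hQ (by positivity) _)

end TensorProduct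

section Assembly
open FourierTransform

theorem fourierT_eq_fourier (u : (Fin 2 → ℝ) → ℂ) (η : EuclideanSpace ℝ (Fin 2)) :
    fourierT 2 u ((2 * Real.pi) • η).ofLp
      = 𝓕 (fun y : EuclideanSpace ℝ (Fin 2) => u y.ofLp) η := by
  rw [fourierT, Real.fourier_eq', ← (PiLp.volume_preserving_ofLp (Fin 2)).integral_comp
    (MeasurableEquiv.toLp 2 (Fin 2 → ℝ)).symm.measurableEmbedding]
  refine integral_congr_ae (Eventually.of_forall fun y => ?_)
  simp only [smul_eq_mul, PiLp.inner_apply, Fin.sum_univ_two, RCLike.inner_apply, conj_trivial,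
    PiLp.smul_apply]
  congr 2
  push_cast
  ring

theorem invFourierT_eq_fourierInv (v : (Fin 2 → ℝ) → ℂ) (x : Fin 2 → ℝ) :
    invFourierT 2 v x
      = 𝓕⁻ (fun η : EuclideanSpace ℝ (Fin 2) => v ((2 * Real.pi) • η).ofLp) (WithLp.toLp 2 x) := by
  have h := Measure.integral_comp_smul (volume : Measure (EuclideanSpace ℝ (Fin 2)))
    (fun ξ => Complex.exp (Complex.I * ((∑ t, x t * ξ t : ℝ) : ℂ)) * v ξ.ofLp) (2 * Real.pi)
  have h2 := (PiLp.volume_preserving_ofLp (Fin 2)).integral_comp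
    (MeasurableEquiv.toLp 2 (Fin 2 → ℝ)).symm.measurableEmbedding
    (fun ξ : Fin 2 → ℝ => Complex.exp (Complex.I * ((∑ t, x t * ξ t : ℝ) : ℂ)) * v ξ)
  rw [h2, finrank_euclideanSpace_fin, abs_of_pos (by positivity), Complex.real_smul,
    Complex.ofReal_inv] at h
  rw [invFourierT, ← h, Real.fourierInv_eq']
  refine integral_congr_ae (Eventually.of_forall fun y => ?_)
  simp only [smul_eq_mul, PiLp.inner_apply, Fin.sum_univ_two, RCLike.inner_apply, conj_trivial,
    PiLp.smul_apply]
  congr 2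
  push_cast
  ring

theorem riesz_two_eq (i : Fin 2) (u : (Fin 2 → ℝ) → ℝ) (x : Fin 2 → ℝ) :
    riesz 2 i u x = -Complex.I * 𝓕⁻ (fun η : EuclideanSpace ℝ (Fin 2) =>
      ((η i / ‖η‖ : ℝ) : ℂ) * 𝓕 (fun y : EuclideanSpace ℝ (Fin 2) => ((u y.ofLp : ℝ) : ℂ)) η)
      (WithLp.toLp 2 x) := by
  rw [riesz, invFourierT_eq_fourierInv]
  refine congrArg (fun g : EuclideanSpace ℝ (Fin 2) → ℂ => -Complex.I * 𝓕⁻ g (WithLp.toLp 2 x))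
    (funext fun η => ?_)
  rw [fourierT_eq_fourier (fun y => ((u y : ℝ) : ℂ)) η]
  have hn : √(∑ t, ((2 * Real.pi) • η).ofLp t ^ 2) = 2 * Real.pi * ‖η‖ := by
    have := EuclideanSpace.norm_eq ((2 * Real.pi) • η)
    simp only [Real.norm_eq_abs, sq_abs] at this
    rw [← this, norm_smul, Real.norm_of_nonneg (by positivity)]
  rw [hn, PiLp.smul_apply, smul_eq_mul, mul_div_mul_left _ _ (by positivity)]

/-- Trading a derivative in the first variable for one in the second. -/
theorem coord_mul_fourier_fTest {A A' B D : ℝ → ℝ} (hA : ∀ t, HasDerivAt A (A' t) t)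
    (hD : ∀ t, HasDerivAt D (B t) t) (hAi : Integrable A) (hA'i : Integrable A')
    (hBi : Integrable B) (hDi : Integrable D) (n0 : ℕ) (ξ : EuclideanSpace ℝ (Fin 2)) :
    (ξ 0 : ℂ) * 𝓕 (fun y : EuclideanSpace ℝ (Fin 2) => ((fTest A B n0 y.ofLp : ℝ) : ℂ)) ξ
      = ((2 ^ n0 : ℝ) : ℂ)⁻¹ * (ξ 1 *
        𝓕 (fun y : EuclideanSpace ℝ (Fin 2) => ((fTest A' D n0 y.ofLp : ℝ) : ℂ)) ξ) := by
  rw [fourier_fTest hAi hBi, fourier_fTest hA'i hDi, Finset.mul_sum, Finset.mul_sum,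
    Finset.mul_sum]
  refine Finset.sum_congr rfl fun s _ => ?_
  set T : ℝ := 2 ^ (2 * s.1 * n0) with hT
  have hT0 : T ≠ 0 := by positivity
  have hE0 : (2 ^ n0 : ℝ) ≠ 0 := by positivity
  have h1 := fourier_dilate_deriv hA hAi hA'i hT0 s.2.1 (ξ 0)
  have h2 := fourier_dilate_deriv hD hDi hBi (mul_ne_zero hT0 hE0) (2 * s.2.2 * 2 ^ n0) (ξ 1)
  have hTc : (T : ℂ) ≠ 0 := by exact_mod_cast hT0
  have hEc : ((2 ^ n0 : ℝ) : ℂ) ≠ 0 := by exact_mod_cast hE0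
  rw [Complex.ofReal_mul] at h2
  generalize ((2 ^ n0 : ℝ) : ℂ) = E at *
  have hpi : (2 * Real.pi * Complex.I : ℂ) ≠ 0 := Complex.two_pi_I_ne_zero
  generalize 𝓕 (dilate A T s.2.1) (ξ 0) = a at *
  generalize 𝓕 (dilate A' T s.2.1) (ξ 0) = a' at *
  generalize 𝓕 (dilate B (T * 2 ^ n0) (2 * s.2.2 * 2 ^ n0)) (ξ 1) = b at *
  generalize 𝓕 (dilate D (T * 2 ^ n0) (2 * s.2.2 * 2 ^ n0)) (ξ 1) = d at *
  rw [inv_mul_eq_div, eq_div_iff hEc]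
  refine mul_left_cancel₀ (mul_ne_zero hpi hTc) ?_
  linear_combination (-(T : ℂ) * E * b) * h1 + T * a' * h2

theorem riesz_fTest_eq {A A' B D : ℝ → ℝ} (hA : ∀ t, HasDerivAt A (A' t) t)
    (hD : ∀ t, HasDerivAt D (B t) t) (hAi : Integrable A) (hA'i : Integrable A')
    (hBi : Integrable B) (hDi : Integrable D) (n0 : ℕ) (x : Fin 2 → ℝ) :
    riesz 2 0 (fTest A B n0) x = -Complex.I * (((2 ^ n0 : ℝ) : ℂ)⁻¹ *
      rieszPlane (fun y => fTest A' D n0 y.ofLp) (WithLp.toLp 2 x)) := by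
  rw [riesz_two_eq, rieszPlane, Real.fourierInv_eq', Real.fourierInv_eq']
  congr 1
  rw [← integral_const_mul]
  refine integral_congr_ae (Eventually.of_forall fun ξ => ?_)
  have h := coord_mul_fourier_fTest hA hD hAi hA'i hBi hDi n0 ξ
  simp only [smul_eq_mul, Complex.ofReal_div]
  rw [div_mul_eq_mul_div, h]
  ring

theorem exists_primitive {B : ℝ → ℝ} (hB : Continuous B)
    (hB_supp : Function.support B ⊆ Set.Icc (-1) 1) (hB_int : ∫ t, B t = 0) :
    ∃ D : ℝ → ℝ, (∀ t, HasDerivAt D (B t) t) ∧ Function.support D ⊆ Set.Ioo (-1) 1 := by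
  refine ⟨fun y => ∫ t in (-1)..y, B t, fun t => intervalIntegral.integral_hasDerivAt_right
    (hB.intervalIntegrable _ _) hB.stronglyMeasurable.stronglyMeasurableAtFilter
    hB.continuousAt, fun y hy => ?_⟩
  by_contra hc
  rw [Set.mem_Ioo, not_and_or, not_lt, not_lt] at hc
  refine hy ?_
  have hsub : ∀ t, t ∉ Set.Icc (-1 : ℝ) 1 → B t = 0 := fun t ht => by
    by_contra h
    exact ht (hB_supp h)
  rcases hc with hc | hc
  · simp only
    rw [intervalIntegral.integral_symm, intervalIntegral.integral_of_le hc,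
      integral_Ioc_eq_integral_Ioo, setIntegral_eq_zero_of_forall_eq_zero, neg_zero]
    exact fun t ht => hsub t fun h => absurd ht.2 (not_lt.2 h.1)
  · simp only
    rw [intervalIntegral.integral_of_le (by linarith), ← integral_Icc_eq_integral_Ioc,
      setIntegral_eq_integral_of_forall_compl_eq_zero, hB_int]
    exact fun t ht => hsub t fun h => ht ⟨h.1, h.2.trans hc⟩

theorem support_deriv_subset_Ioo {A : ℝ → ℝ} (hA' : Continuous (deriv A))
    (hA : Function.support A ⊆ Set.Icc 0 1) :
    Function.support (deriv A) ⊆ Set.Ioo 0 1 := by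
  have h1 : Function.support (deriv A) ⊆ Set.Icc 0 1 :=
    support_deriv_subset.trans (closure_minimal hA isClosed_Icc)
  have h2 : Function.support (deriv A) ⊆ interior (Set.Icc 0 1) :=
    interior_maximal h1 hA'.isOpen_support
  rwa [interior_Icc] at h2

theorem continuous_fTest_s17 {P Q : ℝ → ℝ} (hP : Continuous P) (hQ : Continuous Q) (n0 : ℕ) :
    Continuous (fTest P Q n0) := by
  unfold fTest gBlock
  fun_prop

theorem norm_le_two_of_fTest_ne_zero {P Q : ℝ → ℝ} (hP : Function.support P ⊆ Set.Ioo 0 1)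
    (hQ : Function.support Q ⊆ Set.Ioo (-1) 1) {n0 : ℕ} (hn : 1 ≤ n0)
    {x : EuclideanSpace ℝ (Fin 2)} (hx : fTest P Q n0 x.ofLp ≠ 0) : ‖x‖ ≤ 2 := by
  obtain ⟨h0, h1⟩ := fTest_support hP hQ hn hx
  rw [EuclideanSpace.norm_eq, Fin.sum_univ_two]
  refine Real.sqrt_le_iff.2 ⟨by norm_num, ?_⟩
  simp only [Real.norm_eq_abs, sq_abs]
  nlinarith [h0.1, h0.2, h1.1, h1.2]

theorem lintegral_euclidean_eq (u : (Fin 2 → ℝ) → ℝ≥0∞) :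
    ∫⁻ y : EuclideanSpace ℝ (Fin 2), u y.ofLp = ∫⁻ x, u x :=
  (PiLp.volume_preserving_ofLp (Fin 2)).lintegral_comp_emb
    (MeasurableEquiv.toLp 2 (Fin 2 → ℝ)).symm.measurableEmbedding u

theorem exists_lintegral_rieszPlane_fTest_le {P Q : ℝ → ℝ} {KP KQ : NNReal}
    (hP : LipschitzWith KP P) (hQ : LipschitzWith KQ Q)
    (hPs : Function.support P ⊆ Set.Ioo 0 1) (hQs : Function.support Q ⊆ Set.Ioo (-1) 1)
    (hP_int : ∫ t, P t = 0) {p : ℝ} (hp : 1 < p) :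
    ∃ C : ℝ≥0∞, C ≠ ∞ ∧ ∀ n0 : ℕ, 1 ≤ n0 →
      ∫⁻ x, ‖rieszPlane (fun y => fTest P Q n0 y.ofLp) x‖ₑ ^ p ≤ C := by
  have hPc : HasCompactSupport P := HasCompactSupport.of_support_subset_isCompact
    isCompact_Icc (hPs.trans Set.Ioo_subset_Icc_self)
  have hQc : HasCompactSupport Q := HasCompactSupport.of_support_subset_isCompact
    isCompact_Icc (hQs.trans Set.Ioo_subset_Icc_self)
  have hPi : Integrable P := hP.continuous.integrable_of_hasCompactSupport hPc
  have hQi : Integrable Q := hQ.continuous.integrable_of_hasCompactSupport hQc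
  obtain ⟨a, ha⟩ := hPc.exists_bound_of_continuous hP.continuous
  obtain ⟨b, hb⟩ := hQc.exists_bound_of_continuous hQ.continuous
  obtain ⟨m, hm⟩ := exists_nat_ge p
  have hm0 : m ≠ 0 := by
    rintro rfl
    norm_num at hm
    linarith
  obtain ⟨K1, h10, hK1⟩ := exists_lintegral_fTest_pow_le ha hb hPs hQs one_ne_zero
  obtain ⟨K2, h20, hK2⟩ := exists_lintegral_fTest_pow_le ha hb hPs hQs two_ne_zero
  obtain ⟨K3, h30, hK3⟩ := exists_lintegral_fTest_pow_le ha hb hPs hQs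
    (mul_ne_zero four_ne_zero hm0)
  obtain ⟨C, hC, h⟩ := exists_lintegral_rieszPlane_rpow_le (R := 2) (K := K1 + K2 + K3) hp
    (m := m) (by linarith) (by norm_num) (by positivity)
  refine ⟨C, hC, fun n0 hn => ?_⟩
  have hcont : Continuous fun y : EuclideanSpace ℝ (Fin 2) => fTest P Q n0 y.ofLp :=
    (continuous_fTest_s17 hP.continuous hQ.continuous n0).comp (PiLp.continuous_ofLp 2 _)
  have hs : ∀ x : EuclideanSpace ℝ (Fin 2), fTest P Q n0 x.ofLp ≠ 0 → ‖x‖ ≤ 2 :=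
    fun x hx => norm_le_two_of_fTest_ne_zero hPs hQs hn hx
  have hcs : HasCompactSupport fun y : EuclideanSpace ℝ (Fin 2) => fTest P Q n0 y.ofLp :=
    HasCompactSupport.of_support_subset_isCompact (isCompact_closedBall 0 2)
      fun x hx => by simpa using hs x hx
  have hint := hcont.integrable_of_hasCompactSupport hcs (μ := volume)
  refine h _ hcont hint ((Complex.continuous_ofReal.comp hcont).memLp_of_hasCompactSupport
    (hcs.comp_left (g := fun r : ℝ => (r : ℂ)) Complex.ofReal_zero)) ?_ hs ?_ ?_ ?_ ?_
  · have e : 𝓕 (fun y : EuclideanSpace ℝ (Fin 2) => ((fTest P Q n0 y.ofLp : ℝ) : ℂ)) = _ :=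
      funext fun ξ => fourier_fTest hPi hQi n0 ξ
    rw [e]
    exact integrable_finsetSum _ fun s _ => integrable_euclidean_mul
      (integrable_fourier_dilate hP hPc (by positivity) _)
      (integrable_fourier_dilate hQ hQc (by positivity) _)
  · rw [← Complex.ofReal_eq_zero, ← integral_complex_ofReal]
    simp only [fTest_eq_sum_dilate]
    rw [integral_finsetSum _ fun s _ => integrable_euclidean_mul
      (integrable_dilate hPi (by positivity) _) (integrable_dilate hQi (by positivity) _)]
    refine Finset.sum_eq_zero fun s _ => ?_
    rw [integral_euclidean_mul, integral_dilate hP_int, zero_mul]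
  · rw [integral_norm_eq_lintegral_enorm hint.aestronglyMeasurable,
      lintegral_euclidean_eq fun x => ‖fTest P Q n0 x‖ₑ]
    have := hK1 n0 hn
    simp only [pow_one] at this
    exact (ENNReal.toReal_le_of_le_ofReal h10 this).trans (by linarith)
  · rw [lintegral_euclidean_eq fun x => ‖fTest P Q n0 x‖ₑ ^ 2]
    exact (hK2 n0 hn).trans (ENNReal.ofReal_le_ofReal (by linarith))
  · rw [lintegral_euclidean_eq fun x => ‖fTest P Q n0 x‖ₑ ^ (4 * m)]
    exact (hK3 n0 hn).trans (ENNReal.ofReal_le_ofReal (by linarith))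

end Assembly

theorem fTest_riesz_bound
    (A B : ℝ → ℝ) (KA KB : NNReal)
    (hA_lip : LipschitzWith KA A) (hB_lip : LipschitzWith KB B)
    (hA_supp : Function.support A ⊆ Set.Icc 0 1) (hA_int : ∫ t, A t = 0)
    (hB_supp : Function.support B ⊆ Set.Icc (-1) 1)
    (hA_diff : Differentiable ℝ A) (KA' : NNReal)
    (hA'_lip : LipschitzWith KA' (deriv A))
    (hB_int : ∫ t, B t = 0) :
    ∀ p : ℝ, 1 < p → ∃ Cp : ℝ, 0 < Cp ∧ ∀ n0 : ℕ, 1 ≤ n0 →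
      eLpNorm (riesz 2 0 (fTest A B n0)) (ENNReal.ofReal p) volume ≤
        ENNReal.ofReal (Cp * 2 ^ (-(n0 : ℤ))) := by
  intro p hp
  have hp0 : 0 < p := by linarith
  have hAc : HasCompactSupport A := HasCompactSupport.of_support_subset_isCompact
    isCompact_Icc hA_supp
  have hBc : HasCompactSupport B := HasCompactSupport.of_support_subset_isCompact
    isCompact_Icc hB_supp
  have hAi : Integrable A := hA_lip.continuous.integrable_of_hasCompactSupport hAc
  have hBi : Integrable B := hB_lip.continuous.integrable_of_hasCompactSupport hBc
  have hA's := support_deriv_subset_Ioo hA'_lip.continuous hA_supp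
  have hA'i : Integrable (deriv A) := hA'_lip.continuous.integrable_of_hasCompactSupport hAc.deriv
  obtain ⟨D, hD, hDs⟩ := exists_primitive hB_lip.continuous hB_supp hB_int
  obtain ⟨b, hb⟩ := hBc.exists_bound_of_continuous hB_lip.continuous
  have hDd : Differentiable ℝ D := fun t => (hD t).differentiableAt
  have hDlip : LipschitzWith b.toNNReal D := lipschitzWith_of_nnnorm_deriv_le hDd fun t => by
    rw [(hD t).deriv, ← NNReal.coe_le_coe, coe_nnnorm]
    exact (hb t).trans (Real.le_coe_toNNReal b)
  have hDi : Integrable D := hDd.continuous.integrable_of_hasCompactSupport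
    (HasCompactSupport.of_support_subset_isCompact isCompact_Icc
      (hDs.trans Set.Ioo_subset_Icc_self))
  have hA'_int : ∫ t, deriv A t = 0 :=
    integral_eq_zero_of_hasDerivAt_of_integrable (fun t => (hA_diff t).hasDerivAt) hA'i hAi
  obtain ⟨C, hC, h⟩ := exists_lintegral_rieszPlane_fTest_le hA'_lip hDlip hA's hDs hA'_int hp
  refine ⟨(C ^ (1 / p)).toReal + 1, by positivity, fun n0 hn => ?_⟩
  have hCp : C ^ (1 / p) ≠ ∞ := ENNReal.rpow_ne_top_of_nonneg (by positivity) hC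
  have hrw : ∀ x, ‖riesz 2 0 (fTest A B n0) x‖ₑ = ENNReal.ofReal (2 ^ (-(n0 : ℤ))) *
      ‖rieszPlane (fun y => fTest (deriv A) D n0 y.ofLp) (WithLp.toLp 2 x)‖ₑ := by
    intro x
    rw [riesz_fTest_eq (fun t => (hA_diff t).hasDerivAt) hD hAi hA'i hBi hDi, enorm_mul, enorm_mul,
      ← Complex.ofReal_inv, ← ofReal_norm, ← ofReal_norm, norm_neg, Complex.norm_I,
      Complex.norm_real, ENNReal.ofReal_one, one_mul, zpow_neg, zpow_natCast,
      Real.norm_of_nonneg (by positivity)]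
  rw [eLpNorm_eq_lintegral_rpow_enorm_toReal (by simpa using hp0) ENNReal.ofReal_ne_top,
    ENNReal.toReal_ofReal hp0.le]
  simp only [hrw, ENNReal.mul_rpow_of_nonneg _ _ hp0.le]
  rw [lintegral_const_mul' _ _ (by finiteness), ENNReal.mul_rpow_of_nonneg _ _ (by positivity),
    ← ENNReal.rpow_mul, mul_one_div_cancel hp0.ne', ENNReal.rpow_one, mul_comm,
    ENNReal.ofReal_mul (by positivity)]
  gcongr
  have h2 := lintegral_euclidean_eq fun x =>
    ‖rieszPlane (fun y => fTest (deriv A) D n0 y.ofLp) (WithLp.toLp 2 x)‖ₑ ^ p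
  rw [← h2]
  calc _ ≤ C ^ (1 / p) := by
        gcongr
        exact h n0 hn
    _ = ENNReal.ofReal (C ^ (1 / p)).toReal := (ENNReal.ofReal_toReal hCp).symm
    _ ≤ _ := ENNReal.ofReal_le_ofReal (by linarith)
end
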